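/- arXiv:1509.03282 — 6 statements merged into one kernel-verified Lean document; each statement's English description precedes it below -/
import Mathlib

section
/- Let D be a finite oriented graph missing a matching and let C = a₁b₁, a₂b₂, …, a_kb_k be a directed cycle of its dependency digraph Δ. Set a_{k+1} = a₁ and b_{k+1} = b₁ if k is odd, and a_{k+1} = b₁ and b_{k+1} = a₁ if k is even. Then in the induced subdigraph D[K(C)], for every i = 1,…,k: N⁺(aᵢ) = N⁻(bᵢ), N⁻(aᵢ) = N⁺(bᵢ), N⁺⁺(aᵢ) = (N⁻(aᵢ) ∪ {bᵢ}) \ {b_{i+1}}, and N⁺⁺(bᵢ) = (N⁻(bᵢ) ∪ {aᵢ}) \ {a_{i+1}}. -/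
variable {V : Type*}

/-- Out-neighborhood of `v`. -/
def Nplus (E : V → V → Prop) (v : V) : Set V := {w | E v w}

/-- In-neighborhood of `v`. -/
def Nminus (E : V → V → Prop) (v : V) : Set V := {w | E w v}

/-- Second out-neighborhood: vertices at directed distance exactly 2 from `v`. -/
def Npp (E : V → V → Prop) (v : V) : Set V :=
  {w | w ≠ v ∧ ¬ E v w ∧ ∃ u, E v u ∧ E u w}

/-- Weight of a set of vertices. -/
noncomputable def wt (ω : V → ℝ) (S : Set V) : ℝ := ∑ᶠ x ∈ S, ω x

/-- Total weight of the forward arcs of the ordering `L`. -/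
noncomputable def fwdW {n : ℕ} (E : V → V → Prop) (ω : V → ℝ) (L : Fin n ≃ V) : ℝ :=
  ∑ᶠ p ∈ {p : Fin n × Fin n | p.1 < p.2 ∧ E (L p.1) (L p.2)}, ω (L p.1) * ω (L p.2)

/-- `L` is a weighted median order of `(E, ω)`. -/
def IsWMedian {n : ℕ} (E : V → V → Prop) (ω : V → ℝ) (L : Fin n ≃ V) : Prop :=
  ∀ L' : Fin n ≃ V, fwdW E ω L' ≤ fwdW E ω L

/-- Number of forward arcs of the ordering `L`. -/
noncomputable def fwdCount {n : ℕ} (E : V → V → Prop) (L : Fin n ≃ V) : ℕ :=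
  Set.ncard {p : Fin n × Fin n | p.1 < p.2 ∧ E (L p.1) (L p.2)}

/-- `L` is a (unweighted) median order of `E`. -/
def IsMedian {n : ℕ} (E : V → V → Prop) (L : Fin n ≃ V) : Prop :=
  ∀ L' : Fin n ≃ V, fwdCount E L' ≤ fwdCount E L

/-- `K` is an interval of the digraph `E`. -/
def IsInterval (E : V → V → Prop) (K : Set V) : Prop :=
  ∀ u ∈ K, ∀ v ∈ K,
    Nplus E u \ K = Nplus E v \ K ∧ Nminus E u \ K = Nminus E v \ K

/-- `K` occurs as a set of consecutive vertices of the ordering `L`. -/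
def OrderConvex {n : ℕ} (L : Fin n ≃ V) (K : Set V) : Prop :=
  ∀ i j k : Fin n, i ≤ j → j ≤ k → L i ∈ K → L k ∈ K → L j ∈ K

/-- `{x, y}` is a missing edge. -/
def IsMissing (E : V → V → Prop) (x y : V) : Prop := x ≠ y ∧ ¬ E x y ∧ ¬ E y x

/-- The unordered pair `e` is a missing edge. -/
def IsMissingS (E : V → V → Prop) (e : Sym2 V) : Prop :=
  ∃ x y, e = s(x, y) ∧ IsMissing E x y

/-- The labelled losing relation: the missing edge `x₁y₁` loses to the missing edge `x₂y₂`
with this labelling of the endpoints. -/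
def LosesLab (E : V → V → Prop) (x1 y1 x2 y2 : V) : Prop :=
  IsMissing E x1 y1 ∧ IsMissing E x2 y2 ∧
  E x1 x2 ∧ y2 ∉ Nplus E x1 ∪ Npp E x1 ∧ E y1 y2 ∧ x2 ∉ Nplus E y1 ∪ Npp E y1

/-- The losing relation on missing edges: the arcs of the dependency digraph `Δ`. -/
def Loses (E : V → V → Prop) (e f : Sym2 V) : Prop :=
  ∃ x1 y1 x2 y2, e = s(x1, y1) ∧ f = s(x2, y2) ∧ LosesLab E x1 y1 x2 y2

/-- One merging step used to generate the sets `K(ξ)`. -/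
def MissTouch (E : V → V → Prop) (u v : V) : Prop :=
  IsMissing E u v ∨ ∃ e f : Sym2 V, Loses E e f ∧ u ∈ e ∧ v ∈ f

/-- `u` and `v` lie in the same set `K(ξ)` (or `u = v`). -/
def SameK (E : V → V → Prop) : V → V → Prop := Relation.EqvGen (MissTouch E)

/-- `J(f)`: equal to `{f}` when `f` is whole, and to `K(ξ)` for the unique connected
component `ξ` of the interval graph with `f ∈ K(ξ)` otherwise. -/
def Jset (E : V → V → Prop) (f : V) : Set V := {v | SameK E f v}

/-- A good digraph: all sets `K(ξ)` are intervals. -/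
def GoodDigraph (E : V → V → Prop) : Prop := ∀ f : V, IsInterval E (Jset E f)

/-- The set `G_L` of good vertices of the ordering `L`. -/
def GoodSet {n : ℕ} (E : V → V → Prop) (L : Fin (n + 1) ≃ V) : Set V :=
  {w | w ∉ Nplus E (L (Fin.last n)) ∧
    ∃ i j : Fin (n + 1), i ≤ j ∧ w = L j ∧ E (L (Fin.last n)) (L i) ∧ E (L i) w}

/-- The subdigraph of `E` induced on `K`. -/
def ERestrict (E : V → V → Prop) (K : Set V) : V → V → Prop :=
  fun x y => x ∈ K ∧ y ∈ K ∧ E x y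

/-- `(a, b)` is a convenient orientation of the missing edge `ab`. -/
def ConvenientFor (E : V → V → Prop) (a b : V) : Prop :=
  ∀ v, v ≠ a → v ≠ b → E v a → b ∈ Nplus E v ∪ Npp E v

/-- Two missing edges lie in the same connected component of the dependency digraph. -/
def DeltaConn (E : V → V → Prop) : Sym2 V → Sym2 V → Prop :=
  Relation.ReflTransGen (fun e f => Loses E e f ∨ Loses E f e)

/-- The connected component of `e` in the dependency digraph is a (maximal directed) path,
i.e. it contains a missing edge of in-degree zero. -/
def InPathComp (E : V → V → Prop) (e : Sym2 V) : Prop :=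
  ∃ f, IsMissingS E f ∧ DeltaConn E e f ∧ ¬ ∃ g, Loses E g f

theorem LosesLab.swap12 {V : Type*} {E : V → V → Prop} {x y u v : V}
    (h : LosesLab E x y u v) : LosesLab E y x v u := by
  obtain ⟨⟨h1, h2, h3⟩, ⟨h4, h5, h6⟩, h7, h8, h9, h10⟩ := h
  exact ⟨⟨h1.symm, h3, h2⟩, ⟨h4.symm, h6, h5⟩, h9, h10, h7, h8⟩

theorem LosesLab.det12 {V : Type*} {E : V → V → Prop} {x y u v u' v' : V}
    (h : LosesLab E x y u v) (h' : LosesLab E x y u' v') (hs : s(u, v) = s(u', v')) :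
    u = u' ∧ v = v' := by
  rcases Sym2.eq_iff.1 hs with h0 | ⟨rfl, rfl⟩
  · exact h0
  · exact absurd (Or.inl h.2.2.1) h'.2.2.2.1

theorem core12 {V : Type*} [Fintype V]
    (E : V → V → Prop) (hloop : ∀ v, ¬ E v v) (hdigon : ∀ x y, ¬ (E x y ∧ E y x))
    (hmatch : ∀ a b c, IsMissing E a b → IsMissing E a c → b = c)
    (k : ℕ) (hk : 1 ≤ k) (F G : ℕ → V)
    (hL : ∀ n, LosesLab E (F n) (G n) (G (n + 1)) (F (n + 1)))
    (hper : ∀ n, s(F (n + k), G (n + k)) = s(F n, G n))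
    (hdis : ∀ n m, n < m → m < n + k → s(F n, G n) ≠ s(F m, G m)) :
    (∀ n, F (n + k) = G n ∧ G (n + k) = F n) ∧
    (∀ n s, 1 ≤ s → s < k → E (F (n + s)) (F n)) := by
  have hm : ∀ n, IsMissing E (F n) (G n) := fun n => (hL n).1
  have hne : ∀ n m, n < m → m < n + k → F n ≠ G m := by
    intro n m h1 h2 h3
    have h4 : IsMissing E (F n) (F m) := by
      have := hm m
      rw [h3]; exact ⟨this.1.symm, this.2.2, this.2.1⟩
    have h5 := hmatch _ _ _ (hm n) h4
    apply hdis n m h1 h2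
    rw [h3, h5, Sym2.eq_swap]
  -- basic four-cycle
  have hback : ∀ n, E (F (n + 1)) (F n) := by
    intro n
    obtain ⟨h1, h2, h3, h4, h5, h6⟩ := hL n
    by_contra hc
    have h7 : IsMissing E (F n) (F (n + 1)) := by
      refine ⟨?_, fun h => h4 (Or.inl h), hc⟩
      intro h; rw [← h] at h5; exact h1.2.2 h5
    have := hmatch _ _ _ h1 h7
    rw [← this] at h5
    exact hloop _ h5
  have hsub : ∀ n w, E (F n) w → w ≠ G (n + 1) → E (F (n + 1)) w := by
    intro n w h w1
    obtain ⟨h1, h2, h3, h4, h5, h6⟩ := hL n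
    by_contra hc
    have hw : ¬ E w (F (n + 1)) := by
      intro h7
      apply h4
      right
      refine ⟨?_, fun h => h4 (Or.inl h), w, h, h7⟩
      intro h8
      rw [h8] at h5; exact h1.2.2 h5
    have hw2 : F (n + 1) ≠ w := by
      intro h8; rw [← h8] at h; exact h4 (Or.inl h)
    exact w1 (hmatch _ _ _ ⟨hw2, hc, hw⟩ (hm (n + 1)))
  -- closing dichotomy
  have hstepA : ∀ n, (F (n + k) = F n ∧ G (n + k) = G n) →
      (F (n + 1 + k) = F (n + 1) ∧ G (n + 1 + k) = G (n + 1)) := by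
    rintro n ⟨h1, h2⟩
    have h3 := hL (n + k)
    rw [h1, h2, show n + k + 1 = n + 1 + k by ring] at h3
    have h4 := hper (n + 1)
    rw [Sym2.eq_swap, Sym2.eq_swap (a := F (n + 1))] at h4
    exact (h3.det12 (hL n) h4).symm
  have hstepB : ∀ n, (F (n + k) = G n ∧ G (n + k) = F n) →
      (F (n + 1 + k) = G (n + 1) ∧ G (n + 1 + k) = F (n + 1)) := by
    rintro n ⟨h1, h2⟩
    have h3 := hL (n + k)
    rw [h1, h2, show n + k + 1 = n + 1 + k by ring] at h3
    have h4 := hper (n + 1)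
    rw [Sym2.eq_swap (a := F (n + 1))] at h4
    exact h3.swap12.det12 (hL n) h4
  have hAB : (∀ n, F (n + k) = F n ∧ G (n + k) = G n) ∨
      (∀ n, F (n + k) = G n ∧ G (n + k) = F n) := by
    rcases Sym2.eq_iff.1 (hper 0) with h | h
    · left; intro n
      induction n with
      | zero => exact h
      | succ n ih => exact hstepA n ih
    · right; intro n
      induction n with
      | zero => exact h
      | succ n ih => exact hstepB n ih
  have hind : ∀ n s, 1 ≤ s → s < k → E (F (n + s)) (F n) := by
    intro n s hs
    induction s, hs using Nat.le_induction with
    | base => intro _; exact hback n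
    | succ s hs ih =>
      intro h
      exact hsub (n + s) _ (ih (by omega)) (hne n (n + s + 1) (by omega) (by omega))
  refine ⟨?_, hind⟩
  rcases hAB with hA | hB
  · exfalso
    have h0 := (hA 0).1
    have h1 : E (F (0 + k)) (F 0) := by
      rcases Nat.lt_or_ge 1 k with h | h
      · have h2 := hind 0 (k - 1) (by omega) (by omega)
        have h3 := hsub (0 + (k - 1)) _ h2
        rw [show 0 + (k - 1) + 1 = 0 + k by omega, (hA 0).2] at h3
        exact h3 (hm 0).1
      · have : k = 1 := by omega
        subst this
        exact hback 0
    rw [h0] at h1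
    exact hloop _ h1
  · exact hB

theorem circ12 {V : Type*}
    (E : V → V → Prop) (hloop : ∀ v, ¬ E v v) (hdigon : ∀ x y, ¬ (E x y ∧ E y x))
    (k : ℕ) (hk : 1 ≤ k) (F G : ℕ → V)
    (hL : ∀ n, LosesLab E (F n) (G n) (G (n + 1)) (F (n + 1)))
    (hB : ∀ n, F (n + k) = G n ∧ G (n + k) = F n)
    (hind : ∀ n s, 1 ≤ s → s < k → E (F (n + s)) (F n))
    (K : Set V) (hK : ∀ v, v ∈ K ↔ ∃ n, v = F n) (i : ℕ) :
    Nplus (ERestrict E K) (F i) = Nminus (ERestrict E K) (G i) ∧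
    Nminus (ERestrict E K) (F i) = Nplus (ERestrict E K) (G i) ∧
    Npp (ERestrict E K) (F i) = (Nminus (ERestrict E K) (F i) ∪ {G i}) \ {F (i + 1)} := by
  have hm : ∀ n, IsMissing E (F n) (G n) := fun n => (hL n).1
  have hp : ∀ n, F (n + 2 * k) = F n := by
    intro n
    rw [show n + 2 * k = n + k + k by ring, (hB _).1, (hB _).2]
  have hpp : ∀ q n, F (n + 2 * k * q) = F n := by
    intro q n
    induction q with
    | zero => simp
    | succ q ih => rw [show n + 2 * k * (q + 1) = n + 2 * k * q + 2 * k by ring, hp, ih]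
  have hF : ∀ n, F n ∈ K := fun n => (hK _).2 ⟨n, rfl⟩
  have hG : ∀ n, G n ∈ K := fun n => (hK _).2 ⟨n + k, (hB n).1.symm⟩
  have hrep : ∀ v ∈ K, ∃ t, t < 2 * k ∧ v = F (i + t) := by
    intro v hv
    obtain ⟨n, rfl⟩ := (hK v).1 hv
    have hlt := Nat.mod_lt (n + 2 * k * i - i) (show 0 < 2 * k by omega)
    refine ⟨(n + 2 * k * i - i) % (2 * k), hlt, ?_⟩
    have h1 := Nat.mod_add_div (n + 2 * k * i - i) (2 * k)
    have h2 : i ≤ 2 * k * i := Nat.le_mul_of_pos_left i (by omega)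
    rw [← hpp i n, ← hpp ((n + 2 * k * i - i) / (2 * k)) (i + _)]
    congr 1
    omega
  have hin : ∀ t, 1 ≤ t → t < k → E (F (i + t)) (F i) ∧ E (G i) (F (i + t)) := by
    intro t h1 h2
    refine ⟨hind _ _ h1 h2, ?_⟩
    have := hind (i + t) (k - t) (by omega) (by omega)
    rwa [show i + t + (k - t) = i + k by omega, (hB i).1] at this
  have hout : ∀ t, k < t → t < 2 * k → E (F i) (F (i + t)) ∧ E (F (i + t)) (G i) := by
    intro t h1 h2
    constructor
    · have := hind (i + t) (2 * k - t) (by omega) (by omega)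
      rwa [show i + t + (2 * k - t) = i + 2 * k by omega, hp] at this
    · have := hind (i + k) (t - k) (by omega) (by omega)
      rwa [show i + k + (t - k) = i + t by omega, (hB i).1] at this
  have hcase : ∀ v ∈ K, v = F i ∨ v = G i ∨ (E v (F i) ∧ E (G i) v) ∨
      (E (F i) v ∧ E v (G i)) := by
    intro v hv
    obtain ⟨t, ht, rfl⟩ := hrep v hv
    rcases Nat.eq_zero_or_pos t with rfl | h0
    · left; rfl
    rcases lt_trichotomy t k with h | rfl | h
    · right; right; left; exact hin t h0 h
    · right; left; exact (hB i).1
    · right; right; right; exact hout t h ht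
  have hmi := hm i
  refine ⟨?_, ?_, ?_⟩
  · ext v
    constructor
    · rintro ⟨_, hv, h⟩
      refine ⟨hv, hG i, ?_⟩
      rcases hcase v hv with rfl | rfl | h' | h'
      · exact absurd h (hloop _)
      · exact absurd h hmi.2.1
      · exact absurd ⟨h, h'.1⟩ (hdigon _ _)
      · exact h'.2
    · rintro ⟨hv, _, h⟩
      refine ⟨hF i, hv, ?_⟩
      rcases hcase v hv with rfl | rfl | h' | h'
      · exact absurd h hmi.2.1
      · exact absurd h (hloop _)
      · exact absurd ⟨h, h'.2⟩ (hdigon _ _)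
      · exact h'.1
  · ext v
    constructor
    · rintro ⟨hv, _, h⟩
      refine ⟨hG i, hv, ?_⟩
      rcases hcase v hv with rfl | rfl | h' | h'
      · exact absurd h (hloop _)
      · exact absurd h hmi.2.2
      · exact h'.2
      · exact absurd ⟨h, h'.1⟩ (hdigon _ _)
    · rintro ⟨_, hv, h⟩
      refine ⟨hv, hF i, ?_⟩
      rcases hcase v hv with rfl | rfl | h' | h'
      · exact absurd h hmi.2.2
      · exact absurd h (hloop _)
      · exact h'.1
      · exact absurd ⟨h, h'.2⟩ (hdigon _ _)
  · ext v
    constructor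
    · rintro ⟨h1, h2, u, ⟨_, hu, h3⟩, ⟨_, hv, h4⟩⟩
      have h2' : ¬ E (F i) v := fun h => h2 ⟨hF i, hv, h⟩
      refine ⟨?_, ?_⟩
      · rcases hcase v hv with rfl | rfl | h' | h'
        · exact absurd rfl h1
        · right; rfl
        · left; exact ⟨hv, hF i, h'.1⟩
        · exact absurd h'.1 h2'
      · intro h5
        rw [Set.mem_singleton_iff] at h5
        subst h5
        exact (hL i).2.2.2.1 (Or.inr ⟨h1, h2', u, h3, h4⟩)
    · rintro ⟨h1, h2⟩
      have hv : v ∈ K := by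
        rcases h1 with h1 | h1
        · exact h1.1
        · rw [Set.mem_singleton_iff.1 h1]; exact hG i
      have h3 : v ≠ F i ∧ ¬ E (F i) v := by
        rcases h1 with ⟨_, _, h1⟩ | h1
        · exact ⟨fun h => hloop (F i) (by rwa [h] at h1), fun h => hdigon _ _ ⟨h, h1⟩⟩
        · rw [Set.mem_singleton_iff.1 h1]; exact ⟨hmi.1.symm, hmi.2.1⟩
      obtain ⟨t, ht, rfl⟩ := hrep v hv
      have t0 : t ≠ 0 := by rintro rfl; exact h3.1 rfl
      have t1 : t ≠ 1 := by rintro rfl; exact h2 rfl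
      have t2 : t ≤ k := by
        by_contra hc
        exact h3.2 (hout t (by omega) ht).1
      refine ⟨h3.1, fun h => h3.2 h.2.2, F (i + (k + 1)),
        ⟨hF _, hF _, (hout (k + 1) (by omega) (by omega)).1⟩, ⟨hF _, hF _, ?_⟩⟩
      have := hind (i + t) (k + 1 - t) (by omega) (by omega)
      rwa [show i + t + (k + 1 - t) = i + (k + 1) by omega] at this

theorem chain12 {V : Type*} (E : V → V → Prop) (e : ℕ → Sym2 V)
    (he : ∀ n, Loses E (e n) (e (n + 1))) (x y : V) (h0 : s(x, y) = e 0) :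
    ∃ F G : ℕ → V, F 0 = x ∧ G 0 = y ∧ (∀ n, s(F n, G n) = e n) ∧
      ∀ n, LosesLab E (F n) (G n) (G (n + 1)) (F (n + 1)) := by
  have step : ∀ n (p : {p : V × V // s(p.1, p.2) = e n}),
      ∃ q : {p : V × V // s(p.1, p.2) = e (n + 1)},
        LosesLab E p.1.1 p.1.2 q.1.2 q.1.1 := by
    rintro n ⟨⟨p1, p2⟩, hp⟩
    obtain ⟨x1, y1, x2, y2, h1, h2, h3⟩ := he n
    have h4 : s(p1, p2) = s(x1, y1) := hp.trans h1
    rcases Sym2.eq_iff.1 h4 with ⟨rfl, rfl⟩ | ⟨rfl, rfl⟩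
    · exact ⟨⟨(y2, x2), by rw [h2, Sym2.eq_swap]⟩, h3⟩
    · exact ⟨⟨(x2, y2), h2.symm⟩, h3.swap12⟩
  choose f hf using step
  let P : (n : ℕ) → {p : V × V // s(p.1, p.2) = e n} :=
    fun n => Nat.rec ⟨(x, y), h0⟩ (fun n p => f n p) n
  exact ⟨fun n => (P n).1.1, fun n => (P n).1.2, rfl, rfl, fun n => (P n).2,
    fun n => hf n (P n)⟩

theorem stmt_12 {V : Type*} [Fintype V]
    (E : V → V → Prop) (hloop : ∀ v, ¬ E v v) (hdigon : ∀ x y, ¬ (E x y ∧ E y x))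
    (hmatch : ∀ a b c, IsMissing E a b → IsMissing E a c → b = c)
    (k : ℕ) (hk : 1 ≤ k) (a b : ℕ → V)
    (hmiss : ∀ i, 1 ≤ i → i ≤ k → IsMissing E (a i) (b i))
    (hpath : ∀ i, 1 ≤ i → i < k → LosesLab E (a i) (b i) (a (i + 1)) (b (i + 1)))
    (hclose : Loses E s(a k, b k) s(a 1, b 1))
    (hinj : ∀ i j, 1 ≤ i → i ≤ k → 1 ≤ j → j ≤ k → s(a i, b i) = s(a j, b j) → i = j)
    (K : Set V) (hK : K = {v | ∃ i, 1 ≤ i ∧ i ≤ k ∧ (v = a i ∨ v = b i)})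
    (a' b' : ℕ → V)
    (ha' : ∀ i, a' i = if i = k + 1 then (if Odd k then a 1 else b 1) else a i)
    (hb' : ∀ i, b' i = if i = k + 1 then (if Odd k then b 1 else a 1) else b i) :
    ∀ i, 1 ≤ i → i ≤ k →
      Nplus (ERestrict E K) (a i) = Nminus (ERestrict E K) (b i) ∧
      Nminus (ERestrict E K) (a i) = Nplus (ERestrict E K) (b i) ∧
      Npp (ERestrict E K) (a i) = (Nminus (ERestrict E K) (a i) ∪ {b i}) \ {b' (i + 1)} ∧
      Npp (ERestrict E K) (b i) = (Nminus (ERestrict E K) (b i) ∪ {a i}) \ {a' (i + 1)} := by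
  obtain ⟨F, G, hF0, hG0, he, hL⟩ := chain12 E (fun n => s(a (n % k + 1), b (n % k + 1)))
    (by
      intro n
      have hlt := Nat.mod_lt n (show 0 < k by omega)
      show Loses E s(a (n % k + 1), b (n % k + 1)) s(a ((n + 1) % k + 1), b ((n + 1) % k + 1))
      rcases Nat.lt_or_ge (n % k + 1) k with h | h
      · have h1 : (n + 1) % k = n % k + 1 := by
          rw [← Nat.mod_add_mod, Nat.mod_eq_of_lt h]
        rw [h1]
        exact ⟨_, _, _, _, rfl, rfl, hpath _ (by omega) h⟩
      · have h2 : n % k + 1 = k := by omega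
        have h1 : (n + 1) % k = 0 := by
          rw [← Nat.mod_add_mod, h2, Nat.mod_self]
        rw [h1, h2]
        exact hclose)
    (a 1) (b 1) (by simp)
  have hdis : ∀ n m, n < m → m < n + k → s(F n, G n) ≠ s(F m, G m) := by
    intro n m h1 h2 h3
    rw [he, he] at h3
    have hn := Nat.mod_lt n (show 0 < k by omega)
    have hm := Nat.mod_lt m (show 0 < k by omega)
    have h4 := hinj _ _ (by omega) (by omega) (by omega) (by omega) h3
    have h5 : n ≡ m [MOD k] := by
      show n % k = m % k
      omega
    have h6 := (Nat.modEq_iff_dvd' h1.le).1 h5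
    have := Nat.le_of_dvd (by omega) h6
    omega
  obtain ⟨hB, hind⟩ := core12 E hloop hdigon hmatch k hk F G hL
    (by intro n; rw [he, he]; simp) hdis
  -- identification of the labels
  have hid : ∀ n, n < k → (Even n → F n = a (n + 1) ∧ G n = b (n + 1)) ∧
      (¬ Even n → F n = b (n + 1) ∧ G n = a (n + 1)) := by
    intro n
    induction n with
    | zero => intro _; exact ⟨fun _ => ⟨hF0, hG0⟩, fun h => absurd Even.zero h⟩
    | succ n ih =>
      intro hn
      obtain ⟨ih1, ih2⟩ := ih (by omega)
      have h1 := hL n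
      have h2 := hpath (n + 1) (by omega) hn
      have h3 := he (n + 1)
      rw [Nat.mod_eq_of_lt hn] at h3
      by_cases hev : Even n
      · obtain ⟨h4, h5⟩ := ih1 hev
        rw [h4, h5] at h1
        have h6 := h1.det12 h2 (by rw [← h3, Sym2.eq_swap])
        exact ⟨fun h => absurd hev (Nat.even_add_one.1 h), fun _ => ⟨h6.2, h6.1⟩⟩
      · obtain ⟨h4, h5⟩ := ih2 hev
        rw [h4, h5] at h1
        have h6 := h1.swap12.det12 h2 h3
        exact ⟨fun _ => h6, fun h => absurd (Nat.even_add_one.2 hev) h⟩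
  have hmemF : ∀ n, F n ∈ K := by
    intro n
    have hlt := Nat.mod_lt n (show 0 < k by omega)
    rw [hK]
    refine ⟨n % k + 1, by omega, by omega, ?_⟩
    rcases Sym2.eq_iff.1 (he n) with h | h
    · exact Or.inl h.1
    · exact Or.inr h.1
  have hKF : ∀ v, v ∈ K ↔ ∃ n, v = F n := by
    intro v
    constructor
    · intro hv
      rw [hK] at hv
      obtain ⟨i, h1, h2, h3⟩ := hv
      obtain ⟨i, rfl⟩ : ∃ j, i = j + 1 := ⟨i - 1, by omega⟩
      have h4 : v = F i ∨ v = G i := by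
        obtain ⟨h5, h6⟩ := hid i (by omega)
        by_cases hev : Even i
        · rw [(h5 hev).1, (h5 hev).2]; exact h3
        · rw [(h6 hev).1, (h6 hev).2]; exact h3.symm
      rcases h4 with h4 | h4
      · exact ⟨i, h4⟩
      · exact ⟨i + k, by rw [h4, (hB i).1]⟩
    · rintro ⟨n, rfl⟩
      exact hmemF n
  have hcirc := circ12 E hloop hdigon k hk F G hL hB hind K hKF
  intro i hi1 hi2
  obtain ⟨i, rfl⟩ : ∃ j, i = j + 1 := ⟨i - 1, by omega⟩
  obtain ⟨c1, c2, c3⟩ := hcirc i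
  obtain ⟨_, _, c6⟩ := hcirc (i + k)
  rw [show i + k + 1 = i + 1 + k by ring, (hB i).1, (hB i).2, (hB (i + 1)).1] at c6
  obtain ⟨d1, d2⟩ := hid i (by omega)
  have hnext : (Even i → F (i + 1) = b' (i + 1 + 1) ∧ G (i + 1) = a' (i + 1 + 1)) ∧
      (¬ Even i → F (i + 1) = a' (i + 1 + 1) ∧ G (i + 1) = b' (i + 1 + 1)) := by
    rw [ha', hb']
    rcases Nat.lt_or_ge (i + 1) k with h | h
    · have hne : i + 1 + 1 ≠ k + 1 := by omega
      rw [if_neg hne, if_neg hne]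
      obtain ⟨f1, f2⟩ := hid (i + 1) h
      exact ⟨fun hev => f2 (fun h => Nat.even_add_one.1 h hev),
        fun hev => f1 (Nat.even_add_one.2 hev)⟩
    · have hk' : k = i + 1 := by omega
      subst hk'
      have hb0 := hB 0
      rw [Nat.zero_add, hF0, hG0] at hb0
      rw [if_pos rfl, if_pos rfl]
      constructor
      · intro hev
        have : Odd (i + 1) := hev.add_one
        rw [if_pos this, if_pos this]
        exact hb0
      · intro hev
        have : ¬ Odd (i + 1) := by
          rw [Nat.not_odd_iff_even]; exact Nat.even_add_one.2 hev
        rw [if_neg this, if_neg this]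
        exact hb0
  by_cases hev : Even i
  · rw [← (d1 hev).1, ← (d1 hev).2, ← (hnext.1 hev).1, ← (hnext.1 hev).2]
    exact ⟨c1, c2, c3, c6⟩
  · rw [← (d2 hev).1, ← (d2 hev).2, ← (hnext.2 hev).1, ← (hnext.2 hev).2]
    exact ⟨c2.symm, c1.symm, c6, c3⟩
end

section
/- Let D be a finite oriented graph missing a matching and let C = a₁b₁, a₂b₂, …, a_kb_k be a directed cycle of its dependency digraph Δ. Then in the induced subdigraph D[K(C)], every vertex v ∈ K(C) satisfies d⁺⁺(v) = d⁺(v) = d⁻(v) = k − 1. In particular, every vertex of K(C) has the SNP in D[K(C)]. -/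
variable {V : Type*}

theorem aux_step {V : Type*} {E : V → V → Prop} {e f : Sym2 V} (h : Loses E e f) (x y : V)
    (he : e = s(x, y)) : ∃ u w, f = s(u, w) ∧ LosesLab E x y w u := by
  obtain ⟨x1, y1, x2, y2, h1, h2, h3⟩ := h
  rw [he, Sym2.eq_iff] at h1
  rcases h1 with ⟨rfl, rfl⟩ | ⟨rfl, rfl⟩
  · exact ⟨y2, x2, by rw [h2, Sym2.eq_swap], h3⟩
  · obtain ⟨⟨p1, p2, p3⟩, ⟨q1, q2, q3⟩, r1, r2, r3, r4⟩ := h3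
    exact ⟨x2, y2, h2, ⟨p1.symm, p3, p2⟩, ⟨q1.symm, q3, q2⟩, r3, r4, r1, r2⟩

theorem aux_seq {V : Type*} {E : V → V → Prop} (e : ℕ → Sym2 V)
    (h : ∀ n, Loses E (e n) (e (n + 1))) (x y : V) (h0 : e 0 = s(x, y)) :
    ∃ U W : ℕ → V, U 0 = x ∧ W 0 = y ∧ (∀ n, e n = s(U n, W n)) ∧
      ∀ n, LosesLab E (U n) (W n) (W (n + 1)) (U (n + 1)) := by
  choose f g h1 h2 using fun n (p : {p : V × V // e n = s(p.1, p.2)}) =>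
    aux_step (h n) p.1.1 p.1.2 p.2
  let P : (n : ℕ) → {p : V × V // e n = s(p.1, p.2)} := fun n =>
    Nat.rec ⟨(x, y), h0⟩ (fun n p => ⟨(f n p, g n p), h1 n p⟩) n
  exact ⟨fun n => (P n).1.1, fun n => (P n).1.2, rfl, rfl, fun n => (P n).2, fun n => h2 n (P n)⟩

theorem aux_core {V : Type*} [Fintype V]
    (E : V → V → Prop) (hloop : ∀ v, ¬ E v v) (hdigon : ∀ x y, ¬ (E x y ∧ E y x))
    (hmatch : ∀ a b c, IsMissing E a b → IsMissing E a c → b = c)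
    (k : ℕ) (hk : 1 ≤ k) (U W : ℕ → V)
    (hl : ∀ n, LosesLab E (U n) (W n) (W (n + 1)) (U (n + 1)))
    (hper : ∀ n, s(U (n + k), W (n + k)) = s(U n, W n))
    (hinj : ∀ n m, n < m → m < n + k → s(U n, W n) ≠ s(U m, W m))
    (K : Set V) (hK : ∀ v, v ∈ K ↔ ∃ i, i < k ∧ (v = U i ∨ v = W i)) :
      (Npp (ERestrict E K) (U 0)).ncard = k - 1 ∧
      (Nplus (ERestrict E K) (U 0)).ncard = k - 1 ∧
      (Nminus (ERestrict E K) (U 0)).ncard = k - 1 := by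
  have hm : ∀ n, IsMissing E (U n) (W n) := fun n => (hl n).1
  have symm : ∀ x y, IsMissing E x y → IsMissing E y x := fun x y h => ⟨h.1.symm, h.2.2, h.2.1⟩
  -- partner function facts
  have key : ∀ x y x' y', IsMissing E x y → IsMissing E x' y' → s(x, y) ≠ s(x', y') →
      x ≠ x' ∧ (E x x' ∨ E x' x) := by
    intro x y x' y' h h' hne
    have h1 : x ≠ x' := by
      rintro rfl
      exact hne (by rw [hmatch _ _ _ h h'])
    refine ⟨h1, ?_⟩
    by_contra hc
    push Not at hc
    have h2 : IsMissing E x x' := ⟨h1, hc.1, hc.2⟩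
    have e1 := hmatch _ _ _ h h2
    have e2 := hmatch _ _ _ h' (symm _ _ h2)
    exact hne (by rw [e1, e2, Sym2.eq_swap])
  have sw : ∀ x y x' y' : V, s(x, y) ≠ s(x', y') → s(y, x) ≠ s(y', x') := by
    intro x y x' y' h
    rwa [Sym2.eq_swap, Sym2.eq_swap (a := y')]
  have k2 : 2 ≤ k := by
    by_contra hc
    obtain rfl : k = 1 := by omega
    have h := hper 0
    rw [Sym2.eq_iff] at h
    obtain ⟨h1, h2, h3, -⟩ := hl 0
    rcases h with ⟨p, q⟩ | ⟨p, q⟩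
    · rw [q] at h3; exact h1.2.1 h3
    · rw [q] at h3; exact hloop _ h3
  have UU : ∀ n d, 1 ≤ d → d < k → E (U (n + d)) (U n) ∧ E (W (n + d)) (W n) := by
    intro n d hd
    induction d, hd using Nat.le_induction with
    | base =>
      intro hk1
      have hne := hinj n (n + 1) (by omega) (by omega)
      have h1 := key _ _ _ _ (hm n) (hm (n + 1)) hne
      have h2 := key _ _ _ _ (symm _ _ (hm n)) (symm _ _ (hm (n + 1))) (sw _ _ _ _ hne)
      obtain ⟨-, -, -, h3, -, h4⟩ := hl n
      exact ⟨h1.2.resolve_left fun h => h3 (Or.inl h), h2.2.resolve_left fun h => h4 (Or.inl h)⟩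
    | succ d hd ih =>
      intro hk1
      obtain ⟨i1, i2⟩ := ih (by omega)
      have hne := hinj n (n + (d + 1)) (by omega) (by omega)
      have h1 := key _ _ _ _ (hm n) (hm (n + (d + 1))) hne
      have h2 := key _ _ _ _ (symm _ _ (hm n)) (symm _ _ (hm (n + (d + 1)))) (sw _ _ _ _ hne)
      have hne' := hinj (n + d) (n + (d + 1)) (by omega) (by omega)
      have g1 := key _ _ _ _ (hm (n + d)) (hm (n + (d + 1))) hne'
      have g2 := key _ _ _ _ (symm _ _ (hm (n + d))) (symm _ _ (hm (n + (d + 1))))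
        (sw _ _ _ _ hne')
      obtain ⟨-, -, -, h3, -, h4⟩ := hl (n + d)
      refine ⟨h1.2.resolve_left fun h => h3 (Or.inr ⟨g1.1.symm, fun h' => h3 (Or.inl h'), _, i1, h⟩),
        h2.2.resolve_left fun h => h4 (Or.inr ⟨g2.1.symm, fun h' => h4 (Or.inl h'), _, i2, h⟩)⟩
  have UW : ∀ n d, 1 ≤ d → d < k → E (U n) (W (n + d)) ∧ E (W n) (U (n + d)) := by
    intro n d hd hdk
    obtain ⟨h1, h2⟩ := UU n d hd hdk
    obtain ⟨h3, h4⟩ := UU (n + d) (k - d) (by omega) (by omega)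
    have e1 : n + d + (k - d) = n + k := by omega
    rw [e1] at h3 h4
    have h := hper n
    rw [Sym2.eq_iff] at h
    rcases h with ⟨p, q⟩ | ⟨p, q⟩
    · rw [p] at h3
      exact absurd ⟨h1, h3⟩ (hdigon _ _)
    · rw [p] at h3
      rw [q] at h4
      exact ⟨h4, h3⟩
  have UU0 : ∀ d, 1 ≤ d → d < k → E (U d) (U 0) := fun d h h' => by
    simpa using (UU 0 d h h').1
  have UW0 : ∀ d, 1 ≤ d → d < k → E (U 0) (W d) := fun d h h' => by
    simpa using (UW 0 d h h').1
  have memU : ∀ d, d < k → U d ∈ K := fun d h => (hK _).2 ⟨d, h, Or.inl rfl⟩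
  have memW : ∀ d, d < k → W d ∈ K := fun d h => (hK _).2 ⟨d, h, Or.inr rfl⟩
  have injU : Set.InjOn U (Set.Iio k) := by
    intro i hi j hj hij
    simp only [Set.mem_Iio] at hi hj
    rcases lt_trichotomy i j with h | h | h
    · exact absurd hij (key _ _ _ _ (hm i) (hm j) (hinj i j h (by omega))).1
    · exact h
    · exact absurd hij.symm (key _ _ _ _ (hm j) (hm i) (hinj j i h (by omega))).1
  have injW : Set.InjOn W (Set.Iio k) := by
    intro i hi j hj hij
    simp only [Set.mem_Iio] at hi hj
    apply injU hi hj
    have h1 := symm _ _ (hm i)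
    rw [hij] at h1
    exact hmatch _ _ _ h1 (symm _ _ (hm j))
  have W0 : ∀ d, d < k → W 0 ≠ U d := by
    intro d hd h
    rcases Nat.eq_zero_or_pos d with rfl | hp
    · exact (hm 0).1 h.symm
    · exact (hm 0).2.2 (h ▸ UU0 d hp hd)
  have k0 : 0 < k := by omega
  have Np : Nplus (ERestrict E K) (U 0) = W '' (Set.Ico 1 k) := by
    ext v
    constructor
    · rintro ⟨-, hv, hE⟩
      obtain ⟨i, hi, rfl | rfl⟩ := (hK v).1 hv
      · exfalso
        rcases Nat.eq_zero_or_pos i with rfl | hp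
        · exact hloop _ hE
        · exact hdigon _ _ ⟨hE, UU0 i hp hi⟩
      · refine ⟨i, ⟨?_, hi⟩, rfl⟩
        rcases Nat.eq_zero_or_pos i with rfl | hp
        · exact absurd hE (hm 0).2.1
        · exact hp
    · rintro ⟨i, ⟨h1, h2⟩, rfl⟩
      exact ⟨memU 0 k0, memW i h2, UW0 i h1 h2⟩
  have Nm : Nminus (ERestrict E K) (U 0) = U '' (Set.Ico 1 k) := by
    ext v
    constructor
    · rintro ⟨hv, -, hE⟩
      obtain ⟨i, hi, rfl | rfl⟩ := (hK v).1 hv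
      · refine ⟨i, ⟨?_, hi⟩, rfl⟩
        rcases Nat.eq_zero_or_pos i with rfl | hp
        · exact absurd hE (hloop _)
        · exact hp
      · exfalso
        rcases Nat.eq_zero_or_pos i with rfl | hp
        · exact (hm 0).2.2 hE
        · exact hdigon _ _ ⟨hE, UW0 i hp hi⟩
    · rintro ⟨i, ⟨h1, h2⟩, rfl⟩
      exact ⟨memU i h2, memU 0 k0, UU0 i h1 h2⟩
  have N2 : Npp (ERestrict E K) (U 0) = insert (W 0) (U '' (Set.Ico 2 k)) := by
    ext v
    constructor
    · rintro ⟨hne, hn, u, ⟨h1, h2, h3⟩, -, hv, h4⟩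
      obtain ⟨i, hi, rfl | rfl⟩ := (hK v).1 hv
      · right
        refine ⟨i, ⟨?_, hi⟩, rfl⟩
        by_contra hc
        have : i = 0 ∨ i = 1 := by omega
        rcases this with rfl | rfl
        · exact hne rfl
        · exact (hl 0).2.2.2.1 (Or.inr ⟨hne, fun h => hn ⟨h1, hv, h⟩, u, h3, h4⟩)
      · rcases Nat.eq_zero_or_pos i with rfl | hp
        · exact Or.inl rfl
        · exact absurd ⟨h1, hv, UW0 i hp hi⟩ hn
    · rintro (rfl | ⟨i, ⟨h1, h2⟩, rfl⟩)
      · refine ⟨(hm 0).1.symm, fun h => (hm 0).2.1 h.2.2, W 1, ⟨memU 0 k0, memW 1 (by omega),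
          UW0 1 le_rfl (by omega)⟩, memW 1 (by omega), memW 0 k0, ?_⟩
        simpa using (UU 0 1 le_rfl (by omega)).2
      · have hE := UU0 i (by omega) h2
        refine ⟨fun h => hloop (U 0) (by rw [h] at hE; exact hE),
          fun h => hdigon _ _ ⟨hE, h.2.2⟩, W (i - 1), ⟨memU 0 k0, memW _ (by omega),
          UW0 _ (by omega) (by omega)⟩, memW _ (by omega), memU _ h2, ?_⟩
        have := (UW (i - 1) 1 le_rfl (by omega)).2
        rwa [show i - 1 + 1 = i by omega] at this
  have sub : ∀ c, Set.Ico c k ⊆ Set.Iio k := fun c x hx => hx.2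
  have cI : ∀ c, (Set.Ico c k).ncard = k - c := fun c => by
    rw [← Finset.coe_Ico, Set.ncard_coe_finset, Nat.card_Ico]
  refine ⟨?_, ?_, ?_⟩
  · rw [N2, Set.ncard_insert_of_notMem, Set.ncard_image_of_injOn (injU.mono (sub _)), cI]
    · omega
    · rintro ⟨i, hi, h⟩
      exact W0 i hi.2 h.symm
  · rw [Np, Set.ncard_image_of_injOn (injW.mono (sub _)), cI]
  · rw [Nm, Set.ncard_image_of_injOn (injU.mono (sub _)), cI]

theorem stmt_13 {V : Type*} [Fintype V]
    (E : V → V → Prop) (hloop : ∀ v, ¬ E v v) (hdigon : ∀ x y, ¬ (E x y ∧ E y x))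
    (hmatch : ∀ a b c, IsMissing E a b → IsMissing E a c → b = c)
    (k : ℕ) (hk : 1 ≤ k) (a b : ℕ → V)
    (hmiss : ∀ i, 1 ≤ i → i ≤ k → IsMissing E (a i) (b i))
    (hpath : ∀ i, 1 ≤ i → i < k → LosesLab E (a i) (b i) (a (i + 1)) (b (i + 1)))
    (hclose : Loses E s(a k, b k) s(a 1, b 1))
    (hinj : ∀ i j, 1 ≤ i → i ≤ k → 1 ≤ j → j ≤ k → s(a i, b i) = s(a j, b j) → i = j)
    (K : Set V) (hK : K = {v | ∃ i, 1 ≤ i ∧ i ≤ k ∧ (v = a i ∨ v = b i)}) :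
    ∀ v ∈ K,
      (Npp (ERestrict E K) v).ncard = k - 1 ∧
      (Nplus (ERestrict E K) v).ncard = k - 1 ∧
      (Nminus (ERestrict E K) v).ncard = k - 1 ∧
      (Nplus (ERestrict E K) v).ncard ≤ (Npp (ERestrict E K) v).ncard := by
  intro v hv
  suffices h : (Npp (ERestrict E K) v).ncard = k - 1 ∧
      (Nplus (ERestrict E K) v).ncard = k - 1 ∧
      (Nminus (ERestrict E K) v).ncard = k - 1 from
    ⟨h.1, h.2.1, h.2.2, by rw [h.1, h.2.1]⟩
  have hv' := hv
  rw [hK] at hv'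
  obtain ⟨m, hm1, hmk, hvm⟩ := hv'
  let e : ℕ → Sym2 V := fun n => s(a (n % k + 1), b (n % k + 1))
  have hlt : ∀ n, n % k < k := fun n => Nat.mod_lt _ (by omega)
  have he : ∀ n, Loses E (e n) (e (n + 1)) := by
    intro n
    have h1 := hlt n
    by_cases h : n % k + 1 < k
    · have h2 : (n + 1) % k = n % k + 1 := by
        rw [Nat.add_mod, Nat.mod_eq_of_lt (show 1 < k by omega), Nat.mod_eq_of_lt h]
      simp only [e, h2]
      exact ⟨_, _, _, _, rfl, rfl, hpath _ (by omega) h⟩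
    · have h3 : n % k + 1 = k := by omega
      have h2 : (n + 1) % k = 0 := by
        rw [← Nat.mod_add_mod, h3, Nat.mod_self]
      simp only [e, h2, h3]
      exact hclose
  have heq : ∀ n n', e n = e n' → n % k = n' % k := by
    intro n n' h
    have := hinj _ _ (by omega) (hlt n) (by omega) (hlt n') h
    omega
  have hem : e (m - 1) = s(a m, b m) := by
    simp only [e]
    rw [Nat.mod_eq_of_lt (by omega), Nat.sub_add_cancel hm1]
  obtain ⟨y, hy⟩ : ∃ y, e (m - 1) = s(v, y) := by
    rw [hem]
    rcases hvm with rfl | rfl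
    · exact ⟨_, rfl⟩
    · exact ⟨_, Sym2.eq_swap⟩
  obtain ⟨U, W, rfl, -, hUW, hl⟩ := aux_seq (E := E) (fun n => e (m - 1 + n))
    (fun n => he _) v y hy
  have hper : ∀ n, e (n + k) = e n := fun n => by simp only [e, Nat.add_mod_right]
  refine aux_core E hloop hdigon hmatch k hk U W hl ?_ ?_ K ?_
  · intro n
    rw [← hUW, ← hUW, ← add_assoc, hper]
  · intro n n' h1 h2 h
    rw [← hUW, ← hUW] at h
    have h3 : (m - 1 + n) ≡ (m - 1 + n') [MOD k] := heq _ _ h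
    have h4 := (Nat.modEq_iff_dvd' (by omega)).1 h3
    have := Nat.le_of_dvd (by omega) h4
    omega
  · intro x
    have hx : ∀ n, (x = U n ∨ x = W n) ↔ x ∈ e (m - 1 + n) := fun n => by
      rw [hUW n, Sym2.mem_iff]
    simp only [hx]
    rw [hK]
    constructor
    · rintro ⟨i, h1, h2, h3⟩
      have h4 : x ∈ e (i - 1) := by
        simp only [e]
        rw [Nat.mod_eq_of_lt (by omega), Nat.sub_add_cancel h1, Sym2.mem_iff]
        exact h3
      by_cases h : m ≤ i
      · exact ⟨i - m, by omega, by rwa [show m - 1 + (i - m) = i - 1 by omega]⟩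
      · exact ⟨i + k - m, by omega, by
          rwa [show m - 1 + (i + k - m) = i - 1 + k by omega, hper]⟩
    · rintro ⟨i, h1, h2⟩
      exact ⟨(m - 1 + i) % k + 1, by omega, hlt _, Sym2.mem_iff.1 h2⟩
end

section
/- Let D be a finite oriented graph missing a matching, let Δ be its dependency digraph, and let D' = D + F be obtained from D as follows: for each connected component of Δ that is a maximal directed path P = a₁b₁, a₂b₂, …, a_kb_k (so a₁b₁ is a good missing edge), if (a₁,b₁) is a convenient orientation of a₁b₁ then add the arcs (aᵢ,bᵢ) for i = 1,…,k, and otherwise add the arcs (bᵢ,aᵢ) for i = 1,…,k; F is the set of all arcs so added. Then D' is a good digraph. -/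
variable {V : Type*}

theorem stmt_14 {V : Type*} [Fintype V]
    (E : V → V → Prop) (hloop : ∀ v, ¬ E v v) (hdigon : ∀ x y, ¬ (E x y ∧ E y x))
    (hmatch : ∀ a b c, IsMissing E a b → IsMissing E a c → b = c)
    (E' : V → V → Prop) (hloop' : ∀ v, ¬ E' v v) (hdigon' : ∀ x y, ¬ (E' x y ∧ E' y x))
    (hsub : ∀ x y, E x y → E' x y)
    (hnew : ∀ x y, E' x y → ¬ E x y → IsMissing E x y ∧ InPathComp E s(x, y))
    (hcover : ∀ x y, IsMissing E x y → InPathComp E s(x, y) → E' x y ∨ E' y x)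
    (hfirst : ∀ x y, IsMissing E x y → (¬ ∃ g, Loses E g s(x, y)) → E' x y →
      ConvenientFor E x y)
    (hprop : ∀ x1 y1 x2 y2, LosesLab E x1 y1 x2 y2 → E' x1 y1 → E' x2 y2) :
    GoodDigraph E' := by
  classical
  have mem1 : ∀ a b : V, b ∉ Nplus E a ∪ Npp E a → ¬ E a b ∧ (b ≠ a → ∀ u, E a u → ¬ E u b) := by
    intro a b h
    simp only [Set.mem_union, not_or, Nplus, Npp, Set.mem_setOf_eq] at h
    refine ⟨h.1, fun hne u h1 h2 => h.2 ⟨hne, h.1, u, h1, h2⟩⟩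
  have misym : ∀ {a b : V}, IsMissing E a b → IsMissing E b a :=
    fun h => ⟨h.1.symm, h.2.2, h.2.1⟩
  let R : V → V → Prop := fun c c' => ∃ d d', LosesLab E c d d' c'
  have labsym : ∀ {c d d' c'}, LosesLab E c d d' c' → LosesLab E d c c' d' := by
    rintro c d d' c' ⟨h1, h2, h3, h4, h5, h6⟩
    exact ⟨misym h1, misym h2, h5, h6, h3, h4⟩
  have labne : ∀ {c d d' c'}, LosesLab E c d d' c' → c' ≠ c := by
    rintro c d d' c' ⟨h1, h2, h3, h4, h5, h6⟩ rfl
    exact h1.2.2 h5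
  have labback : ∀ {c d d' c'}, LosesLab E c d d' c' → E c' c := by
    intro c d d' c' h
    have hne := labne h
    obtain ⟨h1, h2, h3, h4, h5, h6⟩ := h
    by_contra hc
    have hm : IsMissing E c c' := ⟨hne.symm, (mem1 _ _ h4).1, hc⟩
    have := hmatch c d c' h1 hm
    subst this
    exact hloop _ h5
  have labmono : ∀ {c d d' c'}, LosesLab E c d d' c' → ∀ w, w ≠ c' → w ≠ d' → E c w → E c' w := by
    intro c d d' c' h w hw1 hw2 hcw
    have hne := labne h
    obtain ⟨h1, h2, h3, h4, h5, h6⟩ := h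
    by_contra hc
    have hm : IsMissing E c' w := ⟨hw1.symm, hc, (mem1 _ _ h4).2 hne w hcw⟩
    exact hw2 (hmatch c' w d' hm (misym h2))
  have Rfun : ∀ {c c' c''}, R c c' → R c c'' → c' = c'' := by
    rintro c c' c'' ⟨d, d', h⟩ ⟨e, d'', k⟩
    obtain rfl : d = e := hmatch c d e h.1 k.1
    by_contra hne
    have hn1 : d'' ≠ c' := by
      rintro rfl
      exact hdigon _ _ ⟨k.2.2.1, labback h⟩
    have hn2 : d'' ≠ d' := by
      rintro rfl
      exact hne (hmatch _ _ _ h.2.1 k.2.1)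
    have e1 : E c' d'' := labmono h d'' hn1 hn2 k.2.2.1
    have e2 : E d'' c' := labmono (labsym k) c' hn1.symm hne h.2.2.2.2.1
    exact hdigon _ _ ⟨e1, e2⟩
  let P : V → Prop := fun c => ∃ d, IsMissing E c d ∧ ¬ InPathComp E s(c, d)
  have Pmate : ∀ {c d}, P c → IsMissing E c d → ¬ InPathComp E s(c, d) := by
    rintro c d ⟨e, he, hn⟩ h
    obtain rfl := hmatch c e d he h
    exact hn
  have Psym : ∀ {c d}, P c → IsMissing E c d → P d := by
    intro c d hc h
    refine ⟨c, misym h, ?_⟩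
    rw [Sym2.eq_swap]
    exact Pmate hc h
  have Pout : ∀ {c w}, P c → E' c w → E c w := by
    intro c w hc h
    by_contra hn
    obtain ⟨h1, h2⟩ := hnew _ _ h hn
    exact Pmate hc h1 h2
  have Pin : ∀ {c w}, P c → E' w c → E w c := by
    intro c w hc h
    by_contra hn
    obtain ⟨h1, h2⟩ := hnew _ _ h hn
    rw [Sym2.eq_swap] at h2
    exact Pmate hc (misym h1) h2
  have missE' : ∀ {c d}, P c → IsMissing E c d → IsMissing E' c d := by
    intro c d hc h
    exact ⟨h.1, fun k => h.2.1 (Pout hc k), fun k => h.2.2 (Pin hc k)⟩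
  have missE : ∀ {c d}, IsMissing E' c d → IsMissing E c d ∧ P c := by
    intro c d h
    have hm : IsMissing E c d := ⟨h.1, fun k => h.2.1 (hsub _ _ k), fun k => h.2.2 (hsub _ _ k)⟩
    refine ⟨hm, d, hm, fun hp => ?_⟩
    rcases hcover _ _ hm hp with k | k
    · exact h.2.1 k
    · exact h.2.2 k
  have predEx : ∀ c' : {c // P c}, ∃ c : {c // P c}, R c c' := by
    rintro ⟨c', hc'⟩
    obtain ⟨d', hm, hp⟩ := id hc'
    have : ∃ g, Loses E g s(c', d') := by
      by_contra hno
      exact hp ⟨_, ⟨c', d', rfl, hm⟩, Relation.ReflTransGen.refl, hno⟩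
    obtain ⟨g, hg⟩ := this
    have hgp : ¬ InPathComp E g := by
      rintro ⟨h, h1, h2, h3⟩
      exact hp ⟨h, h1, Relation.ReflTransGen.head (Or.inr hg) h2, h3⟩
    obtain ⟨x1, y1, x2, y2, rfl, h2, hl⟩ := hg
    rcases Sym2.eq_iff.1 h2 with ⟨rfl, rfl⟩ | ⟨rfl, rfl⟩
    · refine ⟨⟨y1, x1, misym hl.1, ?_⟩, x1, d', labsym hl⟩
      rw [Sym2.eq_swap]; exact hgp
    · exact ⟨⟨x1, y1, hl.1, hgp⟩, y1, d', hl⟩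
  choose p hp using predEx
  have pinj : Function.Injective p := by
    intro a b hab
    have h1 := hp a
    have h2 := hp b
    rw [hab] at h1
    exact Subtype.ext (Rfun h1 h2)
  let σ : Equiv.Perm {c // P c} := (Equiv.ofBijective p (Finite.injective_iff_bijective.1 pinj)).symm
  have hσ : ∀ c : {c // P c}, R c (σ c) := by
    intro c
    have h := hp (σ c)
    have h2 : p (σ c) = c :=
      (Equiv.ofBijective p (Finite.injective_iff_bijective.1 pinj)).apply_symm_apply c
    rw [h2] at h
    exact h
  have period : ∃ N : ℕ, 0 < N ∧ σ ^ N = 1 := ⟨orderOf σ, orderOf_pos σ, pow_orderOf_eq_one σ⟩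
  obtain ⟨N, hN, hσN⟩ := period
  have orbit : ∀ c : {c // P c}, ∀ d, IsMissing E c d → ∃ n : ℕ, ((σ ^ n) c : V) = d := by
    intro c d hd
    by_contra hno
    push Not at hno
    have key : ∀ i : ℕ, E ((σ ^ (i+1)) c : V) c := by
      intro i
      induction i with
      | zero =>
        obtain ⟨a, b, h⟩ := hσ c
        simpa using labback h
      | succ i ih =>
        obtain ⟨a, b, h⟩ := hσ ((σ ^ (i+1)) c)
        have e : σ ((σ ^ (i+1)) c) = (σ ^ (i+1+1)) c := by
          rw [pow_succ' σ (i+1), Equiv.Perm.mul_apply]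
        rw [e] at h
        refine labmono h c ?_ ?_ ih
        · intro heq
          have hb := labback h
          rw [← heq] at hb
          exact hdigon _ _ ⟨hb, ih⟩
        · rintro rfl
          exact hno (i+1+1) (hmatch _ _ _ h.2.1 hd)
    have := key (N - 1)
    rw [Nat.sub_add_cancel hN, hσN] at this
    exact hloop _ this
  have labE' : ∀ {c d d' c'}, P c → P c' → LosesLab E c d d' c' → LosesLab E' c d d' c' := by
    have half : ∀ {a b : V}, P a → P b → b ∉ Nplus E a ∪ Npp E a → b ∉ Nplus E' a ∪ Npp E' a := by
      intro a b ha hb h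
      rintro (k | ⟨k1, k2, u, k3, k4⟩)
      · exact (mem1 _ _ h).1 (Pout ha k)
      · exact (mem1 _ _ h).2 k1 u (Pout ha k3) (Pin hb k4)
    rintro c d d' c' hc hc' ⟨h1, h2, h3, h4, h5, h6⟩
    exact ⟨missE' hc h1, missE' (Psym hc' (misym h2)) h2, hsub _ _ h3, half hc hc' h4, hsub _ _ h5,
      half (Psym hc h1) (Psym hc' (misym h2)) h6⟩
  have labE : ∀ {c d d' c'}, LosesLab E' c d d' c' → P c ∧ P c' ∧ LosesLab E c d d' c' := by
    have half : ∀ {a b : V}, b ∉ Nplus E' a ∪ Npp E' a → b ∉ Nplus E a ∪ Npp E a := by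
      intro a b h
      rintro (k | ⟨k1, k2, u, k3, k4⟩)
      · exact h (Or.inl (hsub _ _ k))
      · exact h (Or.inr ⟨k1, fun k => h (Or.inl k), u, hsub _ _ k3, hsub _ _ k4⟩)
    rintro c d d' c' ⟨h1, h2, h3, h4, h5, h6⟩
    obtain ⟨m1, p1⟩ := missE h1
    obtain ⟨m2, p2⟩ := missE h2
    exact ⟨p1, Psym p2 m2, m1, m2, Pout p1 h3, half h4, Pout (Psym p1 m1) h5, half h6⟩
  have stepK : ∀ c : {c // P c}, SameK E' c (σ c) := by
    intro c
    obtain ⟨d, d', h⟩ := hσ c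
    refine Relation.EqvGen.rel _ _ (Or.inr ⟨s((c:V), d), s(d', (σ c : V)), ?_, by simp, by simp⟩)
    exact ⟨_, _, _, _, rfl, rfl, labE' c.2 (σ c).2 h⟩
  have step : ∀ (c : {c // P c}) w, ¬ SameK E' c w → E c w → E (σ c) w := by
    intro c w hw hcw
    have hs := stepK c
    obtain ⟨d, d', h⟩ := hσ c
    refine labmono h w ?_ ?_ hcw
    · rintro rfl; exact hw hs
    · rintro rfl
      exact hw (hs.trans _ _ _ (Relation.EqvGen.rel _ _ (Or.inl (missE' (σ c).2 (misym h.2.1)))))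
  have steps : ∀ (n : ℕ) (c : {c // P c}) w, ¬ SameK E' c w → E c w →
      SameK E' c ((σ ^ n) c) ∧ E ((σ ^ n) c) w := by
    intro n c w hw hcw
    induction n with
    | zero => exact ⟨Relation.EqvGen.refl _, by simpa using hcw⟩
    | succ n ih =>
      rw [pow_succ' σ n, Equiv.Perm.mul_apply]
      refine ⟨ih.1.trans _ _ _ (stepK _), step _ _ (fun hh => hw (ih.1.trans _ _ _ hh)) ih.2⟩
  have reach : ∀ (n : ℕ) (c : {c // P c}), ∃ m : ℕ, (σ ^ m) ((σ ^ n) c) = c := by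
    intro n c
    refine ⟨n * N - n, ?_⟩
    rw [← Equiv.Perm.mul_apply, ← pow_add, Nat.sub_add_cancel (Nat.le_mul_of_pos_right n hN),
      mul_comm, pow_mul, hσN]
    simp
  have adj : ∀ c w, P c → ¬ SameK E' c w → (E w c ↔ ¬ E c w) := by
    intro c w hc hw
    refine ⟨fun h k => hdigon _ _ ⟨h, k⟩, fun h => ?_⟩
    by_contra hn
    refine hw (Relation.EqvGen.rel _ _ (Or.inl (missE' hc ⟨?_, h, hn⟩)))
    rintro rfl
    exact hw (Relation.EqvGen.refl _)
  let Q : V → V → Prop := fun a b => ∀ w, ¬ SameK E' a w → (E' a w ↔ E' b w) ∧ (E' w a ↔ E' w b)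
  have orbQ : ∀ (n : ℕ) (c : {c // P c}), SameK E' c ((σ ^ n) c) → Q c ((σ ^ n) c) := by
    intro n c hs w hw
    have hw' : ¬ SameK E' ((σ ^ n) c) w := fun hh => hw (hs.trans _ _ _ hh)
    have hiff : E c w ↔ E ((σ ^ n) c) w := by
      refine ⟨fun h => (steps n c w hw h).2, fun h => ?_⟩
      obtain ⟨m, hm⟩ := reach n c
      have := (steps m _ w hw' h).2
      rwa [hm] at this
    have o1 : ∀ a : {c // P c}, E' a w ↔ E a w := fun a => ⟨Pout a.2, hsub _ _⟩
    have o2 : ∀ a : {c // P c}, E' w a ↔ E w a := fun a => ⟨Pin a.2, hsub _ _⟩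
    rw [o1, o1, o2, o2, adj _ _ c.2 hw, adj _ _ ((σ ^ n) c).2 hw', hiff]
    exact ⟨Iff.rfl, Iff.rfl⟩
  have missQ : ∀ a b, IsMissing E' a b → Q a b := by
    intro a b h
    obtain ⟨m, pa⟩ := missE h
    obtain ⟨n, hn⟩ := orbit ⟨a, pa⟩ b m
    have := orbQ n ⟨a, pa⟩ (by rw [hn]; exact Relation.EqvGen.rel _ _ (Or.inl h))
    rwa [hn] at this
  have labQ : ∀ c d d' c', LosesLab E' c d d' c' → Q c c' := by
    intro c d d' c' h
    obtain ⟨p1, p2, h'⟩ := labE h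
    have e : (σ ⟨c, p1⟩ : V) = c' := Rfun (hσ ⟨c, p1⟩) ⟨d, d', h'⟩
    have := orbQ 1 ⟨c, p1⟩ (by simpa using stepK ⟨c, p1⟩)
    rw [pow_one, e] at this
    exact this
  have Qtrans : ∀ a b c, SameK E' a b → Q a b → Q b c → Q a c := by
    intro a b c hs h1 h2 w hw
    have k1 := h1 w hw
    have k2 := h2 w (fun hh => hw (hs.trans _ _ _ hh))
    exact ⟨k1.1.trans k2.1, k1.2.trans k2.2⟩
  have lab'sym : ∀ {c d d' c'}, LosesLab E' c d d' c' → LosesLab E' d c c' d' := by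
    rintro c d d' c' ⟨⟨a1, a2, a3⟩, ⟨b1, b2, b3⟩, h3, h4, h5, h6⟩
    exact ⟨⟨a1.symm, a3, a2⟩, ⟨b1.symm, b3, b2⟩, h5, h6, h3, h4⟩
  have labcross : ∀ c d d' c', LosesLab E' c d d' c' → Q c d' := by
    intro c d d' c' h
    refine Qtrans c d d' (Relation.EqvGen.rel _ _ (Or.inl h.1)) (missQ _ _ h.1) ?_
    exact labQ _ _ _ _ (lab'sym h)
  have touchQ : ∀ a b, MissTouch E' a b → Q a b := by
    rintro a b (h | ⟨e, f, ⟨x1, y1, x2, y2, rfl, rfl, hl⟩, ha, hb⟩)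
    · exact missQ _ _ h
    · rcases Sym2.mem_iff.1 ha with rfl | rfl <;> rcases Sym2.mem_iff.1 hb with rfl | rfl
      · exact labcross _ _ _ _ hl
      · exact labQ _ _ _ _ hl
      · exact labQ _ _ _ _ (lab'sym hl)
      · exact labcross _ _ _ _ (lab'sym hl)
  have sameQ : ∀ a b, SameK E' a b → Q a b := by
    intro a b h
    induction h with
    | rel a b h => exact touchQ _ _ h
    | refl a => exact fun w _ => ⟨Iff.rfl, Iff.rfl⟩
    | symm a b h ih =>
      intro w hw
      have := ih w (fun hh => hw ((h.symm _ _).trans _ _ _ hh))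
      exact ⟨this.1.symm, this.2.symm⟩
    | trans a b c h1 h2 ih1 ih2 => exact Qtrans _ _ _ h1 ih1 ih2
  intro f u hu v hv
  have huv : SameK E' u v := (Relation.EqvGen.symm _ _ hu).trans _ _ _ hv
  have hQ := sameQ u v huv
  have hout : ∀ w, w ∉ Jset E' f → ¬ SameK E' u w :=
    fun w hw hh => hw (Relation.EqvGen.trans _ _ _ hu hh)
  constructor
  · ext w
    exact ⟨fun h => ⟨(hQ w (hout w h.2)).1.1 h.1, h.2⟩, fun h => ⟨(hQ w (hout w h.2)).1.2 h.1, h.2⟩⟩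
  · ext w
    exact ⟨fun h => ⟨(hQ w (hout w h.2)).2.1 h.1, h.2⟩, fun h => ⟨(hQ w (hout w h.2)).2.2 h.1, h.2⟩⟩
end

section
/- Let D be a finite oriented graph missing a matching and let D' = D + F be the good oriented graph obtained from D by adding, for each connected component of the dependency digraph Δ that is a maximal directed path P = a₁b₁, …, a_kb_k, the arcs (aᵢ,bᵢ) for all i if (a₁,b₁) is a convenient orientation of the good missing edge a₁b₁, and the arcs (bᵢ,aᵢ) for all i otherwise. Then every feed vertex of D' (i.e., the last vertex of any good median order of D') has the SNP both in D and in D'. In particular, D satisfies Seymour's Second Neighborhood Conjecture. -/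
variable {V : Type*}

/-- The feed property of median orders. -/
theorem aux_feed {V : Type*} {n : ℕ} (E : V → V → Prop) (L : Fin n ≃ V) (hL : IsMedian E L)
    (m i : Fin n) (hmi : m ≤ i) :
    Set.ncard {j | m ≤ j ∧ j < i ∧ E (L i) (L j)} ≤
      Set.ncard {j | m ≤ j ∧ j < i ∧ E (L j) (L i)} := by
  classical
  let key : Fin n → ℕ := fun p => if p = i then 2 * m.val else 2 * p.val + 1
  have hkinj : Function.Injective key := by
    intro p q h
    simp only [key] at h
    split_ifs at h with h1 h2 h2
    · rw [h1, h2]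
    · omega
    · omega
    · exact Fin.ext (by omega)
  let e := Tuple.sort key
  have hmono : Monotone (key ∘ e) := Tuple.monotone_sort key
  have hstrict : StrictMono (key ∘ e) := hmono.strictMono_of_injective (hkinj.comp e.injective)
  have hlt : ∀ p q, p < q ↔ key (e p) < key (e q) := fun p q => (hstrict.lt_iff_lt).symm
  have h1 := hL (e.trans L)
  unfold fwdCount at h1
  have h2 : Set.ncard {p : Fin n × Fin n | p.1 < p.2 ∧ E ((e.trans L) p.1) ((e.trans L) p.2)}
      = Set.ncard {p : Fin n × Fin n | key p.1 < key p.2 ∧ E (L p.1) (L p.2)} := by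
    rw [← Set.ncard_image_of_injective _ (Equiv.prodCongr e e).injective]
    congr 1
    ext ⟨p, q⟩
    simp only [Set.mem_image, Set.mem_ofPred_eq, Prod.exists, Equiv.prodCongr_apply, Prod.map,
      Prod.mk.injEq, Equiv.trans_apply]
    constructor
    · rintro ⟨a, b, ⟨hab, hE⟩, rfl, rfl⟩
      exact ⟨(hlt a b).1 hab, hE⟩
    · rintro ⟨hk, hE⟩
      refine ⟨e.symm p, e.symm q, ⟨(hlt _ _).2 (by simpa using hk), by simpa using hE⟩, ?_, ?_⟩ <;> simp
  rw [h2] at h1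
  let C : Set (Fin n × Fin n) := {p | p.1 < p.2 ∧ E (L p.1) (L p.2) ∧ ¬ (p.2 = i ∧ m ≤ p.1)}
  have hS : {p : Fin n × Fin n | p.1 < p.2 ∧ E (L p.1) (L p.2)} =
      C ∪ (fun j => (j, i)) '' {j | m ≤ j ∧ j < i ∧ E (L j) (L i)} := by
    ext ⟨p, q⟩
    simp only [C, Set.mem_ofPred_eq, Set.mem_union, Set.mem_image, Prod.mk.injEq]
    constructor
    · rintro ⟨h, hE⟩
      by_cases hc : q = i ∧ m ≤ p
      · right
        obtain ⟨rfl, hm⟩ := hc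
        exact ⟨p, ⟨hm, h, hE⟩, rfl, rfl⟩
      · exact Or.inl ⟨h, hE, hc⟩
    · rintro (⟨h, hE, -⟩ | ⟨j, ⟨h1, h2, h3⟩, rfl, rfl⟩)
      · exact ⟨h, hE⟩
      · exact ⟨h2, h3⟩
  have hS' : C ∪ (fun j => (i, j)) '' {j | m ≤ j ∧ j < i ∧ E (L i) (L j)} ⊆
      {p : Fin n × Fin n | key p.1 < key p.2 ∧ E (L p.1) (L p.2)} := by
    rintro ⟨p, q⟩
    simp only [C, Set.mem_ofPred_eq, Set.mem_union, Set.mem_image, Prod.mk.injEq, key]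
    rintro (⟨h, hE, hc⟩ | ⟨j, ⟨h1, h2, h3⟩, rfl, rfl⟩)
    · refine ⟨?_, hE⟩
      split_ifs with a b b
      · subst a; subst b; exact absurd h (lt_irrefl _)
      · subst a
        have : p.val < q.val := h
        have : m.val ≤ p.val := hmi
        omega
      · have : ¬ m.val ≤ p.val := fun hh => hc ⟨b, hh⟩
        omega
      · have : p.val < q.val := h
        omega
    · refine ⟨?_, h3⟩
      rw [if_pos rfl, if_neg (ne_of_lt h2)]
      have : m.val ≤ j.val := h1
      omega
  rw [hS, Set.ncard_union_eq ?_ (Set.toFinite _) (Set.toFinite _)] at h1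
  · have h3 := Set.ncard_le_ncard hS' (Set.toFinite _)
    rw [Set.ncard_union_eq ?_ (Set.toFinite _) (Set.toFinite _)] at h3
    · rw [Set.ncard_image_of_injective _ (fun a b h => by simpa using h)] at h1 h3
      omega
    · rw [Set.disjoint_left]
      rintro ⟨p, q⟩ ⟨hp, -, -⟩ ⟨j, ⟨h1, h2, h3⟩, hj⟩
      simp only [Prod.mk.injEq] at hj hp
      obtain ⟨rfl, rfl⟩ := hj
      exact absurd h2 (not_lt.2 hp.le)
  · rw [Set.disjoint_left]
    rintro ⟨p, q⟩ ⟨-, -, hp⟩ ⟨j, ⟨h1, h2, h3⟩, hj⟩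
    simp only [Prod.mk.injEq] at hj
    obtain ⟨rfl, rfl⟩ := hj
    exact hp ⟨rfl, h1⟩

/-- Counting of good vertices, on the vertex set `Fin (n+1)` with its natural order. -/
theorem aux_core_fin {n : ℕ} (A R : Fin (n + 1) → Fin (n + 1) → Prop)
    (hR : Equivalence R) (hdig : ∀ x y, ¬ (A x y ∧ A y x))
    (hadj : ∀ x y, ¬ R x y → A x y ∨ A y x)
    (hout : ∀ u v z, R u v → ¬ R u z → A u z → A v z)
    (hin : ∀ u v z, R u v → ¬ R u z → A z u → A z v)
    (hconv : ∀ i j k, i ≤ j → j ≤ k → R i k → R i j)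
    (hfeed : ∀ m i : Fin (n + 1), m ≤ i →
      Set.ncard {j | m ≤ j ∧ j < i ∧ A i j} ≤ Set.ncard {j | m ≤ j ∧ j < i ∧ A j i})
    (f : Fin (n + 1)) (hf : f = Fin.last n) (d : ℕ) : ∀ m : ℕ, n + 1 - m ≤ d →
    Set.ncard {j : Fin (n + 1) | m ≤ j.val ∧ A f j ∧ ¬ R f j} ≤
    Set.ncard {j : Fin (n + 1) | m ≤ j.val ∧ ¬ A f j ∧ ¬ R f j ∧
      ∃ i, m ≤ i.val ∧ i ≤ j ∧ A f i ∧ A i j} := by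
  classical
  have hirr : ∀ x, ¬ A x x := fun x h => hdig x x ⟨h, h⟩
  have hle : ∀ x : Fin (n + 1), x ≤ f := fun x => hf ▸ Fin.le_last x
  have hconv' : ∀ s j, R f s → s ≤ j → R f j := fun s j h1 h2 =>
    hR.trans h1 (hconv s j f h2 (hle j) (hR.symm h1))
  induction d with
  | zero =>
    intro m hm
    have : {j : Fin (n + 1) | m ≤ j.val ∧ A f j ∧ ¬ R f j} = ∅ := by
      ext j
      simp only [Set.mem_ofPred_eq, Set.mem_empty_iff_false, iff_false]
      rintro ⟨h, -⟩
      have := j.isLt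
      omega
    rw [this]; simp
  | succ d ih =>
    intro m hm
    let P : Fin (n + 1) → Prop := fun j => m ≤ j.val ∧ ¬ A f j ∧ ¬ R f j ∧
      ¬ ∃ i, m ≤ i.val ∧ i ≤ j ∧ A f i ∧ A i j
    by_cases hB : ∃ j, P j
    · obtain ⟨i, hi, himin⟩ : ∃ i, P i ∧ ∀ j, P j → i ≤ j := by
        have hne : (Finset.univ.filter P).Nonempty := by
          obtain ⟨j, hj⟩ := hB
          exact ⟨j, by simpa using hj⟩
        refine ⟨(Finset.univ.filter P).min' hne, ?_, ?_⟩
        · have := Finset.min'_mem _ hne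
          simpa using this
        · intro j hj
          exact Finset.min'_le _ _ (by simpa using hj)
      obtain ⟨hmi, hnA, hnR, hbad⟩ := hi
      have hAif : A i f := (hadj f i hnR).resolve_left hnA
      have hrec := ih (i.val + 1) (by have := i.isLt; omega)
      let m' : Fin (n + 1) := ⟨m, lt_of_le_of_lt hmi i.isLt⟩
      have hfe := hfeed m' i hmi
      have hltR : ∀ j, j < i → ¬ R f j := fun j hj h => hnR (hconv' j i h hj.le)
      have s1 : {j : Fin (n + 1) | m ≤ j.val ∧ A f j ∧ ¬ R f j} ⊆
          {j | m' ≤ j ∧ j < i ∧ A i j} ∪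
          {j : Fin (n + 1) | i.val + 1 ≤ j.val ∧ A f j ∧ ¬ R f j} := by
        rintro j ⟨h1, h2, h3⟩
        by_cases hji : i.val + 1 ≤ j.val
        · exact Or.inr ⟨hji, h2, h3⟩
        · left
          have hne : j ≠ i := by rintro rfl; exact hnA h2
          have hlt : j < i := lt_of_le_of_ne (by rw [Fin.le_def]; omega) hne
          refine ⟨h1, hlt, ?_⟩
          have hnij : ¬ R i j := by
            intro h
            have : A j f := hout i j f h (fun h' => hnR (hR.symm h')) hAif
            exact hdig _ _ ⟨h2, this⟩
          refine (hadj i j hnij).resolve_right fun h => hbad ⟨j, h1, hlt.le, h2, h⟩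
      have s2 : {j | m' ≤ j ∧ j < i ∧ A j i} ∪ {j : Fin (n + 1) | i.val + 1 ≤ j.val ∧ ¬ A f j ∧
          ¬ R f j ∧ ∃ i', i.val + 1 ≤ i'.val ∧ i' ≤ j ∧ A f i' ∧ A i' j} ⊆
          {j : Fin (n + 1) | m ≤ j.val ∧ ¬ A f j ∧ ¬ R f j ∧
            ∃ i, m ≤ i.val ∧ i ≤ j ∧ A f i ∧ A i j} := by
        rintro j (⟨h1, h2, h3⟩ | ⟨h1, h2, h3, i', h4, h5⟩)
        · have hnfj : ¬ A f j := fun h => hbad ⟨j, h1, h2.le, h, h3⟩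
          refine ⟨h1, hnfj, hltR j h2, ?_⟩
          by_contra hc
          exact absurd (himin j ⟨h1, hnfj, hltR j h2, hc⟩) (not_le.2 h2)
        · exact ⟨by omega, h2, h3, i', by omega, h5⟩
      have c1 := Set.ncard_le_ncard s1 (Set.toFinite _)
      have c2 := Set.ncard_le_ncard s2 (Set.toFinite _)
      have c3 := Set.ncard_union_le {j | m' ≤ j ∧ j < i ∧ A i j}
          {j : Fin (n + 1) | i.val + 1 ≤ j.val ∧ A f j ∧ ¬ R f j}
      rw [Set.ncard_union_eq ?_ (Set.toFinite _) (Set.toFinite _)] at c2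
      · omega
      · rw [Set.disjoint_left]
        rintro j ⟨-, h, -⟩ ⟨h', -⟩
        rw [Fin.lt_def] at h
        omega
    · push Not at hB
      have hgood : ∀ j : Fin (n + 1), m ≤ j.val → ¬ A f j → ¬ R f j →
          ∃ i, m ≤ i.val ∧ i ≤ j ∧ A f i ∧ A i j := by
        intro j h1 h2 h3
        by_contra hc
        exact hB j ⟨h1, h2, h3, hc⟩
      obtain ⟨s, hs, hsmin⟩ : ∃ s, R f s ∧ ∀ j, R f j → s ≤ j := by
        have hne : (Finset.univ.filter (R f)).Nonempty := ⟨f, by simpa using hR.refl f⟩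
        refine ⟨(Finset.univ.filter (R f)).min' hne, ?_, ?_⟩
        · have := Finset.min'_mem _ hne
          simpa using this
        · intro j hj
          exact Finset.min'_le _ _ (by simpa using hj)
      by_cases hms : m ≤ s.val
      · let m' : Fin (n + 1) := ⟨m, lt_of_le_of_lt hms s.isLt⟩
        have hfe := hfeed m' s hms
        refine le_trans (Set.ncard_le_ncard ?_ (Set.toFinite _))
          (le_trans hfe (Set.ncard_le_ncard ?_ (Set.toFinite _)))
        · rintro j ⟨h1, h2, h3⟩
          refine ⟨h1, ?_, hout f s j hs h3 h2⟩
          by_contra hc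
          exact h3 (hconv' s j hs (not_lt.1 hc))
        · rintro j ⟨h1, h2, h3⟩
          have hnR : ¬ R f j := fun h => absurd (hsmin j h) (not_le.2 h2)
          have : A j f := hin s f j (hR.symm hs) (fun h => hnR (hR.trans hs h)) h3
          have hn : ¬ A f j := fun h => hdig _ _ ⟨h, this⟩
          exact ⟨h1, hn, hnR, hgood j h1 hn hnR⟩
      · have : {j : Fin (n + 1) | m ≤ j.val ∧ A f j ∧ ¬ R f j} = ∅ := by
          ext j
          simp only [Set.mem_ofPred_eq, Set.mem_empty_iff_false, iff_false]
          rintro ⟨h, -, h3⟩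
          exact h3 (hconv' s j hs (by rw [Fin.le_def]; omega))
        rw [this]; simp

theorem aux_core_s15 {V : Type*} {n : ℕ} (E R : V → V → Prop)
    (hR : Equivalence R) (hdig : ∀ x y, ¬ (E x y ∧ E y x))
    (hadj : ∀ x y, ¬ R x y → E x y ∨ E y x)
    (hout : ∀ u v z, R u v → ¬ R u z → E u z → E v z)
    (hin : ∀ u v z, R u v → ¬ R u z → E z u → E z v)
    (L : Fin (n + 1) ≃ V)
    (hconv : ∀ v, OrderConvex L {w | R v w})
    (hfeed : ∀ m i : Fin (n + 1), m ≤ i →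
      Set.ncard {j | m ≤ j ∧ j < i ∧ E (L i) (L j)} ≤
      Set.ncard {j | m ≤ j ∧ j < i ∧ E (L j) (L i)})
    (f : V) (hf : f = L (Fin.last n)) :
    Set.ncard {w | E f w ∧ ¬ R f w} ≤ Set.ncard {w | w ∈ Npp E f ∧ ¬ R f w} := by
  have hVfin : Finite V := Finite.of_equiv _ L
  have h := aux_core_fin (fun i j => E (L i) (L j)) (fun i j => R (L i) (L j))
    ⟨fun _ => hR.refl _, fun h => hR.symm h, fun h h' => hR.trans h h'⟩
    (fun x y => hdig _ _) (fun x y => hadj _ _) (fun u v z => hout _ _ _)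
    (fun u v z => hin _ _ _)
    (fun i j k h1 h2 h3 => hconv (L i) i j k h1 h2 (hR.refl _) h3) hfeed _ rfl (n + 1) 0 (by simp)
  simp only [← hf] at h
  calc Set.ncard {w | E f w ∧ ¬ R f w}
      = Set.ncard (L '' {j | 0 ≤ j.val ∧ E f (L j) ∧ ¬ R f (L j)}) := by
        congr 1
        ext w
        simp only [Set.mem_ofPred_eq, Set.mem_image]
        constructor
        · intro h
          exact ⟨L.symm w, by simpa using h, by simp⟩
        · rintro ⟨j, ⟨-, hj⟩, rfl⟩
          exact hj
    _ = _ := Set.ncard_image_of_injective _ L.injective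
    _ ≤ _ := h
    _ = _ := (Set.ncard_image_of_injective _ L.injective).symm
    _ ≤ _ := by
        refine Set.ncard_le_ncard ?_ (Set.toFinite _)
        rintro _ ⟨j, ⟨-, h1, h2, i, -, -, h3, h4⟩, rfl⟩
        refine ⟨⟨?_, h1, L i, h3, h4⟩, h2⟩
        intro hh
        exact h2 (hh ▸ hR.refl _)

theorem aux_miss_symm {V : Type*} {E : V → V → Prop} {x y : V} (h : IsMissing E x y) :
    IsMissing E y x := ⟨h.1.symm, h.2.2, h.2.1⟩

theorem aux_lab_symm {V : Type*} {E : V → V → Prop} {x1 y1 x2 y2 : V}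
    (h : LosesLab E x1 y1 x2 y2) : LosesLab E y1 x1 y2 x2 :=
  ⟨aux_miss_symm h.1, aux_miss_symm h.2.1, h.2.2.2.2.1, h.2.2.2.2.2, h.2.2.1, h.2.2.2.1⟩

/-- No path of length two from the first to the opposite end. -/
theorem aux_lab_nopath {V : Type*} {E : V → V → Prop} (hdigon : ∀ x y, ¬ (E x y ∧ E y x))
    {x1 y1 x2 y2 : V} (h : LosesLab E x1 y1 x2 y2) {u : V} : E x1 u → E u y2 → False := by
  obtain ⟨h1, h2, h3, h4, h5, h6⟩ := h
  intro hu hu'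
  apply h4
  by_cases hE : E x1 y2
  · exact Or.inl hE
  · right
    refine ⟨?_, hE, u, hu, hu'⟩
    rintro rfl
    exact hdigon _ _ ⟨hu, hu'⟩

/-- In-degree at most one. -/
theorem aux_lab_uniq {V : Type*} {E : V → V → Prop} (hdigon : ∀ x y, ¬ (E x y ∧ E y x))
    (hmatch : ∀ a b c, IsMissing E a b → IsMissing E a c → b = c)
    {x1 y1 x1' y1' x2 y2 : V} (h : LosesLab E x1 y1 x2 y2) (h' : LosesLab E x1' y1' x2 y2) :
    y1 = y1' := by
  refine hmatch x1 _ _ h.1 ⟨?_, ?_, ?_⟩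
  · rintro rfl
    exact h'.2.2.2.2.2 (Or.inl h.2.2.1)
  · intro hE
    exact aux_lab_nopath hdigon h hE h'.2.2.2.2.1
  · intro hE
    exact aux_lab_nopath hdigon (aux_lab_symm h') hE h.2.2.1

/-- Out-degree at most one. -/
theorem aux_lab_uniq_out {V : Type*} {E : V → V → Prop} (hdigon : ∀ x y, ¬ (E x y ∧ E y x))
    (hmatch : ∀ a b c, IsMissing E a b → IsMissing E a c → b = c)
    {x1 y1 x2 y2 x2' y2' : V} (h : LosesLab E x1 y1 x2 y2) (h' : LosesLab E x1 y1 x2' y2') :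
    y2 = y2' := by
  refine hmatch x2 _ _ h.2.1 ⟨?_, ?_, ?_⟩
  · rintro rfl
    exact h'.2.2.2.1 (Or.inl h.2.2.1)
  · intro hE
    exact aux_lab_nopath hdigon h' h.2.2.1 hE
  · intro hE
    exact aux_lab_nopath hdigon (aux_lab_symm h) h'.2.2.2.2.1 hE

/-- If `x1 y1` loses to `x2 y2` then `y2 → x1`. -/
theorem aux_lab_back {V : Type*} {E : V → V → Prop} (hdigon : ∀ x y, ¬ (E x y ∧ E y x))
    (hmatch : ∀ a b c, IsMissing E a b → IsMissing E a c → b = c)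
    {x1 y1 x2 y2 : V} (h : LosesLab E x1 y1 x2 y2) : E y2 x1 := by
  by_contra hE
  have hm : IsMissing E x1 y2 := by
    refine ⟨?_, fun h' => h.2.2.2.1 (Or.inl h'), hE⟩
    rintro rfl
    exact h.2.1.2.2 h.2.2.1
  have := hmatch _ _ _ h.1 hm
  subst this
  exact hdigon _ _ ⟨h.2.2.2.2.1, h.2.2.2.2.1⟩

/-- Step of propagation. -/
theorem aux_lab_step {V : Type*} {E : V → V → Prop} (hdigon : ∀ x y, ¬ (E x y ∧ E y x))
    (hmatch : ∀ a b c, IsMissing E a b → IsMissing E a c → b = c)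
    {x1 y1 x2 y2 u : V} (h : LosesLab E x1 y1 x2 y2) (hu : E u y2) (hn : u ≠ y1) : E u x1 := by
  by_contra hE
  apply hn
  symm
  refine hmatch x1 _ _ h.1 ⟨?_, fun h' => aux_lab_nopath hdigon h h' hu, hE⟩
  rintro rfl
  exact hdigon _ _ ⟨hu, aux_lab_back hdigon hmatch h⟩

/-- The structure theorem: when every missing edge has a predecessor, there is a permutation
whose cycles are the sets `J`. -/
theorem aux_perm {V : Type*} [Finite V] (E : V → V → Prop)
    (hdigon : ∀ x y, ¬ (E x y ∧ E y x))
    (hmatch : ∀ a b c, IsMissing E a b → IsMissing E a c → b = c)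
    (hpred : ∀ x y, IsMissing E x y → ∃ x1 y1, LosesLab E x1 y1 x y) :
    ∃ T : Equiv.Perm V,
      (∀ x y, IsMissing E x y → LosesLab E (T y) (T x) x y) ∧
      (∀ x, (¬ ∃ y, IsMissing E x y) → T x = x) := by
  classical
  have hex : ∀ x, ∃ t, (∀ y, IsMissing E x y → ∃ s, LosesLab E s t x y) ∧
      ((¬ ∃ y, IsMissing E x y) → t = x) := by
    intro x
    by_cases hx : ∃ y, IsMissing E x y
    · obtain ⟨y, hy⟩ := hx
      obtain ⟨x1, y1, h1⟩ := hpred x y hy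
      refine ⟨y1, ?_, fun h => absurd ⟨y, hy⟩ h⟩
      intro y' hy'
      rw [hmatch _ _ _ hy' hy]
      exact ⟨x1, h1⟩
    · exact ⟨x, fun y hy => absurd ⟨y, hy⟩ hx, fun _ => rfl⟩
  choose T hT1 hT2 using hex
  have hT : ∀ x y, IsMissing E x y → LosesLab E (T y) (T x) x y := by
    intro x y hxy
    obtain ⟨s, hs⟩ := hT1 x y hxy
    obtain ⟨s', hs'⟩ := hT1 y x (aux_miss_symm hxy)
    have := aux_lab_uniq hdigon hmatch (aux_lab_symm hs) hs'
    rw [← this]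
    exact hs
  have hinj : Function.Injective T := by
    intro x x' hxx
    by_cases hx : ∃ y, IsMissing E x y
    · obtain ⟨y, hy⟩ := hx
      have h1 := hT x y hy
      by_cases hx' : ∃ y, IsMissing E x' y
      · obtain ⟨y', hy'⟩ := hx'
        have h2 := hT x' y' hy'
        rw [← hxx] at h2
        have : T y = T y' := hmatch _ _ _ (aux_miss_symm h1.1) (aux_miss_symm h2.1)
        rw [← this] at h2
        exact aux_lab_uniq_out hdigon hmatch (aux_lab_symm h1) (aux_lab_symm h2)
      · have := hT2 x' hx'
        rw [← hxx] at this
        exact absurd ⟨_, this ▸ aux_miss_symm h1.1⟩ hx'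
    · have h1 := hT2 x hx
      by_cases hx' : ∃ y, IsMissing E x' y
      · obtain ⟨y', hy'⟩ := hx'
        have h2 := hT x' y' hy'
        rw [← hxx, h1] at h2
        exact absurd ⟨_, aux_miss_symm h2.1⟩ hx
      · rw [← h1, ← hT2 x' hx', hxx]
  exact ⟨Equiv.ofBijective T (Finite.injective_iff_bijective.1 hinj), hT, hT2⟩

/-- The partner is in the cycle; more precisely. -/
theorem aux_partner {V : Type*} [Finite V] (E : V → V → Prop)
    (hdigon : ∀ x y, ¬ (E x y ∧ E y x))
    (hmatch : ∀ a b c, IsMissing E a b → IsMissing E a c → b = c)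
    (T : Equiv.Perm V) (hT : ∀ x y, IsMissing E x y → LosesLab E (T y) (T x) x y)
    (x y : V) (hxy : IsMissing E x y) :
    ∃ k : ℕ, 2 ≤ k ∧ (T ^ k) x = y ∧ ∀ j, 1 ≤ j → j < k → E x ((T ^ j) x) := by
  classical
  have hpart : ∀ j : ℕ, IsMissing E ((T ^ j) x) ((T ^ j) y) := by
    intro j
    induction j with
    | zero => simpa using hxy
    | succ j ih =>
      rw [pow_succ', Equiv.Perm.mul_apply, Equiv.Perm.mul_apply]
      exact aux_miss_symm (hT _ _ ih).1
  have hx1 : E x (T x) := by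
    have := aux_lab_back hdigon hmatch (aux_lab_symm (hT x y hxy))
    exact this
  have hstep : ∀ k : ℕ, (∀ j, j ≤ k → (T ^ j) x ≠ y) → ∀ j, 1 ≤ j → j ≤ k → E x ((T ^ j) x) := by
    intro k hk j
    induction j with
    | zero => intro h; omega
    | succ j ih =>
      intro _ hjk
      rcases Nat.eq_zero_or_pos j with rfl | hj
      · simpa using hx1
      · have h1 := ih hj (by omega)
        have h2 := hT _ _ (hpart j)
        have h3 := hpart (j + 1)
        rw [pow_succ', Equiv.Perm.mul_apply, Equiv.Perm.mul_apply] at h3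
        rw [pow_succ', Equiv.Perm.mul_apply]
        refine aux_lab_step hdigon hmatch (aux_lab_symm h2) h1 ?_
        intro hx
        have h4 : IsMissing E x (T ((T ^ j) x)) := by
          rw [← hx] at h3
          exact aux_miss_symm h3
        apply hk (j + 1) hjk
        rw [pow_succ', Equiv.Perm.mul_apply]
        exact hmatch _ _ _ h4 hxy
  have hex : ∃ k : ℕ, (T ^ k) x = y := by
    by_contra hc
    push Not at hc
    have h1 := hstep (orderOf T) (fun j _ => hc j) (orderOf T) (orderOf_pos T) le_rfl
    rw [pow_orderOf_eq_one] at h1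
    exact hdigon _ _ ⟨h1, h1⟩
  refine ⟨Nat.find hex, ?_, Nat.find_spec hex, ?_⟩
  · rcases h : Nat.find hex with _ | _ | k
    · have := Nat.find_spec hex
      rw [h] at this
      exact absurd this hxy.1
    · have := Nat.find_spec hex
      rw [h] at this
      simp only [zero_add, pow_one] at this
      exact absurd (this ▸ hx1) hxy.2.1
    · omega
  · intro j h1 h2
    exact hstep j (fun i hi => Nat.find_min hex (by omega)) j h1 le_rfl

theorem aux_sameK_equiv {V : Type*} (E : V → V → Prop) : Equivalence (SameK E) :=
  Relation.EqvGen.is_equivalence _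

theorem aux_sameK {V : Type*} [Finite V] (E : V → V → Prop)
    (hdigon : ∀ x y, ¬ (E x y ∧ E y x))
    (hmatch : ∀ a b c, IsMissing E a b → IsMissing E a c → b = c)
    (T : Equiv.Perm V) (hT : ∀ x y, IsMissing E x y → LosesLab E (T y) (T x) x y)
    (hT2 : ∀ x, (¬ ∃ y, IsMissing E x y) → T x = x) (x y : V) :
    SameK E x y ↔ ∃ k : ℕ, (T ^ k) x = y := by
  have hmiss : ∀ x y, IsMissing E x y → T.SameCycle x y := by
    intro x y h
    obtain ⟨k, -, hk, -⟩ := aux_partner E hdigon hmatch T hT x y h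
    exact ⟨k, by simpa using hk⟩
  constructor
  · intro h
    have hsc : T.SameCycle x y := by
      unfold SameK at h
      induction h with
      | rel a b hab =>
        rcases hab with hab | ⟨e, g, ⟨x1, y1, x2, y2, rfl, rfl, hl⟩, ha, hb⟩
        · exact hmiss _ _ hab
        · have h1 := hT _ _ hl.2.1
          have h2 : y1 = T x2 := aux_lab_uniq hdigon hmatch hl h1
          have c1 : T.SameCycle y1 x2 := by rw [h2]; exact Equiv.Perm.sameCycle_apply_left.2 (Equiv.Perm.SameCycle.refl _ _)
          have c2 := hmiss _ _ hl.1
          have c3 := hmiss _ _ hl.2.1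
          have d1 : T.SameCycle a y1 := by
            rcases Sym2.mem_iff.1 ha with rfl | rfl
            · exact c2
            · exact Equiv.Perm.SameCycle.refl _ _
          have d2 : T.SameCycle x2 b := by
            rcases Sym2.mem_iff.1 hb with rfl | rfl
            · exact Equiv.Perm.SameCycle.refl _ _
            · exact c3
          exact d1.trans (c1.trans d2)
      | refl a => exact Equiv.Perm.SameCycle.refl _ _
      | symm a b _ ih => exact ih.symm
      | trans a b c _ _ ih1 ih2 => exact ih1.trans ih2
    obtain ⟨i, hi⟩ := hsc
    have hpos : (0 : ℤ) < orderOf T := by exact_mod_cast orderOf_pos T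
    refine ⟨(i % (orderOf T : ℤ)).toNat, ?_⟩
    rw [← hi, ← zpow_mod_orderOf T i, ← zpow_natCast,
      Int.toNat_of_nonneg (Int.emod_nonneg _ hpos.ne')]
  · rintro ⟨k, rfl⟩
    induction k with
    | zero => exact (aux_sameK_equiv E).refl _
    | succ k ih =>
      rw [pow_succ', Equiv.Perm.mul_apply]
      refine (aux_sameK_equiv E).trans ih ?_
      generalize (T ^ k) x = z
      by_cases hz : ∃ y, IsMissing E z y
      · obtain ⟨y, hy⟩ := hz
        apply (aux_sameK_equiv E).symm
        refine Relation.EqvGen.rel _ _ (Or.inr ⟨s(T y, T z), s(z, y), ⟨_, _, _, _, rfl, rfl, hT _ _ hy⟩, ?_, ?_⟩) <;> simp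
      · rw [hT2 z hz]
        exact (aux_sameK_equiv E).refl _

theorem aux_adj {V : Type*} (E : V → V → Prop) (x y : V) (h : ¬ SameK E x y) : E x y ∨ E y x := by
  by_contra hc
  push Not at hc
  refine h (Relation.EqvGen.rel _ _ (Or.inl ⟨?_, hc.1, hc.2⟩))
  rintro rfl
  exact h ((aux_sameK_equiv E).refl _)

theorem aux_interval {V : Type*} [Finite V] (E : V → V → Prop)
    (hdigon : ∀ x y, ¬ (E x y ∧ E y x))
    (hmatch : ∀ a b c, IsMissing E a b → IsMissing E a c → b = c)
    (T : Equiv.Perm V) (hT : ∀ x y, IsMissing E x y → LosesLab E (T y) (T x) x y)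
    (hT2 : ∀ x, (¬ ∃ y, IsMissing E x y) → T x = x) (u v z : V)
    (huv : SameK E u v) (huz : ¬ SameK E u z) :
    (E u z → E v z) ∧ (E z u → E z v) := by
  have hq := aux_sameK_equiv E
  -- going forward along `T` preserves in-arcs from outside
  have key : ∀ u, ¬ SameK E u z → E z u → ∀ k : ℕ, E z ((T ^ k) u) := by
    intro u hu hzu k
    induction k with
    | zero => simpa using hzu
    | succ k ih =>
      rw [pow_succ', Equiv.Perm.mul_apply]
      have hk : SameK E u ((T ^ k) u) :=
        (aux_sameK E hdigon hmatch T hT hT2 _ _).2 ⟨k, rfl⟩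
      generalize (T ^ k) u = w at hk ih
      by_cases hw : ∃ y, IsMissing E w y
      · obtain ⟨y, hy⟩ := hw
        refine aux_lab_step hdigon hmatch (aux_lab_symm (hT w y hy)) ih ?_
        rintro rfl
        apply hu
        refine hq.trans hk (hq.trans (Relation.EqvGen.rel _ _ (Or.inl hy)) ?_)
        exact (aux_sameK E hdigon hmatch T hT hT2 _ _).2 ⟨1, by simp⟩
      · rw [hT2 w hw]; exact ih
  have hvz : ¬ SameK E v z := fun h => huz (hq.trans huv h)
  constructor
  · intro h
    refine (aux_adj E v z hvz).resolve_right fun h' => ?_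
    obtain ⟨k, hk⟩ := (aux_sameK E hdigon hmatch T hT hT2 v u).1 (hq.symm huv)
    exact hdigon _ _ ⟨h, hk ▸ key v hvz h' k⟩
  · intro h
    obtain ⟨k, hk⟩ := (aux_sameK E hdigon hmatch T hT hT2 u v).1 huv
    exact hk ▸ key u huz h k

theorem aux_inside {V : Type*} [Finite V] (E : V → V → Prop)
    (hdigon : ∀ x y, ¬ (E x y ∧ E y x))
    (hmatch : ∀ a b c, IsMissing E a b → IsMissing E a c → b = c)
    (T : Equiv.Perm V) (hT : ∀ x y, IsMissing E x y → LosesLab E (T y) (T x) x y)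
    (hT2 : ∀ x, (¬ ∃ y, IsMissing E x y) → T x = x) (f : V) :
    Set.ncard {w | E f w ∧ SameK E f w} ≤ Set.ncard {w | w ∈ Npp E f ∧ SameK E f w} := by
  have hirr : ∀ x, ¬ E x x := fun x h => hdigon _ _ ⟨h, h⟩
  have hK := aux_sameK E hdigon hmatch T hT hT2
  by_cases hf : ∃ g, IsMissing E f g
  · obtain ⟨g, hg⟩ := hf
    obtain ⟨k, hk2, hkg, hkE⟩ := aux_partner E hdigon hmatch T hT f g hg
    have hpart : ∀ j : ℕ, IsMissing E ((T ^ j) f) ((T ^ j) g) := by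
      intro j
      induction j with
      | zero => simpa using hg
      | succ j ih =>
        rw [pow_succ', Equiv.Perm.mul_apply, Equiv.Perm.mul_apply]
        exact aux_miss_symm (hT _ _ ih).1
    have h2k : (T ^ (k + k)) f = f := by
      have h1 := hpart k
      rw [hkg] at h1
      have h2 := hmatch _ _ _ h1 (aux_miss_symm hg)
      rw [pow_add, Equiv.Perm.mul_apply, hkg, h2]
    -- arcs in the cycle
    have hpartner_all : ∀ i : ℕ, ∀ j, 1 ≤ j → j < k → E ((T ^ i) f) ((T ^ (i + j)) f) := by
      intro i j h1 h2
      obtain ⟨k', hk2', hkg', hkE'⟩ := aux_partner E hdigon hmatch T hT _ _ (hpart i)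
      have : (T ^ i) ((T ^ k') f) = (T ^ i) g := by
        rw [← hkg', ← Equiv.Perm.mul_apply, ← Equiv.Perm.mul_apply, ← pow_add, ← pow_add, add_comm]
      have hk' : (T ^ k') f = g := (T ^ i).injective this
      have hle : k ≤ k' := by
        by_contra hc
        have := hkE k' (by omega) (by omega)
        rw [hk'] at this
        exact hg.2.1 this
      have := hkE' j h1 (by omega)
      rw [← Equiv.Perm.mul_apply, ← pow_add, add_comm] at this
      exact this
    have hmod : ∀ w, SameK E f w → ∃ j, j < k + k ∧ (T ^ j) f = w := by
      intro w hw
      obtain ⟨i, rfl⟩ := (hK f w).1 hw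
      refine ⟨i % (k + k), Nat.mod_lt _ (by omega), ?_⟩
      conv_rhs => rw [← Nat.mod_add_div i (k + k), pow_add, Equiv.Perm.mul_apply]
      congr 1
      symm
      rw [pow_mul]
      generalize i / (k + k) = q
      induction q with
      | zero => simp
      | succ q ih => rw [pow_succ, Equiv.Perm.mul_apply, h2k, ih]
    have hback : ∀ j, k < j → j < k + k → E ((T ^ j) f) f := by
      intro j h1 h2
      have := hpartner_all j (k + k - j) (by omega) (by omega)
      rwa [show j + (k + k - j) = k + k by omega, h2k] at this
    rw [← Set.ncard_image_of_injective _ (T ^ (k - 1)).injective]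
    refine Set.ncard_le_ncard ?_ (Set.toFinite _)
    rintro _ ⟨w, ⟨hw1, hw2⟩, rfl⟩
    obtain ⟨j, hj, rfl⟩ := hmod w hw2
    have hj0 : 1 ≤ j := by
      rcases Nat.eq_zero_or_pos j with rfl | h
      · exact absurd hw1 (by simpa using hirr f)
      · exact h
    have hjk : j < k := by
      by_contra hc
      rcases (not_lt.1 hc).eq_or_lt with h | h
      · rw [← h, hkg] at hw1
        exact hg.2.1 hw1
      · exact hdigon _ _ ⟨hw1, hback j h hj⟩
    rw [← Equiv.Perm.mul_apply, ← pow_add]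
    have hmain : (T ^ (k - 1 + j)) f ≠ f ∧ ¬ E f ((T ^ (k - 1 + j)) f) := by
      rcases hj0.eq_or_lt with h | h
      · rw [← h, show k - 1 + 1 = k by omega, hkg]
        exact ⟨hg.1.symm, hg.2.1⟩
      · have := hback (k - 1 + j) (by omega) (by omega)
        refine ⟨fun h' => ?_, fun h' => hdigon _ _ ⟨this, h'⟩⟩
        rw [h'] at this
        exact hirr _ this
    refine ⟨⟨hmain.1, hmain.2, (T ^ (k - 1)) f, hkE _ (by omega) (by omega),
      hpartner_all _ _ hj0 hjk⟩, (hK _ _).2 ⟨_, rfl⟩⟩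
  · have : {w | E f w ∧ SameK E f w} = ∅ := by
      ext w
      simp only [Set.mem_ofPred_eq, Set.mem_empty_iff_false, iff_false]
      rintro ⟨h1, h2⟩
      obtain ⟨i, rfl⟩ := (hK f w).1 h2
      have : ∀ i : ℕ, (T ^ i) f = f := by
        intro i
        induction i with
        | zero => simp
        | succ i ih => rw [pow_succ, Equiv.Perm.mul_apply, hT2 f hf, ih]
      rw [this] at h1
      exact hirr _ h1
    rw [this]; simp

theorem stmt_15 {V : Type*} [Fintype V] {n : ℕ}
    (E : V → V → Prop) (hloop : ∀ v, ¬ E v v) (hdigon : ∀ x y, ¬ (E x y ∧ E y x))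
    (hmatch : ∀ a b c, IsMissing E a b → IsMissing E a c → b = c)
    (E' : V → V → Prop) (hloop' : ∀ v, ¬ E' v v) (hdigon' : ∀ x y, ¬ (E' x y ∧ E' y x))
    (hsub : ∀ x y, E x y → E' x y)
    (hnew : ∀ x y, E' x y → ¬ E x y → IsMissing E x y ∧ InPathComp E s(x, y))
    (hcover : ∀ x y, IsMissing E x y → InPathComp E s(x, y) → E' x y ∨ E' y x)
    (hfirst : ∀ x y, IsMissing E x y → (¬ ∃ g, Loses E g s(x, y)) → E' x y →
      ConvenientFor E x y)
    (hprop : ∀ x1 y1 x2 y2, LosesLab E x1 y1 x2 y2 → E' x1 y1 → E' x2 y2)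
    (L : Fin (n + 1) ≃ V) (hL : IsMedian E' L)
    (hLgood : ∀ v, OrderConvex L (Jset E' v))
    (f : V) (hf : f = L (Fin.last n)) :
    (Nplus E f).ncard ≤ (Npp E f).ncard ∧ (Nplus E' f).ncard ≤ (Npp E' f).ncard := by
  classical
  have hmissE : ∀ x y, IsMissing E' x y → IsMissing E x y := fun x y h =>
    ⟨h.1, fun h' => h.2.1 (hsub _ _ h'), fun h' => h.2.2 (hsub _ _ h')⟩
  have hmatch' : ∀ a b c, IsMissing E' a b → IsMissing E' a c → b = c := fun a b c h1 h2 =>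
    hmatch a b c (hmissE _ _ h1) (hmissE _ _ h2)
  have harc1 : ∀ x y u, IsMissing E' x y → E' x u → E x u := by
    intro x y u h hu
    by_contra hc
    have := hmatch _ _ _ (hmissE _ _ h) (hnew _ _ hu hc).1
    exact h.2.1 (this ▸ hu)
  have harc2 : ∀ x y u, IsMissing E' x y → E' u x → E u x := by
    intro x y u h hu
    by_contra hc
    have := hmatch _ _ _ (hmissE _ _ h) (aux_miss_symm (hnew _ _ hu hc).1)
    exact h.2.2 (this ▸ hu)
  have hnot : ∀ x1 y1 x2 y2, LosesLab E x1 y1 x2 y2 → IsMissing E' x1 y1 → IsMissing E' x2 y2 →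
      y2 ∉ Nplus E' x1 ∪ Npp E' x1 := by
    intro x1 y1 x2 y2 h h1 h2 hc
    rcases hc with hc | ⟨-, -, u, hu1, hu2⟩
    · exact h.2.2.2.1 (Or.inl (harc1 _ _ _ h1 hc))
    · exact aux_lab_nopath hdigon h (harc1 _ _ _ h1 hu1) (harc2 _ _ _ (aux_miss_symm h2) hu2)
  have hpathstep : ∀ x1 y1 x2 y2, LosesLab E x1 y1 x2 y2 →
      (InPathComp E s(x1, y1) ↔ InPathComp E s(x2, y2)) := by
    intro x1 y1 x2 y2 h
    have hl : Loses E s(x1, y1) s(x2, y2) := ⟨_, _, _, _, rfl, rfl, h⟩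
    constructor
    · rintro ⟨e, he1, he2, he3⟩
      exact ⟨e, he1, Relation.ReflTransGen.head (Or.inr hl) he2, he3⟩
    · rintro ⟨e, he1, he2, he3⟩
      exact ⟨e, he1, Relation.ReflTransGen.head (Or.inl hl) he2, he3⟩
  have hlab : ∀ x y, (∃ g, Loses E g s(x, y)) → ∃ x1 y1, LosesLab E x1 y1 x y := by
    rintro x y ⟨g, x1, y1, x2, y2, rfl, he, hl⟩
    rcases Sym2.eq_iff.1 he with ⟨rfl, rfl⟩ | ⟨rfl, rfl⟩
    · exact ⟨_, _, hl⟩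
    · exact ⟨_, _, aux_lab_symm hl⟩
  have hpred : ∀ x y, IsMissing E' x y → ∃ x1 y1, LosesLab E' x1 y1 x y := by
    intro x y h
    have hE := hmissE _ _ h
    have hnp : ¬ InPathComp E s(x, y) := fun hp => by
      rcases hcover x y hE hp with h' | h'
      · exact h.2.1 h'
      · exact h.2.2 h'
    have hp : ∃ g, Loses E g s(x, y) := by
      by_contra hc
      exact hnp ⟨s(x, y), ⟨x, y, rfl, hE⟩, Relation.ReflTransGen.refl, hc⟩
    obtain ⟨x1, y1, hl⟩ := hlab x y hp
    have hnp1 : ¬ InPathComp E s(x1, y1) := fun hh => hnp ((hpathstep _ _ _ _ hl).1 hh)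
    have hm1 : IsMissing E' x1 y1 := by
      refine ⟨hl.1.1, fun h' => hnp1 (hnew _ _ h' hl.1.2.1).2, fun h' => hnp1 ?_⟩
      have := (hnew _ _ h' hl.1.2.2).2
      rwa [Sym2.eq_swap] at this
    exact ⟨x1, y1, hm1, h, hsub _ _ hl.2.2.1, hnot _ _ _ _ hl hm1 h, hsub _ _ hl.2.2.2.2.1,
      hnot _ _ _ _ (aux_lab_symm hl) (aux_miss_symm hm1) (aux_miss_symm h)⟩
  have hnewarc : ∀ x y v, E' x y → ¬ E x y → E v x → v ≠ y →
      y ∈ Nplus E v ∪ Npp E v ∨ ∃ y1, LosesLab E v y1 x y ∧ E' v y1 := by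
    intro x y v hxy hnxy hvx hvy
    obtain ⟨hm, hp⟩ := hnew x y hxy hnxy
    by_cases hg : ∃ g, Loses E g s(x, y)
    · obtain ⟨x1, y1, hl⟩ := hlab x y hg
      have hE1 : E' x1 y1 := by
        refine (hcover x1 y1 hl.1 ((hpathstep _ _ _ _ hl).2 hp)).resolve_right fun h' => ?_
        exact hdigon' _ _ ⟨hxy, hprop _ _ _ _ (aux_lab_symm hl) h'⟩
      by_cases hyv : y ∈ Nplus E v ∪ Npp E v
      · exact Or.inl hyv
      · right
        have hmv : IsMissing E y1 v := by
          refine ⟨?_, ?_, ?_⟩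
          · rintro rfl
            exact hl.2.2.2.2.2 (Or.inl hvx)
          · intro h
            exact aux_lab_nopath hdigon (aux_lab_symm hl) h hvx
          · intro h
            apply hyv
            by_cases hE : E v y
            · exact Or.inl hE
            · exact Or.inr ⟨hvy.symm, hE, y1, h, hl.2.2.2.2.1⟩
        have := hmatch _ _ _ hmv (aux_miss_symm hl.1)
        subst this
        exact ⟨y1, hl, hE1⟩
    · left
      refine hfirst x y hm hg hxy v ?_ hvy hvx
      rintro rfl
      exact hloop _ hvx
  obtain ⟨T, hT, hT2⟩ := aux_perm E' hdigon' hmatch' hpred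
  have hint := aux_interval E' hdigon' hmatch' T hT hT2
  have hq := aux_sameK_equiv E'
  have hfeed := aux_feed E' L hL
  have hSNP' : (Nplus E' f).ncard ≤ (Npp E' f).ncard := by
    have h1 := aux_core_s15 E' (SameK E') hq hdigon' (aux_adj E')
      (fun u v z h1 h2 => (hint u v z h1 h2).1) (fun u v z h1 h2 => (hint u v z h1 h2).2)
      L hLgood hfeed f hf
    have h2 := aux_inside E' hdigon' hmatch' T hT hT2 f
    have e1 : (Nplus E' f).ncard ≤
        ({w | E' f w ∧ ¬ SameK E' f w} ∪ {w | E' f w ∧ SameK E' f w}).ncard := by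
      refine Set.ncard_le_ncard ?_ (Set.toFinite _)
      intro w hw
      by_cases hs : SameK E' f w
      · exact Or.inr ⟨hw, hs⟩
      · exact Or.inl ⟨hw, hs⟩
    have e2 : ({w | w ∈ Npp E' f ∧ ¬ SameK E' f w} ∪ {w | w ∈ Npp E' f ∧ SameK E' f w}).ncard ≤
        (Npp E' f).ncard := by
      refine Set.ncard_le_ncard ?_ (Set.toFinite _)
      rintro w (hw | hw)
      · exact hw.1
      · exact hw.1
    rw [Set.ncard_union_eq ?_ (Set.toFinite _) (Set.toFinite _)] at e2
    · have e3 := Set.ncard_union_le {w | E' f w ∧ ¬ SameK E' f w} {w | E' f w ∧ SameK E' f w}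
      omega
    · rw [Set.disjoint_left]
      rintro w ⟨-, h⟩ ⟨-, h'⟩
      exact h h'
  refine ⟨?_, hSNP'⟩
  by_cases hc : ∃ g, IsMissing E f g ∧ E' f g
  · obtain ⟨g, hfg, hfg'⟩ := hc
    by_cases hs : ∃ x y, LosesLab E f g x y
    · -- the missing edge at `f` has a successor
      obtain ⟨x, y, hl⟩ := hs
      have e1 : (insert g (Nplus E f)).ncard ≤ (Nplus E' f).ncard := by
        refine Set.ncard_le_ncard ?_ (Set.toFinite _)
        rintro w (rfl | hw)
        · exact hfg'
        · exact hsub _ _ hw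
      rw [Set.ncard_insert_of_notMem (show g ∉ Nplus E f from fun h => hfg.2.1 h) (Set.toFinite _)] at e1
      have e2 : (Npp E' f).ncard ≤ (insert y (Npp E f)).ncard := by
        refine Set.ncard_le_ncard ?_ (Set.toFinite _)
        rintro w ⟨hwf, hnw, u, hu1, hu2⟩
        have hnw' : ¬ E f w := fun h => hnw (hsub _ _ h)
        by_cases hfu : E f u
        · by_cases huw : E u w
          · exact Or.inr ⟨hwf, hnw', u, hfu, huw⟩
          · rcases hnewarc u w f hu2 huw hfu hwf.symm with (h | h) | ⟨y1, h1, h2⟩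
            · exact absurd h hnw'
            · exact Or.inr h
            · left
              have := hmatch _ _ _ h1.1 hfg
              subst this
              exact aux_lab_uniq_out hdigon hmatch h1 hl
        · have hug : u = g := hmatch _ _ _ (hnew _ _ hu1 hfu).1 hfg
          subst hug
          have hgw : E u w := by
            by_contra hc
            exact hwf (hmatch _ _ _ (hnew _ _ hu2 hc).1 (aux_miss_symm hfg))
          by_cases hxw : E x w
          · exact Or.inr ⟨hwf, hnw', x, hl.2.2.1, hxw⟩
          · left
            refine hmatch x _ _ ⟨?_, hxw, fun h => ?_⟩ hl.2.1
            · rintro rfl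
              exact hnw' hl.2.2.1
            · exact aux_lab_nopath hdigon (aux_lab_symm hl) hgw h
      have e3 := Set.ncard_insert_le y (Npp E f)
      omega
    · -- no successor: reverse the arc `(f, g)`
      let E2 : V → V → Prop := fun a b => (E' a b ∧ ¬ (a = f ∧ b = g)) ∨ (a = g ∧ b = f)
      have hgf' : ¬ E' g f := fun h => hdigon' _ _ ⟨hfg', h⟩
      have hnf : ¬ ∃ y, IsMissing E' f y := by
        rintro ⟨y, hy⟩
        have := hmatch _ _ _ (hmissE _ _ hy) hfg
        exact hy.2.1 (this ▸ hfg')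
      have hng : ¬ ∃ y, IsMissing E' g y := by
        rintro ⟨y, hy⟩
        have := hmatch _ _ _ (hmissE _ _ hy) (aux_miss_symm hfg)
        exact hy.2.2 (this ▸ hfg')
      have htriv : ∀ x y, (¬ ∃ y, IsMissing E' x y) → SameK E' x y → y = x := by
        intro x y hx hxy
        obtain ⟨i, rfl⟩ := (aux_sameK E' hdigon' hmatch' T hT hT2 x y).1 hxy
        clear hxy
        induction i with
        | zero => simp
        | succ i ih => rw [pow_succ, Equiv.Perm.mul_apply, hT2 x hx, ih]
      have hcases : ∀ u v, SameK E' u v → u = v ∨ (u ≠ f ∧ u ≠ g ∧ v ≠ f ∧ v ≠ g) := by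
        intro u v h
        by_cases huv : u = v
        · exact Or.inl huv
        · right
          refine ⟨?_, ?_, ?_, ?_⟩
          · rintro rfl; exact huv (htriv _ _ hnf h).symm
          · rintro rfl; exact huv (htriv _ _ hng h).symm
          · rintro rfl; exact huv (htriv _ _ hnf (hq.symm h))
          · rintro rfl; exact huv (htriv _ _ hng (hq.symm h))
      have hdig2 : ∀ x y, ¬ (E2 x y ∧ E2 y x) := by
        rintro x y ⟨⟨h1, h1'⟩ | ⟨rfl, rfl⟩, ⟨h2, h2'⟩ | ⟨h2, h2'⟩⟩
        · exact hdigon' _ _ ⟨h1, h2⟩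
        · exact h1' ⟨h2', h2⟩
        · exact h2' ⟨rfl, rfl⟩
        · exact hfg.1 h2
      have hadj2 : ∀ x y, ¬ SameK E' x y → E2 x y ∨ E2 y x := by
        intro x y h
        by_cases h1 : x = f ∧ y = g
        · exact Or.inr (Or.inr ⟨h1.2, h1.1⟩)
        · by_cases h2 : y = f ∧ x = g
          · exact Or.inl (Or.inr ⟨h2.2, h2.1⟩)
          · rcases aux_adj E' x y h with h3 | h3
            · exact Or.inl (Or.inl ⟨h3, h1⟩)
            · exact Or.inr (Or.inl ⟨h3, h2⟩)
      have hout2 : ∀ u v z, SameK E' u v → ¬ SameK E' u z → E2 u z → E2 v z := by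
        intro u v z h1 h2 h3
        rcases hcases u v h1 with rfl | ⟨n1, n2, n3, n4⟩
        · exact h3
        · rcases h3 with ⟨h3, -⟩ | ⟨h3, -⟩
          · exact Or.inl ⟨(hint u v z h1 h2).1 h3, fun h => n3 h.1⟩
          · exact absurd h3 n2
      have hin2 : ∀ u v z, SameK E' u v → ¬ SameK E' u z → E2 z u → E2 z v := by
        intro u v z h1 h2 h3
        rcases hcases u v h1 with rfl | ⟨n1, n2, n3, n4⟩
        · exact h3
        · rcases h3 with ⟨h3, -⟩ | ⟨-, h3⟩
          · exact Or.inl ⟨(hint u v z h1 h2).2 h3, fun h => n4 h.2⟩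
          · exact absurd h3 n1
      have hfeed2 : ∀ m i : Fin (n + 1), m ≤ i →
          Set.ncard {j | m ≤ j ∧ j < i ∧ E2 (L i) (L j)} ≤
          Set.ncard {j | m ≤ j ∧ j < i ∧ E2 (L j) (L i)} := by
        intro m i hmi
        have hLj : ∀ j, j < i → L j ≠ f := by
          intro j hj h
          rw [hf] at h
          have := L.injective h
          rw [this] at hj
          exact absurd hj (not_lt.2 (Fin.le_last i))
        refine le_trans (Set.ncard_le_ncard ?_ (Set.toFinite _))
          (le_trans (hfeed m i hmi) (Set.ncard_le_ncard ?_ (Set.toFinite _)))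
        · rintro j ⟨h1, h2, ⟨h3, -⟩ | ⟨-, h3⟩⟩
          · exact ⟨h1, h2, h3⟩
          · exact absurd h3 (hLj j h2)
        · rintro j ⟨h1, h2, h3⟩
          exact ⟨h1, h2, Or.inl ⟨h3, fun h => hLj j h2 h.1⟩⟩
      have hmain := aux_core_s15 E2 (SameK E') hq hdig2 hadj2 hout2 hin2 L hLgood hfeed2 f hf
      refine le_trans (Set.ncard_le_ncard ?_ (Set.toFinite _))
        (le_trans hmain (Set.ncard_le_ncard ?_ (Set.toFinite _)))
      · intro w hw
        have hw' : E f w := hw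
        refine ⟨Or.inl ⟨hsub _ _ hw', fun h => hfg.2.1 (h.2 ▸ hw')⟩, fun h => ?_⟩
        exact hloop f (htriv f w hnf h ▸ hw')
      · rintro w ⟨⟨hwf, hnw, u, hu1, hu2⟩, -⟩
        have hnw' : ¬ E f w := fun h => hnw (Or.inl ⟨hsub _ _ h, fun h' => hfg.2.1 (h'.2 ▸ h)⟩)
        have hfu : E f u := by
          rcases hu1 with ⟨h1, h2⟩ | ⟨h1, -⟩
          · by_contra hc
            exact h2 ⟨rfl, hmatch _ _ _ (hnew _ _ h1 hc).1 hfg⟩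
          · exact absurd h1 hfg.1
        have huw' : E' u w := by
          rcases hu2 with ⟨h1, -⟩ | ⟨-, h1⟩
          · exact h1
          · exact absurd h1 hwf
        by_cases huw : E u w
        · exact ⟨hwf, hnw', u, hfu, huw⟩
        · rcases hnewarc u w f huw' huw hfu hwf.symm with (h | h) | ⟨y1, h1, h2⟩
          · exact absurd h hnw'
          · exact h
          · have := hmatch _ _ _ h1.1 hfg
            subst this
            exact absurd ⟨u, w, h1⟩ hs
  · -- `f` gets no new out-neighbour
    refine le_trans (Set.ncard_le_ncard (fun w hw => hsub _ _ hw) (Set.toFinite _))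
      (le_trans hSNP' (Set.ncard_le_ncard ?_ (Set.toFinite _)))
    rintro w ⟨hwf, hnw, u, hu1, hu2⟩
    have hnw' : ¬ E f w := fun h => hnw (hsub _ _ h)
    have hfu : E f u := by
      by_contra h
      exact hc ⟨u, (hnew _ _ hu1 h).1, hu1⟩
    by_cases huw : E u w
    · exact ⟨hwf, hnw', u, hfu, huw⟩
    · rcases hnewarc u w f hu2 huw hfu hwf.symm with (h | h) | ⟨y1, h1, h2⟩
      · exact absurd h hnw'
      · exact h
      · exact absurd ⟨y1, h1.1, h2⟩ hc
end

section
/- Let D be a finite oriented graph missing a matching such that every connected component of its dependency digraph Δ is a directed cycle (equivalently, the set F of added arcs in the construction of D' is empty, so D itself is a good digraph). If D has no sink vertex, then D has at least two vertices with the SNP. -/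
variable {V : Type*}

namespace Sol16
open Classical
set_option linter.unusedSectionVars false

section Tour
variable {Q : Type*} (A : Q → Q → Prop) (ω : Q → ℕ)

noncomputable def ow (f : Q) (l : List Q) : ℕ := (l.map (fun x => if A f x then ω x else 0)).sum

noncomputable def iw (f : Q) (l : List Q) : ℕ := (l.map (fun x => if A x f then ω x else 0)).sum

noncomputable def gw (f : Q) : List Q → ℕ
  | [] => 0
  | x :: s => (if A x f ∧ ∃ z ∈ s, A f z ∧ A z x then ω x else 0) + gw f s

def nb (f u : Q) : List Q → Prop
  | [] => False
  | x :: s => (x = u ∧ (A f x ∨ (A x f ∧ ∃ z ∈ s, A f z ∧ A z x))) ∨ nb f u s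

noncomputable def sc : List Q → ℕ
  | [] => 0
  | c :: l => ω c * iw A ω c l + sc l

lemma ow_app (f : Q) (l m : List Q) : ow A ω f (l ++ m) = ow A ω f l + ow A ω f m := by
  simp [ow]

lemma iw_app (f : Q) (l m : List Q) : iw A ω f (l ++ m) = iw A ω f l + iw A ω f m := by
  simp [iw]

lemma ow_cons (f x : Q) (l : List Q) :
    ow A ω f (x :: l) = (if A f x then ω x else 0) + ow A ω f l := by
  simp [ow]

lemma iw_cons (f x : Q) (l : List Q) :
    iw A ω f (x :: l) = (if A x f then ω x else 0) + iw A ω f l := by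
  simp [iw]

lemma sc_ins (c : Q) (t s : List Q) :
    sc A ω (t ++ c :: s) = sc A ω (t ++ s) + ω c * ow A ω c t + ω c * iw A ω c s := by
  induction t with
  | nil => simp [sc, ow]; ring
  | cons x t ih =>
    simp only [List.cons_append, sc, ih, iw_app, iw_cons, ow_cons]
    split_ifs <;> ring

lemma sc_swap (c : Q) (a t s : List Q) :
    sc A ω (a ++ c :: (t ++ s)) + ω c * ow A ω c t
      = sc A ω (a ++ (t ++ c :: s)) + ω c * iw A ω c t := by
  induction a with
  | nil => simp only [List.nil_append, sc, sc_ins, iw_app]; ring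
  | cons x a ih =>
    simp only [List.cons_append, sc, iw_app, iw_cons]
    linarith

lemma exists_median (hω : ∀ q, 0 < ω q) (l0 : List Q) (hn : l0.Nodup) (u : Q) :
    ∃ l : List Q, l.Perm l0 ∧ ∀ a c t s, l = a ++ c :: (t ++ s) →
      ow A ω c t + (if u ∈ t then 1 else 0) ≤ iw A ω c t := by
  have hfin : {l : List Q | l.Perm l0}.Finite := by
    refine (List.finite_toSet l0.permutations).subset ?_
    intro l hl
    simpa using hl
  obtain ⟨m, hm, hmax⟩ := Set.exists_max_image _ (sc A ω) hfin ⟨l0, List.Perm.refl _⟩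
  have hfin2 : {l : List Q | l.Perm l0 ∧ sc A ω l = sc A ω m}.Finite :=
    hfin.subset (fun l hl => hl.1)
  obtain ⟨l, hl, hmin⟩ := Set.exists_min_image _ (fun l => l.idxOf u) hfin2 ⟨m, hm, rfl⟩
  refine ⟨l, hl.1, ?_⟩
  rintro a c t s rfl
  have hsw := sc_swap A ω c a t s
  have hperm : (a ++ (t ++ c :: s)).Perm (a ++ c :: (t ++ s)) :=
    List.Perm.append_left a List.perm_middle
  have h1 := hmax _ (hperm.trans hl.1)
  have h2 := hl.2
  have h3 : ω c * ow A ω c t ≤ ω c * iw A ω c t := by omega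
  have h4 := Nat.le_of_mul_le_mul_left h3 (hω c)
  split_ifs with hu
  · rcases h4.lt_or_eq with h | h
    · exact h
    · exfalso
      rw [h] at hsw
      have h5 := hmin (a ++ (t ++ c :: s)) ⟨hperm.trans hl.1, by omega⟩
      have hnd : (a ++ c :: (t ++ s)).Nodup := hl.1.nodup_iff.mpr hn
      have hua : u ∉ a := by
        intro h
        have := List.disjoint_of_nodup_append hnd h
        simp [hu] at this
      have huc : c ≠ u := by
        rintro rfl
        have := (List.nodup_append.1 hnd).2.1
        simp [hu] at this
      simp only [List.idxOf_append, hua, if_false, hu, List.idxOf_cons_ne _ huc, if_true] at h5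
      omega
  · simpa using h4

variable (irr : ∀ x, ¬ A x x) (asymm : ∀ x y, A x y → ¬ A y x)
  (total : ∀ x y, x ≠ y → A x y ∨ A y x)

include asymm total in
lemma feed (f u : Q) (s : List Q) : ∀ (t : List Q) (c : Q), f ∉ t ++ s →
    (∀ x ∈ t ++ s, A f x → A c x) →
    (∀ a c' t' s', c :: (t ++ s) = a ++ c' :: (t' ++ s') →
      ow A ω c' t' + (if u ∈ t' then 1 else 0) ≤ iw A ω c' t') →
    ow A ω f (t ++ s) + (if u ∈ t ∨ nb A f u s then 1 else 0) ≤ iw A ω f t + gw A ω f s := by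
  have chunk : ∀ (t : List Q) (c : Q), f ∉ t → (∀ x ∈ t, A f x → A c x) →
      ow A ω f t ≤ ow A ω c t ∧ iw A ω c t ≤ iw A ω f t := by
    intro t c
    induction t with
    | nil => intros; simp [ow, iw]
    | cons x t ih =>
      intro hf hc
      have hi := ih (fun h => hf (List.mem_cons_of_mem _ h))
        (fun y hy => hc y (List.mem_cons_of_mem _ hy))
      have hx := hc x (by simp)
      have hxf : x ≠ f := by rintro rfl; simp at hf
      have ht := total x f hxf
      have h1 := asymm x c
      simp only [ow_cons, iw_cons]
      constructor
      · by_cases h : A f x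
        · simp only [h, hx h, if_true]; omega
        · simp only [h, if_false]; omega
      · by_cases h : A x c
        · have : A x f := by
            rcases ht with h' | h'
            · exact h'
            · exact absurd (hx h') (h1 h)
          simp only [h, this, if_true]; omega
        · simp only [h, if_false]; omega
  induction s with
  | nil =>
    intro t c hf hc hloc
    have h1 := chunk t c (by simpa using hf) (by simpa using hc)
    have h2 := hloc [] c t [] (by simp)
    simp only [List.append_nil, nb, or_false, gw]
    omega
  | cons x s ih =>
    intro t c hf hc hloc
    have hxf : x ≠ f := by rintro rfl; simp at hf
    by_cases hbad : A x f ∧ ∀ z ∈ s, A f z → ¬ A z x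
    · have h1 := chunk t c (fun h => hf (by simp [h])) (fun y hy => hc y (by simp [hy]))
      have h2 := hloc [] c t (x :: s) (by simp)
      have h3 := ih [] x (fun h => hf (by simp at h; simp [h])) (by
        intro z hz hfz
        simp at hz
        have hzx : x ≠ z := by rintro rfl; exact asymm _ _ hfz hbad.1
        rcases total x z hzx with h | h
        · exact h
        · exact absurd h (hbad.2 z hz hfz)) (by
        intro a c' t' s' h
        exact hloc (c :: (t ++ a)) c' t' s' (by simp at h; simp [h]))
      have hng : ¬ (A x f ∧ ∃ z ∈ s, A f z ∧ A z x) := by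
        rintro ⟨_, z, hz, h, h'⟩; exact hbad.2 z hz h h'
      have hnf : ¬ A f x := fun h => asymm _ _ h hbad.1
      simp only [List.nil_append, List.not_mem_nil, false_or] at h3
      have h0 : iw A ω f [] = 0 := by simp [iw]
      simp only [ow_app, ow_cons, gw, nb, hng, hnf, if_false, false_or, or_self, and_false]
      by_cases hu1 : u ∈ t <;> by_cases hu2 : nb A f u s <;>
        simp only [hu1, hu2, if_true, if_false, or_true, true_or, or_self] at * <;> omega
    · have h3 := ih (t ++ [x]) c (by simpa using hf) (by simpa using hc) (by simpa using hloc)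
      have hnb : A f x ∨ (A x f ∧ ∃ z ∈ s, A f z ∧ A z x) := by
        rcases total x f hxf with h | h
        · right
          refine ⟨h, ?_⟩
          by_contra hcon
          exact hbad ⟨h, fun z hz h1 h2 => hcon ⟨z, hz, h1, h2⟩⟩
        · exact Or.inl h
      have heq : (u ∈ t ++ [x] ∨ nb A f u s) ↔ (u ∈ t ∨ nb A f u (x :: s)) := by
        simp only [nb, hnb, and_true, List.mem_append, List.mem_singleton, eq_comm (a := u)]
        tauto
      simp only [heq] at h3
      simp only [List.append_assoc, List.singleton_append, iw_app] at h3
      have h4 : iw A ω f [x] ≤ (if A x f ∧ ∃ z ∈ s, A f z ∧ A z x then ω x else 0) := by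
        rcases hnb with h | h
        · have := asymm _ _ h
          simp [iw, this]
        · simp [iw, h]
      simp only [gw]
      omega

lemma gw_le (f : Q) (P : Q → Prop) (l : List Q)
    (hP : ∀ x ∈ l, A x f → (∃ z ∈ l, A f z ∧ A z x) → P x) :
    gw A ω f l ≤ (l.map (fun x => if P x then ω x else 0)).sum ∧
    ∀ u ∈ l, ¬ nb A f u l → P u →
      gw A ω f l + ω u ≤ (l.map (fun x => if P x then ω x else 0)).sum := by
  induction l with
  | nil => simp [gw]
  | cons x s ih =>
    have hi := ih (fun y hy h1 ⟨z, hz, h⟩ => hP y (by simp [hy]) h1 ⟨z, by simp [hz], h⟩)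
    have hx : (A x f ∧ ∃ z ∈ s, A f z ∧ A z x) → P x := fun ⟨h1, z, hz, h⟩ =>
      hP x (by simp) h1 ⟨z, by simp [hz], h⟩
    have hle : (if A x f ∧ ∃ z ∈ s, A f z ∧ A z x then ω x else 0) ≤ (if P x then ω x else 0) := by
      by_cases h : (A x f ∧ ∃ z ∈ s, A f z ∧ A z x)
      · rw [if_pos h, if_pos (hx h)]
      · rw [if_neg h]; exact Nat.zero_le _
    simp only [gw, List.map_cons, List.sum_cons]
    refine ⟨by omega, ?_⟩
    intro u hu hnb hPu
    simp only [nb, not_or] at hnb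
    by_cases hux : x = u
    · subst hux
      have : ¬ (A x f ∧ ∃ z ∈ s, A f z ∧ A z x) := fun h => hnb.1 ⟨rfl, Or.inr h⟩
      rw [if_neg this, if_pos hPu]
      omega
    · have := hi.2 u (by simpa [Ne.symm hux] using hu) hnb.2 hPu
      omega

def sec (f x : Q) : Prop := x ≠ f ∧ ¬ A f x ∧ ∃ u, A f u ∧ A u x

def SN [Fintype Q] (q : Q) : Prop :=
  (∑ x, if A q x then ω x else 0) ≤
    ∑ x, if sec A q x then ω x else 0

lemma sum_list [Fintype Q] (S : Finset Q) (f : Q) (l : List Q) (h : (f :: l).Perm S.toList)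
    (g : Q → ℕ) : g f + (l.map g).sum = ∑ x ∈ S, g x := by
  have := (h.map g).sum_eq
  simpa using this

include irr asymm total in
theorem two [Fintype Q] [Nonempty Q] (hω : ∀ q, 0 < ω q)
    (hs : ∀ q, ω q ≤ 1 → ∃ q', A q q') :
    (∃ q, 2 ≤ ω q ∧ SN A ω q) ∨ ∃ q q', q ≠ q' ∧ SN A ω q ∧ SN A ω q' := by
  have hfirst : ∃ z, SN A ω z := by
    obtain ⟨u⟩ := ‹Nonempty Q›
    obtain ⟨l, hl, hloc⟩ := exists_median A ω hω Finset.univ.toList (Finset.nodup_toList _) u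
    have hnd : l.Nodup := hl.nodup_iff.mpr (Finset.nodup_toList _)
    cases l with
    | nil =>
      have := hl.mem_iff (a := u)
      simp at this
    | cons f l =>
      refine ⟨f, ?_⟩
      have hfl := (List.nodup_cons.1 hnd).1
      have h1 := feed A ω asymm total f u l [] f (by simpa using hfl) (fun _ _ h => h)
        (by simpa using hloc)
      have h2 := (gw_le A ω f (sec A f) l (by
        rintro x hx h ⟨z, hz, h'⟩
        exact ⟨fun h => hfl (h ▸ hx), asymm _ _ h, z, h'⟩)).1
      unfold SN
      rw [← sum_list Finset.univ f l hl, ← sum_list Finset.univ f l hl]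
      simp [irr, iw, ow] at h1 h2 ⊢
      omega
  obtain ⟨z, hz⟩ := hfirst
  by_cases hz2 : 2 ≤ ω z
  · exact Or.inl ⟨z, hz2, hz⟩
  right
  have hz1 : ω z = 1 := by have := hω z; omega
  obtain ⟨u, hzu⟩ := hs z (by omega)
  have huz : u ≠ z := by rintro rfl; exact irr _ hzu
  obtain ⟨l, hl, hloc⟩ := exists_median A ω hω (Finset.univ.erase z).toList
    (Finset.nodup_toList _) u
  have hnd : l.Nodup := hl.nodup_iff.mpr (Finset.nodup_toList _)
  have hmem : ∀ x, x ∈ l ↔ x ≠ z := by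
    intro x
    rw [hl.mem_iff]; simp
  cases l with
  | nil =>
    have := hmem u
    simp [huz] at this
  | cons f l =>
    have hfz : f ≠ z := (hmem f).1 (by simp)
    refine ⟨z, f, hfz.symm, hz, ?_⟩
    have hfl := (List.nodup_cons.1 hnd).1
    have h1 := feed A ω asymm total f u l [] f (by simpa using hfl) (fun _ _ h => h)
      (by simpa using hloc)
    have h2 := gw_le A ω f (sec A f) l (by
      rintro x hx h ⟨z, hz, h'⟩
      exact ⟨fun h => hfl (h ▸ hx), asymm _ _ h, z, h'⟩)
    unfold SN
    rw [← Finset.add_sum_erase _ _ (Finset.mem_univ z),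
      ← Finset.add_sum_erase (a := z) (s := Finset.univ)
        (fun x => if sec A f x then ω x else 0) (Finset.mem_univ z),
      ← sum_list _ f l hl, ← sum_list _ f l hl, hz1]
    have e0 : iw A ω f [] = 0 := by simp [iw]
    simp only [List.nil_append, List.not_mem_nil, false_or, e0, zero_add] at h1
    have e1 : (if A f f then ω f else 0) = 0 := by simp [irr]
    have e2 : (if sec A f f then ω f else 0) = 0 := by simp [sec]
    have e3 : (List.map (fun x => if A f x then ω x else 0) l).sum = ow A ω f l := rfl
    rw [e1, e2, e3]
    by_cases hAz : A f z
    · have huf : u ≠ f := by rintro rfl; exact asymm _ _ hAz hzu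
      have hul : u ∈ l := by
        have := (hmem u).2 huz
        simpa [huf] using this
      rw [if_pos hAz]
      by_cases hn : nb A f u l
      · rw [if_pos hn] at h1
        have := h2.1
        omega
      · have hnf : ¬ A f u := by
          intro hfu
          apply hn
          clear * - hul hfu
          induction l with
          | nil => simp at hul
          | cons x s ih =>
            simp only [nb]
            rcases List.mem_cons.1 hul with h | h
            · exact Or.inl ⟨h.symm, Or.inl (h ▸ hfu)⟩
            · exact Or.inr (ih h)
        have := h2.2 u hul hn ⟨huf, hnf, z, hAz, hzu⟩
        have := hω u
        omega
    · rw [if_neg hAz]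
      have := h2.1
      omega

end Tour

section Dig
variable {V : Type*} [Fintype V] (E : V → V → Prop) (hloop : ∀ v, ¬ E v v)
  (hdigon : ∀ x y, ¬ (E x y ∧ E y x))
  (hmatch : ∀ a b c, IsMissing E a b → IsMissing E a c → b = c)
  (hcyc : ∀ e, IsMissingS E e → ∃ f, Loses E f e)

/-- `c, d` missing, `c', d'` missing, with `cd` losing to `d'c'`. -/
def R (c d c' d' : V) : Prop := LosesLab E c d d' c'

lemma R_symm {c d c' d' : V} (h : R E c d c' d') : R E d c d' c' := by
  obtain ⟨⟨a1, a2, a3⟩, ⟨b1, b2, b3⟩, h1, h2, h3, h4⟩ := h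
  exact ⟨⟨a1.symm, a3, a2⟩, ⟨b1.symm, b3, b2⟩, h3, h4, h1, h2⟩

lemma miss_symm {c d : V} (h : IsMissing E c d) : IsMissing E d c := ⟨h.1.symm, h.2.2, h.2.1⟩

lemma adj {x y : V} (h1 : x ≠ y) (h2 : ¬ IsMissing E x y) : E x y ∨ E y x := by
  unfold IsMissing at h2; tauto

include hloop hmatch in
/-- basic facts about losing. -/
lemma R_facts {c d c' d' : V} (h : R E c d c' d') :
    E c' c ∧ E c d' ∧ ∀ v, E c v → v ≠ d' → E c' v := by
  obtain ⟨hm, hm', h1, h2, h3, h4⟩ := h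
  simp only [Nplus, Npp, Set.mem_union, Set.mem_ofPred_eq, not_or, not_and, not_exists] at h2 h4
  have hcc' : c' ≠ c := by
    rintro rfl; exact hm'.2.2 h1
  refine ⟨?_, h1, ?_⟩
  · have hnm : ¬ IsMissing E c' c := by
      intro hh
      have := hmatch c _ _ (miss_symm E hh) hm
      subst this
      exact hloop _ h3
    rcases adj E hcc' hnm with h | h
    · exact h
    · exact absurd h h2.1
  · intro v hv hvd
    have h5 := h2.2 hcc' h2.1 v hv
    have hvc : c' ≠ v := by rintro rfl; exact h2.1 hv
    rcases adj E hvc (fun hh => hvd (hmatch c' _ _ hh (miss_symm E hm'))) with h | h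
    · exact h
    · exact absurd h h5

include hloop hdigon hmatch in
lemma R_unique {c d c' d' e c'' d'' : V} (h : R E c d c' d') (h' : R E c e c'' d'') : c' = c'' := by
  have hde : d = e := hmatch c _ _ h.1 h'.1
  subst hde
  by_contra hne
  have hd : d' ≠ d'' := by
    intro hd
    subst hd
    exact hne (hmatch d' _ _ h.2.1 h'.2.1)
  obtain ⟨a1, a2, a3⟩ := R_facts E hloop hmatch h
  obtain ⟨b1, b2, b3⟩ := R_facts E hloop hmatch h'
  obtain ⟨c1, c2, c3⟩ := R_facts E hloop hmatch (R_symm E h)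
  obtain ⟨d1, d2, d3⟩ := R_facts E hloop hmatch (R_symm E h')
  exact hdigon _ _ ⟨b3 d' a2 hd, c3 c'' d2 (Ne.symm hne)⟩

include hloop hdigon hmatch hcyc in
lemma exists_perm : ∃ φ : Equiv.Perm V, (∀ v, (∀ w, ¬ IsMissing E v w) → φ v = v) ∧
    ∀ c d, IsMissing E c d → R E c d (φ c) (φ d) := by
  -- predecessor function
  have hpre : ∀ c', ∃ c, ((∀ w, ¬ IsMissing E c' w) → c = c') ∧
      ∀ d', IsMissing E c' d' → ∃ d, R E c d c' d' := by
    intro c'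
    by_cases h : ∃ d', IsMissing E c' d'
    · obtain ⟨d', hd'⟩ := h
      obtain ⟨e, x1, y1, x2, y2, he, hf, hl⟩ := hcyc s(c', d') ⟨c', d', rfl, hd'⟩
      have key : ∃ c d, R E c d c' d' := by
        rcases Sym2.eq_iff.1 hf with ⟨rfl, rfl⟩ | ⟨rfl, rfl⟩
        · exact ⟨y1, x1, R_symm E hl⟩
        · exact ⟨x1, y1, hl⟩
      obtain ⟨c, d, hR⟩ := key
      refine ⟨c, fun hh => absurd hd' (hh d'), fun d'' hd'' => ?_⟩
      rw [hmatch c' _ _ hd'' hd']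
      exact ⟨d, hR⟩
    · exact ⟨c', fun _ => rfl, fun d' hd' => absurd ⟨d', hd'⟩ h⟩
  choose ψ hψ1 hψ2 using hpre
  have hinj : Function.Injective ψ := by
    intro a b hab
    by_cases ha : ∃ d', IsMissing E a d'
    · obtain ⟨a', ha'⟩ := ha
      obtain ⟨d, hR⟩ := hψ2 a a' ha'
      by_cases hb : ∃ d', IsMissing E b d'
      · obtain ⟨b', hb'⟩ := hb
        obtain ⟨d2, hR2⟩ := hψ2 b b' hb'
        rw [← hab] at hR2
        exact R_unique E hloop hdigon hmatch hR hR2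
      · push Not at hb
        rw [hab, hψ1 b hb] at hR
        exact absurd hR.1 (hb _)
    · push Not at ha
      rw [hψ1 a ha] at hab
      by_cases hb : ∃ d', IsMissing E b d'
      · obtain ⟨b', hb'⟩ := hb
        obtain ⟨d2, hR2⟩ := hψ2 b b' hb'
        rw [← hab] at hR2
        exact absurd hR2.1 (ha _)
      · push Not at hb
        rw [hab, hψ1 b hb]
  let Ψ : Equiv.Perm V := Equiv.ofBijective ψ (Finite.injective_iff_bijective.1 hinj)
  have hΨ : ∀ v, Ψ v = ψ v := fun v => rfl
  have hfix : ∀ v, (∀ w, ¬ IsMissing E v w) → Ψ.symm v = v := by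
    intro v hv
    rw [Equiv.symm_apply_eq, hΨ, hψ1 v hv]
  refine ⟨Ψ.symm, hfix, ?_⟩
  intro c d hcd
  have hc : ψ (Ψ.symm c) = c := by rw [← hΨ]; simp
  have hd : ψ (Ψ.symm d) = d := by rw [← hΨ]; simp
  have hm : ∃ w, IsMissing E (Ψ.symm c) w := by
    by_contra hcon
    push Not at hcon
    have h1 := hψ1 _ hcon
    rw [hc] at h1
    rw [← h1] at hcon
    exact hcon d hcd
  obtain ⟨w, hw⟩ := hm
  obtain ⟨d1, hR⟩ := hψ2 _ w hw
  rw [hc] at hR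
  have : d1 = d := hmatch c _ _ hR.1 hcd
  subst this
  obtain ⟨c2, hR2⟩ := hψ2 w _ (miss_symm E hw)
  have hR3 := R_symm E hR
  -- predecessor of w is d1
  have hpd : ψ w = d1 := by
    by_contra hne
    -- use injectivity on forward images
    have hm2 : IsMissing E d1 c := miss_symm E hcd
    have : ∃ w', IsMissing E (Ψ.symm d1) w' := by
      by_contra hcon
      push Not at hcon
      have h1 := hψ1 _ hcon
      rw [hd] at h1
      rw [← h1] at hcon
      exact hcon c hm2
    obtain ⟨w', hw'⟩ := this
    obtain ⟨e1, hR4⟩ := hψ2 _ w' hw'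
    rw [hd] at hR4
    have := R_unique E hloop hdigon hmatch hR3 hR4
    rw [← this] at hd
    exact hne hd
  have : w = Ψ.symm d1 := by rw [Equiv.eq_symm_apply, hΨ, hpd]
  rw [← this]
  exact hR

variable (φ : Equiv.Perm V) (hfix : ∀ v, (∀ w, ¬ IsMissing E v w) → φ v = v)
  (hφ : ∀ c d, IsMissing E c d → R E c d (φ c) (φ d))

include hφ in
lemma miss_pow {c d : V} (h : IsMissing E c d) (k : ℕ) :
    IsMissing E ((φ ^ k) c) ((φ ^ k) d) := by
  induction k with
  | zero => simpa using h
  | succ k ih =>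
    rw [pow_succ']
    exact miss_symm E (hφ _ _ ih).2.1

include hloop hmatch hφ in
lemma miss_same {c d : V} (h : IsMissing E c d) : φ.SameCycle c d := by
  by_contra hcon
  have key : ∀ k : ℕ, E ((φ ^ (k + 1)) c) c := by
    intro k
    induction k with
    | zero => simpa using (R_facts E hloop hmatch (hφ _ _ h)).1
    | succ k ih =>
      have h1 := miss_pow E φ hφ h (k + 1)
      have h2 := (R_facts E hloop hmatch (hφ _ _ h1)).2.2 c ih (by
        intro heq
        apply hcon
        have : c = (φ ^ (k + 1 + 1)) d := by rw [pow_succ' φ (k + 1)]; exact heq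
        exact Equiv.Perm.SameCycle.symm ⟨((k + 1 + 1 : ℕ) : ℤ), by rw [zpow_natCast]; exact this.symm⟩)
      rw [pow_succ' φ (k + 1)]
      exact h2
  have ho := orderOf_pos φ
  have := key (orderOf φ - 1)
  rw [Nat.sub_add_cancel ho, pow_orderOf_eq_one] at this
  exact hloop _ this

lemma same_pow {x y : V} (h : φ.SameCycle x y) : ∃ k : ℕ, (φ ^ k) x = y := by
  obtain ⟨k, _, _, hk⟩ := h.exists_pow_eq φ
  exact ⟨k, hk⟩

include hloop hmatch hφ hfix in
lemma out_inv {c c' v : V} (hc : φ.SameCycle c c') (hv : ¬ φ.SameCycle c v) (h : E c v) :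
    E c' v := by
  obtain ⟨k, rfl⟩ := same_pow φ hc
  clear hc
  induction k with
  | zero => simpa using h
  | succ k ih =>
    rw [pow_succ']
    by_cases hm : ∃ d, IsMissing E ((φ ^ k) c) d
    · obtain ⟨d, hd⟩ := hm
      refine (R_facts E hloop hmatch (hφ _ _ hd)).2.2 v ih ?_
      rintro rfl
      apply hv
      have h1 := miss_same E hloop hmatch φ hφ hd
      have h2 : φ.SameCycle c ((φ ^ k) c) := ⟨k, by simp⟩
      exact (h2.trans h1).trans ⟨1, by simp⟩
    · push Not at hm
      have := hfix _ hm
      rw [Equiv.Perm.mul_apply, this]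
      exact ih

include hloop hdigon hmatch hφ hfix in
lemma both_inv {c c' v v' : V} (hc : φ.SameCycle c c') (hvv : φ.SameCycle v v')
    (hv : ¬ φ.SameCycle c v) (h : E c v) : E c' v' := by
  have h1 := out_inv E hloop hmatch φ hfix hφ hc hv h
  have hn : ¬ φ.SameCycle c' v' := fun hh => hv ((hc.trans hh).trans hvv.symm)
  have hne : c' ≠ v' := by rintro rfl; exact hn (Equiv.Perm.SameCycle.refl _ _)
  rcases adj E hne (fun hm => hn (miss_same E hloop hmatch φ hφ hm)) with h2 | h2
  · exact h2
  · have h3 := out_inv E hloop hmatch φ hfix hφ hvv.symm (fun hh => hn hh.symm) h2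
    exact absurd ⟨h1, h3⟩ (hdigon _ _)

include hloop hmatch hφ hfix in
lemma out_eq {c d v : V} (h : IsMissing E c d) (hv : E (φ c) v) : v = c ∨ E c v := by
  let N : V → Finset V := fun x => Finset.univ.filter (E x)
  have hsub : ∀ c d, IsMissing E c d → insert c ((N c).erase (φ d)) ⊆ N (φ c) ∧
      (insert c ((N c).erase (φ d))).card = (N c).card := by
    intro c d h
    obtain ⟨a1, a2, a3⟩ := R_facts E hloop hmatch (hφ _ _ h)
    constructor
    · intro x hx
      simp only [N, Finset.mem_insert, Finset.mem_erase, Finset.mem_filter, Finset.mem_univ,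
        true_and] at hx ⊢
      rcases hx with rfl | ⟨h1, h2⟩
      · exact a1
      · exact a3 x h2 h1
    · rw [Finset.card_insert_of_notMem (by simp [N, hloop]), Finset.card_erase_add_one]
      simpa [N] using a2
  have hle : ∀ x ∈ (Finset.univ : Finset V), (N x).card ≤ (N (φ x)).card := by
    intro x _
    by_cases hm : ∃ d, IsMissing E x d
    · obtain ⟨d, hd⟩ := hm
      rw [← (hsub x d hd).2]
      exact Finset.card_le_card (hsub x d hd).1
    · push Not at hm
      rw [hfix x hm]
  have hsum : ∑ x, (N x).card = ∑ x, (N (φ x)).card :=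
    (Equiv.sum_comp φ (fun x => (N x).card)).symm
  have heq := (Finset.sum_eq_sum_iff_of_le hle).1 hsum c (Finset.mem_univ c)
  have hs := hsub c d h
  have := Finset.eq_of_subset_of_card_le hs.1 (by rw [hs.2, heq])
  have hvm : v ∈ N (φ c) := by simpa [N] using hv
  rw [← this] at hvm
  simp only [N, Finset.mem_insert, Finset.mem_erase, Finset.mem_filter, Finset.mem_univ,
        true_and] at hvm
  tauto

include hloop hdigon hmatch hφ hfix in
lemma no_both (c : V) (k : ℕ) : ∀ w wb, IsMissing E w wb → (φ ^ k) w = c → E c w → ¬ E c wb := by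
  induction k with
  | zero =>
    intro w wb _ h1 h2
    simp at h1
    subst h1
    exact absurd h2 (hloop _)
  | succ k ih =>
    intro w wb hm h1 h2 h3
    rw [pow_succ, Equiv.Perm.mul_apply] at h1
    have hR := hφ _ _ hm
    obtain ⟨a1, a2, a3⟩ := R_facts E hloop hmatch hR
    obtain ⟨b1, b2, b3⟩ := R_facts E hloop hmatch (R_symm E hR)
    have n1 : c ≠ φ w := by rintro rfl; exact hdigon _ _ ⟨h3, b2⟩
    have n2 : c ≠ φ wb := by rintro rfl; exact hdigon _ _ ⟨h2, a2⟩
    have hm' : IsMissing E (φ w) (φ wb) := miss_symm E hR.2.1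
    have m1 : ¬ IsMissing E c (φ w) := fun h => n2 (hmatch _ _ _ (miss_symm E h) hm')
    have m2 : ¬ IsMissing E c (φ wb) := fun h =>
      n1 (hmatch _ _ _ (miss_symm E h) (miss_symm E hm'))
    have cw : c ≠ w := by rintro rfl; exact hloop _ h2
    have cwb : c ≠ wb := by rintro rfl; exact hloop _ h3
    -- arcs out of φ w towards c would give arcs out of w
    have r1 : E c (φ w) := by
      rcases adj E n1 m1 with h | h
      · exact h
      · rcases out_eq E hloop hmatch φ hfix hφ hm h with h' | h'
        · exact absurd h' cw
        · exact absurd ⟨h2, h'⟩ (hdigon _ _)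
    have r2 : E c (φ wb) := by
      rcases adj E n2 m2 with h | h
      · exact h
      · rcases out_eq E hloop hmatch φ hfix hφ (miss_symm E hm) h with h' | h'
        · exact absurd h' cwb
        · exact absurd ⟨h3, h'⟩ (hdigon _ _)
    exact ih _ _ hm' h1 r1 r2

include hloop hdigon hmatch hφ hfix in
lemma inner_le (c : V) :
    (Finset.univ.filter (fun x => φ.SameCycle c x ∧ E c x)).card ≤
    (Finset.univ.filter (fun x => φ.SameCycle c x ∧ x ∈ Npp E c)).card := by
  have hb : ∀ x, ∃ y, (∃ d, IsMissing E x d) → IsMissing E x y := by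
    intro x
    by_cases h : ∃ d, IsMissing E x d
    · exact ⟨h.choose, fun _ => h.choose_spec⟩
    · exact ⟨x, fun h' => absurd h' h⟩
  choose bar hbar using hb
  have hX : ∀ x, φ.SameCycle c x → E c x → IsMissing E x (bar x) := by
    intro x hs hE
    apply hbar
    by_contra hcon
    push Not at hcon
    have hf := hfix x hcon
    obtain ⟨k, hk⟩ := same_pow φ hs.symm
    have : (φ ^ k) x = x := by
      clear hk
      induction k with
      | zero => rfl
      | succ k ih => rw [pow_succ', Equiv.Perm.mul_apply, ih, hf]
    rw [this] at hk
    subst hk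
    exact hloop _ hE
  apply Finset.card_le_card_of_injOn (fun x => φ (bar x))
  · intro x hx
    simp only [Finset.coe_filter, Finset.mem_univ, true_and, Set.mem_ofPred_eq] at hx ⊢
    obtain ⟨hs, hE⟩ := hx
    have hm := hX x hs hE
    have hR := hφ _ _ hm
    have hm' : IsMissing E (φ x) (φ (bar x)) := miss_symm E hR.2.1
    obtain ⟨a1, a2, a3⟩ := R_facts E hloop hmatch hR
    have hcx : c ≠ x := by rintro rfl; exact hloop _ hE
    refine ⟨(hs.trans (miss_same E hloop hmatch φ hφ hm)).trans ⟨1, by simp⟩, ?_, ?_, x, hE, a2⟩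
    · intro h
      rw [h] at a2
      exact hdigon _ _ ⟨hE, a2⟩
    · intro h
      have n1 : c ≠ φ x := by
        intro h'
        rw [← h'] at hm'
        exact hm'.2.1 h
      have m1 : ¬ IsMissing E c (φ x) := by
        intro h'
        have := hmatch _ _ _ (miss_symm E h') hm'
        rw [← this] at h
        exact hloop _ h
      have r1 : E c (φ x) := by
        rcases adj E n1 m1 with h | h
        · exact h
        · rcases out_eq E hloop hmatch φ hfix hφ hm h with h' | h'
          · exact absurd h' hcx
          · exact absurd ⟨hE, h'⟩ (hdigon _ _)
      have hsc : φ.SameCycle (φ x) c := (hs.trans ⟨1, by simp⟩).symm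
      obtain ⟨k, hk⟩ := same_pow φ hsc
      exact no_both E hloop hdigon hmatch φ hfix hφ c k _ _ hm' hk r1 h
  · intro x hx y hy hxy
    simp only [Finset.coe_filter, Finset.mem_univ, true_and, Set.mem_ofPred_eq] at hx hy
    have h1 := hX x hx.1 hx.2
    have h2 := hX y hy.1 hy.2
    have h3 : bar x = bar y := φ.injective hxy
    rw [h3] at h1
    exact hmatch _ _ _ (miss_symm E h1) (miss_symm E h2)

lemma count {W Q : Type*} [Fintype W] [Fintype Q] (π : W → Q) (ω : Q → ℕ)
    (hω : ∀ q, ω q = (Finset.univ.filter (fun x => π x = q)).card) (p : Q → Prop) :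
    (∑ q, if p q then ω q else 0) =
      (Finset.univ.filter (fun x => p (π x))).card := by
  rw [Finset.card_eq_sum_card_fiberwise (f := π) (t := Finset.univ) (by simp)]
  refine Finset.sum_congr rfl fun q _ => ?_
  split_ifs with h
  · rw [hω]
    congr 1
    ext x
    simp only [Finset.mem_filter, Finset.mem_univ, true_and]
    exact ⟨fun hx => ⟨hx ▸ h, hx⟩, fun hx => hx.2⟩
  · symm
    rw [Finset.card_eq_zero]
    ext x
    simp only [Finset.mem_filter, Finset.mem_univ, true_and, Finset.notMem_empty, iff_false]
    rintro ⟨h1, h2⟩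
    exact h (h2 ▸ h1)

include hloop hdigon hmatch hcyc in
theorem main [Nonempty V] (hsink : ∀ v, ∃ w, E v w) :
    ∃ u v : V, u ≠ v ∧ (Nplus E u).ncard ≤ (Npp E u).ncard ∧
      (Nplus E v).ncard ≤ (Npp E v).ncard := by
  obtain ⟨φ, hfix, hφ⟩ := exists_perm E hloop hdigon hmatch hcyc
  let S : Setoid V := Equiv.Perm.SameCycle.setoid φ
  let Q := Quotient S
  let π : V → Q := fun x => Quotient.mk S x
  have hπ : ∀ x y, π x = π y ↔ φ.SameCycle x y := fun x y => Quotient.eq (r := S)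
  have hsurj : ∀ q : Q, ∃ x, π x = q := fun q => Quotient.exists_rep q
  obtain ⟨A, hA⟩ : ∃ A : Q → Q → Prop,
      ∀ x y, A (π x) (π y) ↔ ¬ φ.SameCycle x y ∧ E x y := by
    refine ⟨fun q q' => q ≠ q' ∧ ∃ x y, π x = q ∧ π y = q' ∧ E x y, ?_⟩
    intro x y
    constructor
    · rintro ⟨h1, x', y', hx, hy, h⟩
      rw [Ne, hπ] at h1
      rw [hπ] at hx hy
      exact ⟨h1, both_inv E hloop hdigon hmatch φ hfix hφ hx hy
        (fun hh => h1 ((hx.symm.trans hh).trans hy)) h⟩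
    · rintro ⟨h1, h2⟩
      exact ⟨fun h => h1 ((hπ x y).1 h), x, y, rfl, rfl, h2⟩
  let ω : Q → ℕ := fun q => (Finset.univ.filter (fun x => π x = q)).card
  have : Nonempty Q := ⟨π (Classical.arbitrary V)⟩
  have hω : ∀ q, 0 < ω q := by
    intro q
    obtain ⟨x, rfl⟩ := hsurj q
    exact Finset.card_pos.2 ⟨x, by simp⟩
  have hSN : ∀ x, SN A ω (π x) → (Nplus E x).ncard ≤ (Npp E x).ncard := by
    intro x h
    unfold SN at h
    rw [count π ω (fun q => by simp only [ω]; congr), count π ω (fun q => by simp only [ω]; congr)] at h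
    have hin := inner_le E hloop hdigon hmatch φ hfix hφ x
    rw [Set.ncard_eq_toFinset_card', Set.ncard_eq_toFinset_card']
    have h1 : (Nplus E x).toFinset ⊆ Finset.univ.filter (fun y => A (π x) (π y)) ∪
        Finset.univ.filter (fun y => φ.SameCycle x y ∧ E x y) := by
      intro y hy
      have hy' : E x y := Set.mem_toFinset.1 hy
      simp only [Finset.mem_union, Finset.mem_filter, Finset.mem_univ, true_and, hA]
      tauto
    have h2 : Finset.univ.filter (fun y => sec A (π x) (π y)) ∪
        Finset.univ.filter (fun y => φ.SameCycle x y ∧ y ∈ Npp E x) ⊆ (Npp E x).toFinset := by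
      intro y hy
      simp only [Set.mem_toFinset, Finset.mem_union, Finset.mem_filter,
        Finset.mem_univ, true_and] at hy ⊢
      rcases hy with ⟨h1, h2, q, h3, h4⟩ | hy
      · obtain ⟨z, rfl⟩ := hsurj q
        rw [hA] at h2 h3 h4
        have hs : ¬ φ.SameCycle x y := fun hh => h1 ((hπ _ _).2 hh).symm
        exact ⟨fun h => h1 (by rw [h]), fun h => h2 ⟨hs, h⟩, z, h3.2, h4.2⟩
      · exact hy.2
    have hdisj : Disjoint (Finset.univ.filter (fun y => sec A (π x) (π y)))
        (Finset.univ.filter (fun y => φ.SameCycle x y ∧ y ∈ Npp E x)) := by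
      rw [Finset.disjoint_left]
      intro y hy hy'
      simp only [Finset.mem_filter, Finset.mem_univ, true_and] at hy hy'
      exact hy.1 ((hπ _ _).2 hy'.1).symm
    have h3 := (Finset.card_le_card h1).trans (Finset.card_union_le _ _)
    have h4 := Finset.card_le_card h2
    rw [Finset.card_union_of_disjoint hdisj] at h4
    omega
  rcases two A ω (by
      intro q h
      obtain ⟨x, rfl⟩ := hsurj q
      exact ((hA x x).1 h).1 (Equiv.Perm.SameCycle.refl _ _)) (by
      intro q q' h h'
      obtain ⟨x, rfl⟩ := hsurj q
      obtain ⟨y, rfl⟩ := hsurj q'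
      rw [hA] at h h'
      exact hdigon _ _ ⟨h.2, h'.2⟩) (by
      intro q q' hne
      obtain ⟨x, rfl⟩ := hsurj q
      obtain ⟨y, rfl⟩ := hsurj q'
      have hs : ¬ φ.SameCycle x y := fun h => hne ((hπ _ _).2 h)
      rw [hA, hA]
      rcases adj E (fun h => hne (by rw [h]))
        (fun h => hs (miss_same E hloop hmatch φ hφ h)) with h | h
      · exact Or.inl ⟨hs, h⟩
      · exact Or.inr ⟨fun h' => hs h'.symm, h⟩) hω (by
      intro q hq
      obtain ⟨x, rfl⟩ := hsurj q
      obtain ⟨y, hy⟩ := hsink x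
      refine ⟨π y, (hA _ _).2 ⟨fun h => ?_, hy⟩⟩
      have := Finset.card_le_one.1 hq x (by simp) y (by simpa using ((hπ _ _).2 h).symm)
      rw [this] at hy
      exact hloop _ hy) with ⟨q, hq, h⟩ | ⟨q, q', hne, h, h'⟩
  · obtain ⟨u, hu, v, hv, huv⟩ := Finset.one_lt_card.1 (show 1 < ω q from hq)
    simp only [Finset.mem_filter, Finset.mem_univ, true_and] at hu hv
    exact ⟨u, v, huv, hSN u (hu ▸ h), hSN v (hv ▸ h)⟩
  · obtain ⟨x, rfl⟩ := hsurj q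
    obtain ⟨y, rfl⟩ := hsurj q'
    exact ⟨x, y, fun hh => hne (by rw [hh]), hSN x h, hSN y h'⟩

end Dig

end Sol16

theorem stmt_16 {V : Type*} [Fintype V] [Nonempty V]
    (E : V → V → Prop) (hloop : ∀ v, ¬ E v v) (hdigon : ∀ x y, ¬ (E x y ∧ E y x))
    (hmatch : ∀ a b c, IsMissing E a b → IsMissing E a c → b = c)
    (hcyc : ∀ e, IsMissingS E e → ∃ f, Loses E f e)
    (hsink : ∀ v, ∃ w, E v w) :
    ∃ u v : V, u ≠ v ∧ (Nplus E u).ncard ≤ (Npp E u).ncard ∧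
      (Nplus E v).ncard ≤ (Npp E v).ncard := by
  exact Sol16.main E hloop hdigon hmatch hcyc hsink
end

section
/- Every finite oriented graph whose missing edges form a matching (i.e., the missing edges are pairwise vertex-disjoint) has a vertex with the second neighborhood property. -/
variable {V : Type*}

/-- Existence of a vertex ordering (by integers) with the feedback property. -/
theorem feedback_exists {W : Type*} [Finite W] (T : W → W → Prop)
    (hanti : ∀ x y, T x y → ¬ T y x) :
    ∃ p : W → ℤ, Function.Injective p ∧ ∀ r (t : ℤ), t ≤ p r →
      {y | T r y ∧ t ≤ p y ∧ p y < p r}.ncard ≤ {y | T y r ∧ t ≤ p y ∧ p y < p r}.ncard := by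
  classical
  have hne : Nonempty {p : W → ℤ // Function.Injective p} := by
    obtain ⟨n, ⟨e⟩⟩ := Finite.exists_equiv_fin W
    refine ⟨⟨fun w => ((e w : ℕ) : ℤ), ?_⟩⟩
    intro a b h
    apply e.injective
    apply Fin.ext
    simpa using h
  let F : (W → ℤ) → Set (W × W) := fun p => {q | p q.1 < p q.2 ∧ T q.1 q.2}
  have hb : ∀ p, (F p).ncard ≤ (Set.univ : Set (W × W)).ncard := fun p =>
    Set.ncard_le_ncard (Set.subset_univ _) (Set.toFinite _)
  obtain ⟨⟨p, hp⟩, hmax⟩ : ∃ p : {p : W → ℤ // Function.Injective p}, ∀ q :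
      {p : W → ℤ // Function.Injective p}, (F q.1).ncard ≤ (F p.1).ncard := by
    let g : {p : W → ℤ // Function.Injective p} → ℕ :=
      fun p => (Set.univ : Set (W × W)).ncard - (F p.1).ncard
    refine ⟨Function.argmin g, fun q => ?_⟩
    have h1 : g (Function.argmin g) ≤ g q := Function.argmin_le g q
    have h2 := hb q.1
    have h3 := hb (Function.argmin g).1
    simp only [g] at h1 ⊢
    simp only [g] at h3
    omega
  refine ⟨p, hp, fun r t ht => ?_⟩
  let p' : W → ℤ := fun x => if x = r then 2 * t - 1 else 2 * p x
  have hp' : Function.Injective p' := by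
    intro a b h
    simp only [p'] at h
    split_ifs at h with h1 h2 h2
    · rw [h1, h2]
    · omega
    · omega
    · apply hp; omega
  have hm : (F p').ncard ≤ (F p).ncard := hmax ⟨p', hp'⟩
  set O : Set W := {y | T r y ∧ t ≤ p y ∧ p y < p r} with hO
  set I : Set W := {y | T y r ∧ t ≤ p y ∧ p y < p r} with hI
  have hOc : ((fun y => (r, y)) '' O).ncard = O.ncard :=
    Set.ncard_image_of_injective _ (fun a b h => by simpa using h)
  have hIc : ((fun y => (y, r)) '' I).ncard = I.ncard :=
    Set.ncard_image_of_injective _ (fun a b h => by simpa using h)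
  have hdis : Disjoint (F p) ((fun y => (r, y)) '' O) := by
    rw [Set.disjoint_left]
    rintro q ⟨h1, h2⟩ ⟨y, ⟨h3, h4, h5⟩, rfl⟩
    simp only at h1
    omega
  have hsub : F p ∪ ((fun y => (r, y)) '' O) ⊆ F p' ∪ ((fun y => (y, r)) '' I) := by
    have hirr : ∀ x, ¬ T x x := fun x hx => hanti x x hx hx
    rintro ⟨a, b⟩ (⟨h1, h2⟩ | ⟨y, ⟨h3, h4, h5⟩, h6⟩)
    · simp only at h1 h2
      by_cases ha : a = r
      · left
        subst ha
        have hba : b ≠ a := by rintro rfl; exact hirr _ h2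
        refine ⟨?_, h2⟩
        simp only [p', if_pos, if_neg hba]
        omega
      · by_cases hbr : b = r
        · subst hbr
          by_cases hat : t ≤ p a
          · right; exact ⟨a, ⟨h2, hat, h1⟩, rfl⟩
          · left
            refine ⟨?_, h2⟩
            simp only [p', if_pos, if_neg ha]
            omega
        · left
          refine ⟨?_, h2⟩
          simp only [p', if_neg ha, if_neg hbr]
          omega
    · left
      simp only [Prod.mk.injEq] at h6
      obtain ⟨rfl, rfl⟩ := h6
      have hba : y ≠ r := by rintro rfl; exact hirr _ h3
      refine ⟨?_, h3⟩
      simp only [p', if_pos, if_neg hba]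
      omega
  have h1 := Set.ncard_le_ncard hsub (Set.toFinite _)
  rw [Set.ncard_union_eq hdis (Set.toFinite _) (Set.toFinite _), hOc] at h1
  have h2 := Set.ncard_union_le (F p') ((fun y => (y, r)) '' I)
  rw [hIc] at h2
  omega

/-- Havet–Thomassé, in a form allowing an arbitrary set of out-neighbours. -/
theorem havet_thomasse {W : Type*} [Finite W] [Nonempty W] (T : W → W → Prop)
    (hanti : ∀ x y, T x y → ¬ T y x) (htot : ∀ x y, x ≠ y → T x y ∨ T y x) :
    ∃ f, ∀ S : Set W, (∀ x ∈ S, T f x) →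
      S.ncard ≤ {y | y ≠ f ∧ y ∉ S ∧ ∃ x ∈ S, T x y}.ncard := by
  classical
  have hirr : ∀ x, ¬ T x x := fun x hx => hanti x x hx hx
  obtain ⟨p, hp, hfb⟩ := feedback_exists T hanti
  obtain ⟨f, hf⟩ := Finite.exists_max p
  refine ⟨f, fun S hS => ?_⟩
  set G : Set W := {y | y ≠ f ∧ y ∉ S ∧ ∃ x ∈ S, T x y} with hG
  have key : ∀ n : ℕ, ∀ t : ℤ, p f - t < n →
      (S ∩ {y | t ≤ p y}).ncard ≤ (G ∩ {y | t ≤ p y}).ncard := by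
    intro n
    induction n with
    | zero =>
      intro t ht
      have : S ∩ {y | t ≤ p y} = ∅ := by
        ext y
        have := hf y
        simp only [Set.mem_inter_iff, Set.mem_ofPred_eq, Set.mem_empty_iff_false, iff_false, not_and]
        intro _
        push_cast at ht
        omega
      rw [this]; simp
    | succ n ih =>
      intro t ht
      let B : Set W := {y | y ≠ f ∧ y ∉ S ∧ y ∉ G ∧ t ≤ p y}
      by_cases hB : B.Nonempty
      · obtain ⟨r, ⟨hrf, hrS, hrG, hrt⟩, hrmin⟩ := Set.exists_min_image B p (Set.toFinite _) hB
        have hST : ∀ x ∈ S, ¬ T x r := fun x hx hT => hrG ⟨hrf, hrS, x, hx, hT⟩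
        have h1 := hfb r t hrt
        have h2 := ih (p r + 1) (by push_cast at ht; omega)
        have e1 : S ∩ {y | t ≤ p y} ⊆
            {y | T r y ∧ t ≤ p y ∧ p y < p r} ∪ (S ∩ {y | p r + 1 ≤ p y}) := by
          rintro y ⟨hyS, hyt⟩
          have hyr : y ≠ r := by rintro rfl; exact hrS hyS
          have hT : T r y := (htot y r hyr).resolve_left (hST y hyS)
          have hpy : p y ≠ p r := fun h => hyr (hp h)
          simp only [Set.mem_ofPred_eq] at hyt
          by_cases h : p y < p r
          · left; exact ⟨hT, hyt, h⟩
          · right; refine ⟨hyS, ?_⟩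
            simp only [Set.mem_ofPred_eq]; omega
        have e2 : {y | T y r ∧ t ≤ p y ∧ p y < p r} ∪ (G ∩ {y | p r + 1 ≤ p y}) ⊆
            G ∩ {y | t ≤ p y} := by
          rintro y (⟨h1, h2, h3⟩ | ⟨h1, h2⟩)
          · refine ⟨?_, h2⟩
            by_contra hyG
            have hyf : y ≠ f := by
              rintro rfl
              have := hf r
              omega
            have := hrmin y ⟨hyf, fun hyS => hST y hyS h1, hyG, h2⟩
            omega
          · refine ⟨h1, ?_⟩
            simp only [Set.mem_ofPred_eq] at h2 ⊢; omega
        have e3 : Disjoint {y | T y r ∧ t ≤ p y ∧ p y < p r} (G ∩ {y | p r + 1 ≤ p y}) := by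
          rw [Set.disjoint_left]
          rintro y ⟨_, _, h3⟩ ⟨_, h4⟩
          simp only [Set.mem_ofPred_eq] at h4; omega
        have c1 := Set.ncard_le_ncard e1 (Set.toFinite _)
        have c2 := Set.ncard_le_ncard e2 (Set.toFinite _)
        rw [Set.ncard_union_eq e3 (Set.toFinite _) (Set.toFinite _)] at c2
        have c3 := Set.ncard_union_le {y | T r y ∧ t ≤ p y ∧ p y < p r}
          (S ∩ {y | p r + 1 ≤ p y})
        omega
      · by_cases htf : t ≤ p f
        · have h1 := hfb f t htf
          have hlt : ∀ y, y ≠ f → p y < p f := fun y hy =>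
            lt_of_le_of_ne (hf y) (fun h => hy (hp h))
          have e1 : S ∩ {y | t ≤ p y} ⊆ {y | T f y ∧ t ≤ p y ∧ p y < p f} := by
            rintro y ⟨hyS, hyt⟩
            refine ⟨hS y hyS, hyt, hlt y ?_⟩
            rintro rfl
            exact hirr _ (hS _ hyS)
          have e2 : {y | T y f ∧ t ≤ p y ∧ p y < p f} ⊆ G ∩ {y | t ≤ p y} := by
            rintro y ⟨h1, h2, h3⟩
            refine ⟨?_, h2⟩
            by_contra hyG
            exact hB ⟨y, by rintro rfl; exact hirr _ h1, fun hyS => hanti _ _ h1 (hS y hyS),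
              hyG, h2⟩
          exact (Set.ncard_le_ncard e1 (Set.toFinite _)).trans
            (h1.trans (Set.ncard_le_ncard e2 (Set.toFinite _)))
        · have : S ∩ {y | t ≤ p y} = ∅ := by
            ext y
            have := hf y
            simp only [Set.mem_inter_iff, Set.mem_ofPred_eq, Set.mem_empty_iff_false, iff_false,
              not_and]
            intro _
            omega
          rw [this]; simp
  obtain ⟨m, hm⟩ := Finite.exists_min p
  have h := key (p f - p m + 1).toNat (p m) (by omega)
  have : {y | p m ≤ p y} = (Set.univ : Set W) := by
    ext y; simp [hm y]
  rw [this, Set.inter_univ, Set.inter_univ] at h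
  exact h

/-- Oriented graph whose missing edges form a matching. -/
structure OGM (E : V → V → Prop) : Prop where
  loop : ∀ v, ¬ E v v
  dig : ∀ x y, E x y → ¬ E y x
  mat : ∀ a b c, IsMissing E a b → IsMissing E a c → b = c

/-- Losing relation, unfolded. -/
structure Lz (E : V → V → Prop) (a b c d : V) : Prop where
  m1 : IsMissing E a b
  m2 : IsMissing E c d
  ac : E a c
  cb : E c b
  bd : E b d
  da : E d a
  n1 : ∀ u, E a u → ¬ E u d
  n2 : ∀ u, E b u → ¬ E u c

theorem IsMissing.sym {E : V → V → Prop} {a b : V} (h : IsMissing E a b) : IsMissing E b a :=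
  ⟨h.1.symm, h.2.2, h.2.1⟩

theorem Lz.swap {E : V → V → Prop} {a b c d : V} (h : Lz E a b c d) : Lz E b a d c :=
  ⟨h.m1.sym, h.m2.sym, h.bd, h.da, h.ac, h.cb, h.n2, h.n1⟩

theorem OGM.adj {E : V → V → Prop} (g : OGM E) {x x' y : V} (h : IsMissing E x x')
    (h1 : y ≠ x) (h2 : y ≠ x') : E x y ∨ E y x := by
  by_contra hc
  push Not at hc
  exact h2 (g.mat x x' y h ⟨h1.symm, hc.1, hc.2⟩).symm

/-- out-degree at most one -/
theorem OGM.out_unique {E : V → V → Prop} (g : OGM E) {a b c d c' d' : V}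
    (h : Lz E a b c d) (h' : Lz E a b c' d') : c = c' ∧ d = d' := by
  have hcc : c = c' := by
    by_contra hne
    have hcd : c ≠ d' := by
      rintro rfl
      exact g.dig _ _ h.ac h'.da
    rcases g.adj h'.m2.sym hcd hne with h1 | h1
    · exact h.n2 _ h'.bd h1
    · exact h'.n1 _ h.ac h1
  subst hcc
  exact ⟨rfl, (g.mat _ _ _ h'.m2 h.m2).symm⟩

/-- in-degree at most one -/
theorem OGM.in_unique {E : V → V → Prop} (g : OGM E) {a b c d a' b' : V}
    (h : Lz E a b c d) (h' : Lz E a' b' c d) : a = a' ∧ b = b' := by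
  have hcc : a = a' := by
    by_contra hne
    have hcd : a ≠ b' := by
      rintro rfl
      exact g.dig _ _ h.ac h'.cb
    rcases g.adj h'.m1.sym hcd hne with h1 | h1
    · exact h'.n2 _ h1 h.ac
    · exact h.n1 _ h1 h'.bd
  subst hcc
  exact ⟨rfl, (g.mat _ _ _ h'.m1 h.m1).symm⟩

/-- `MM c q`: some missing edge `pq` loses to `cd` with `p → c → q → d → p`. -/
def MM (E : V → V → Prop) (c q : V) : Prop := ∃ p d, Lz E p q c d

theorem OGM.mm_right {E : V → V → Prop} (g : OGM E) {c q q' : V} (h : MM E c q)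
    (h' : MM E c q') : q = q' := by
  obtain ⟨p, d, h⟩ := h
  obtain ⟨p', d', h'⟩ := h'
  obtain rfl := g.mat _ _ _ h.m2 h'.m2
  exact (g.in_unique h h').2

theorem OGM.mm_left {E : V → V → Prop} (g : OGM E) {c c' q : V} (h : MM E c q)
    (h' : MM E c' q) : c = c' := by
  obtain ⟨p, d, h⟩ := h
  obtain ⟨p', d', h'⟩ := h'
  obtain rfl := g.mat _ _ _ h.m1.sym h'.m1.sym
  exact (g.out_unique h h').1

open Relation in
/-- orbit -/
def Orb (E : V → V → Prop) (x y : V) : Prop := ReflTransGen (MM E) x y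

open Relation in
/-- cyclic vertices -/
def Cyc (E : V → V → Prop) (x : V) : Prop := TransGen (MM E) x x

theorem OGM.orb_sym {E : V → V → Prop} (g : OGM E) {x y : V} (hx : Cyc E x) (h : Orb E x y) :
    Orb E y x := by
  induction h with
  | refl => exact Relation.ReflTransGen.refl
  | @tail y z _ hyz ih =>
    rcases Relation.ReflTransGen.cases_head ih with rfl | ⟨w, hw, hwx⟩
    · obtain ⟨w, hw, hwx⟩ := Relation.TransGen.head'_iff.1 hx
      rw [g.mm_right hyz hw]; exact hwx
    · rw [g.mm_right hyz hw]; exact hwx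

theorem OGM.orb_cyc {E : V → V → Prop} (g : OGM E) {x y : V} (hx : Cyc E x) (h : Orb E x y) :
    Cyc E y :=
  Relation.TransGen.trans_right (g.orb_sym hx h) (Relation.TransGen.trans_left hx h)

theorem OGM.cyc_of_mm {E : V → V → Prop} (g : OGM E) {c q : V} (h : MM E c q) (hq : Cyc E q) :
    Cyc E c := by
  obtain ⟨c', hc', h'⟩ := Relation.TransGen.tail'_iff.1 hq
  obtain rfl := g.mm_left h h'
  exact Relation.TransGen.head' h hc'

theorem OGM.mm_step {E : V → V → Prop} (g : OGM E) {f c q : V} (h : MM E c q) (hf : E f c) :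
    E f q ∨ IsMissing E f q := by
  obtain ⟨p, d, h⟩ := h
  by_cases hfp : f = p
  · subst hfp; right; exact h.m1
  · left
    have hfq : f ≠ q := by
      rintro rfl; exact g.dig _ _ hf h.cb
    rcases g.adj h.m1.sym hfq hfp with h1 | h1
    · exact absurd hf (h.n2 _ h1)
    · exact h1

theorem OGM.orb_step {E : V → V → Prop} (g : OGM E) {f c q : V} (h : Orb E c q) (hf : E f c) :
    E f q ∨ ∃ f', Orb E c f' ∧ IsMissing E f f' := by
  induction h with
  | refl => exact Or.inl hf
  | @tail y z hy hyz ih =>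
    rcases ih with ih | ih
    · rcases g.mm_step hyz ih with h1 | h1
      · exact Or.inl h1
      · exact Or.inr ⟨z, hy.tail hyz, h1⟩
    · exact Or.inr ih

theorem OGM.cyc_partner {E : V → V → Prop} (g : OGM E) {c : V} (h : Cyc E c) :
    ∃ c', Orb E c c' ∧ IsMissing E c c' := by
  obtain ⟨w, hw, hwx⟩ := Relation.TransGen.head'_iff.1 h
  have hE : E c w := by obtain ⟨p, d, h⟩ := hw; exact h.cb
  rcases g.orb_step hwx hE with h1 | ⟨f', h1, h2⟩
  · exact absurd h1 (g.loop _)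
  · exact ⟨f', Relation.ReflTransGen.head hw h1, h2⟩

theorem OGM.orb_partner {E : V → V → Prop} (g : OGM E) {c x x' : V} (h : Cyc E c)
    (hx : Orb E c x) (hm : IsMissing E x x') : Orb E c x' := by
  obtain ⟨y, h1, h2⟩ := g.cyc_partner (g.orb_cyc h hx)
  rw [g.mat _ _ _ hm h2]
  exact Relation.ReflTransGen.trans hx h1

/-- An outside vertex sees both ends of a cyclic missing edge. -/
theorem OGM.cyc_both {E : V → V → Prop} (g : OGM E) {f x y : V} (hx : Cyc E x)
    (hm : IsMissing E x y) (hf : E f x) : E f y ∨ Orb E x f := by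
  have hy := g.orb_partner hx Relation.ReflTransGen.refl hm
  rcases g.orb_step hy hf with h | ⟨f', h1, h2⟩
  · exact Or.inl h
  · exact Or.inr (g.orb_partner hx h1 h2.sym)

theorem OGM.not_both {E : V → V → Prop} (g : OGM E) {f x q : V} (h : Orb E x q) :
    ∀ x', IsMissing E x x' → E f x → E f x' → E f q ∧ ∀ q', IsMissing E q q' → E f q' := by
  induction h with
  | refl =>
    intro x' hm h1 h2
    exact ⟨h1, fun q' hq => by rw [← g.mat _ _ _ hm hq]; exact h2⟩
  | @tail y z _ hyz ih =>
    intro x' hm h1 h2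
    obtain ⟨h3, h4⟩ := ih x' hm h1 h2
    obtain ⟨p, d, hl⟩ := hyz
    have h5 : E f d := h4 _ hl.m2
    have h6 : E f z := by
      rcases g.mm_step ⟨p, d, hl⟩ h3 with h6 | h6
      · exact h6
      · obtain rfl := g.mat _ _ _ h6.sym hl.m1.sym
        exact absurd hl.da (g.dig _ _ h5)
    refine ⟨h6, fun q' hq => ?_⟩
    obtain rfl := g.mat _ _ _ hq hl.m1.sym
    rcases g.mm_step ⟨z, y, hl.swap⟩ h5 with h7 | h7
    · exact h7
    · exact absurd h6 (by
        obtain rfl := g.mat _ _ _ h7.sym hl.m1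
        exact g.loop _)

/-- losing relation on ordered pairs -/
def RR (E : V → V → Prop) (x y : V × V) : Prop := Lz E x.1 x.2 y.1 y.2

/-- roots -/
def Root (E : V → V → Prop) (x : V × V) : Prop := IsMissing E x.1 x.2 ∧ ∀ y, ¬ RR E y x

theorem Root.swp {E : V → V → Prop} {x : V × V} (h : Root E x) : Root E x.swap :=
  ⟨h.1.sym, fun y hy => h.2 y.swap (Lz.swap hy)⟩

theorem rr_swap {E : V → V → Prop} {x y : V × V} (h : Relation.ReflTransGen (RR E) x y) :
    Relation.ReflTransGen (RR E) x.swap y.swap := by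
  induction h with
  | refl => exact Relation.ReflTransGen.refl
  | @tail y z _ hyz ih => exact ih.tail (Lz.swap hyz)

theorem OGM.root_exists [Finite V] {E : V → V → Prop} (g : OGM E) (n : ℕ) : ∀ c d : V,
    {q | Relation.TransGen (MM E) c q}.ncard < n → IsMissing E c d → ¬ Cyc E c →
    ∃ r, Root E r ∧ Relation.ReflTransGen (RR E) r (c, d) := by
  induction n with
  | zero => intro c d h; omega
  | succ n ih =>
    intro c d h hm hc
    by_cases hr : Root E (c, d)
    · exact ⟨_, hr, Relation.ReflTransGen.refl⟩
    · have : ∃ y, RR E y (c, d) := by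
        by_contra hcon
        push Not at hcon
        exact hr ⟨hm, hcon⟩
      obtain ⟨⟨p, q⟩, hl⟩ := this
      have hcq : MM E c q := ⟨p, d, hl⟩
      have hq : ¬ Cyc E q := fun hq => hc (g.cyc_of_mm hcq hq)
      have hlt : {z | Relation.TransGen (MM E) q z}.ncard <
          {z | Relation.TransGen (MM E) c z}.ncard := by
        apply Set.ncard_lt_ncard _ (Set.toFinite _)
        refine ⟨fun z hz => Relation.TransGen.head hcq hz, fun hsub => ?_⟩
        exact hq (hsub (Relation.TransGen.single hcq))
      obtain ⟨r, hr1, hr2⟩ := ih q p (by omega) hl.m1.sym hq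
      exact ⟨r.swap, hr1.swp, (rr_swap hr2).tail hl⟩

theorem OGM.root_unique {E : V → V → Prop} (g : OGM E) {r s x : V × V} (hr : Root E r)
    (hs : Root E s) (h1 : Relation.ReflTransGen (RR E) r x)
    (h2 : Relation.ReflTransGen (RR E) s x) : r = s := by
  have aux : ∀ r s : V × V, Root E s → Relation.ReflTransGen (RR E) r s → r = s := by
    intro r s hs h
    rcases Relation.ReflTransGen.cases_tail h with h | ⟨y, _, h⟩
    · exact h.symm
    · exact absurd h (hs.2 y)
  induction h1 with
  | refl => exact (aux _ _ hr h2).symm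
  | @tail y z _ hyz ih =>
    rcases Relation.ReflTransGen.cases_tail h2 with h | ⟨w, hw, h⟩
    · subst h; exact absurd hyz (hs.2 y)
    · have : y = w := Prod.ext (g.in_unique hyz h).1 (g.in_unique hyz h).2
      subst this
      exact ih hw

/-- convenient orientation -/
def Conv (E : V → V → Prop) (a b : V) : Prop := ∀ v, E v a → ¬ E v b → b ∈ Npp E v

theorem OGM.root_good {E : V → V → Prop} (g : OGM E) {a b : V} (h : Root E (a, b)) :
    Conv E a b ∨ Conv E b a := by
  by_contra hc
  simp only [Conv] at hc
  push Not at hc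
  obtain ⟨⟨v, hva, hvb, hv⟩, ⟨u, hub, hua, hu⟩⟩ := hc
  have hm : IsMissing E a b := h.1
  have hv1 : v ≠ a := by rintro rfl; exact g.loop _ hva
  have hv2 : v ≠ b := by rintro rfl; exact hm.2.2 hva
  have hu1 : u ≠ b := by rintro rfl; exact g.loop _ hub
  have hu2 : u ≠ a := by rintro rfl; exact hm.2.1 hub
  have nv : ∀ w, E v w → ¬ E w b := fun w h1 h2 => hv ⟨hv2.symm, hvb, w, h1, h2⟩
  have nu : ∀ w, E u w → ¬ E w a := fun w h1 h2 => hu ⟨hu2.symm, hua, w, h1, h2⟩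
  have hbv : E b v := (g.adj hm.sym hv2 hv1).resolve_right hvb
  have hau : E a u := (g.adj hm hu2 hu1).resolve_right hua
  have hne : v ≠ u := by rintro rfl; exact hua hva
  refine h.2 (v, u) ⟨⟨hne, fun h => nv _ h hub, fun h => nu _ h hva⟩, hm, hva, hau, hub, hbv,
    nv, nu⟩

theorem OGM.orient [Finite V] {E : V → V → Prop} (g : OGM E) :
    ∃ O : V → V → Prop, (∀ a b, IsMissing E a b → (O a b ↔ ¬ O b a)) ∧
      ∀ a b, IsMissing E a b → ¬ Cyc E a → O a b →
        Conv E a b ∨ ∃ p q, Lz E p q a b ∧ O p q := by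
  classical
  obtain ⟨n, ⟨e⟩⟩ := Finite.exists_equiv_fin V
  have hlt : ∀ a b : V, a ≠ b → (e a < e b ↔ ¬ e b < e a) := by
    intro a b hab
    have : e a ≠ e b := fun h => hab (e.injective h)
    constructor
    · intro h; exact not_lt.2 h.le
    · intro h; exact lt_of_le_of_ne (not_lt.1 h) this
  let A0 : V × V → Prop := fun x => Conv E x.1 x.2 ∧ (Conv E x.2 x.1 → e x.1 < e x.2)
  have hA0 : ∀ r, Root E r → (A0 r ↔ ¬ A0 r.swap) := by
    rintro ⟨a, b⟩ hr
    have h1 := g.root_good hr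
    have h2 := hlt a b hr.1.1
    simp only [A0, Prod.swap]
    tauto
  let A : V × V → Prop := fun x => ∃ r, Root E r ∧ A0 r ∧ Relation.ReflTransGen (RR E) r x
  have hA : ∀ a b, IsMissing E a b → ¬ Cyc E a → (A (a, b) ↔ ¬ A (b, a)) := by
    intro a b hm hc
    obtain ⟨r, hr, hr'⟩ := g.root_exists _ a b (Nat.lt_succ_self _) hm hc
    have hs : Relation.ReflTransGen (RR E) r.swap (b, a) := rr_swap hr'
    have e1 : A (a, b) ↔ A0 r := by
      constructor
      · rintro ⟨s, h1, h2, h3⟩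
        rw [g.root_unique hr h1 hr' h3]; exact h2
      · intro h; exact ⟨r, hr, h, hr'⟩
    have e2 : A (b, a) ↔ A0 r.swap := by
      constructor
      · rintro ⟨s, h1, h2, h3⟩
        rw [g.root_unique hr.swp h1 hs h3]; exact h2
      · intro h; exact ⟨_, hr.swp, h, hs⟩
    rw [e1, e2]; exact hA0 r hr
  have hcs : ∀ a b, IsMissing E a b → Cyc E a → Cyc E b := fun a b hm h =>
    g.orb_cyc h (g.orb_partner h Relation.ReflTransGen.refl hm)
  refine ⟨fun a b => (¬ Cyc E a ∧ A (a, b)) ∨ (Cyc E a ∧ e a < e b), ?_, ?_⟩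
  · intro a b hm
    have h1 := hA a b hm
    have h2 := hlt a b hm.1
    by_cases hc : Cyc E a
    · have hc' : Cyc E b := hcs a b hm hc
      simp only [hc, hc', not_true_eq_false, false_and, false_or, true_and]
      exact h2
    · have hc' : ¬ Cyc E b := fun h => hc (hcs b a hm.sym h)
      simp only [hc, hc', not_false_eq_true, false_and, or_false, true_and]
      exact h1 hc
  · rintro a b hm hc (⟨_, hab⟩ | ⟨h, _⟩)
    · obtain ⟨r, h1, h2, h3⟩ := hab
      rcases Relation.ReflTransGen.cases_tail h3 with h | ⟨⟨p, q⟩, hw, h⟩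
      · subst h; left; exact h2.1
      · right
        refine ⟨p, q, h, Or.inl ⟨fun hp => hc ?_, r, h1, h2, hw⟩⟩
        have hl : Lz E p q a b := h
        exact g.cyc_of_mm ⟨p, b, hl⟩ (hcs p q hl.m1 hp)
    · exact absurd h hc

theorem OGM.main [Finite V] [Nonempty V] {E : V → V → Prop} (g : OGM E) :
    ∃ v, (Nplus E v).ncard ≤ (Npp E v).ncard := by
  classical
  obtain ⟨O, hO, hO2⟩ := g.orient
  let T : V → V → Prop := fun a b => E a b ∨ (IsMissing E a b ∧ O a b)
  have hanti : ∀ x y, T x y → ¬ T y x := by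
    rintro x y (h | ⟨h1, h2⟩) (h' | ⟨h1', h2'⟩)
    · exact g.dig _ _ h h'
    · exact h1'.2.2 h
    · exact h1.2.2 h'
    · exact (hO x y h1).1 h2 h2'
  have htot : ∀ x y, x ≠ y → T x y ∨ T y x := by
    intro x y hne
    by_cases hm : IsMissing E x y
    · have := hO x y hm
      have hm' := hm.sym
      simp only [T]
      tauto
    · simp only [IsMissing] at hm
      simp only [T]
      tauto
  -- errors created by the new arcs
  have err : ∀ f x y, E f x → ¬ E f y → IsMissing E x y → O x y → (Cyc E x → ¬ Orb E x f) →
      y ∈ Npp E f ∨ ∃ f', Lz E f f' x y ∧ O f f' := by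
    intro f x y hfx hfy hm hxy hcyc
    by_cases hx : Cyc E x
    · rcases g.cyc_both hx hm hfx with h | h
      · exact absurd h hfy
      · exact absurd h (hcyc hx)
    · rcases hO2 x y hm hx hxy with h | ⟨p, q, hl, hpq⟩
      · exact Or.inl (h f hfx hfy)
      · by_cases hfp : f = p
        · subst hfp; exact Or.inr ⟨q, hl, hpq⟩
        · left
          have hfq : f ≠ q := by rintro rfl; exact g.dig _ _ hfx hl.cb
          have hyf : y ≠ f := by rintro rfl; exact hm.2.2 hfx
          rcases g.adj hl.m1.sym hfq hfp with h | h
          · exact absurd hfx (hl.n2 _ h)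
          · exact ⟨hyf, hfy, q, h, hl.bd⟩
  obtain ⟨f, hf⟩ := havet_thomasse T hanti htot
  refine ⟨f, ?_⟩
  by_cases hc : Cyc E f
  · -- cyclic feed vertex
    let K : Set V := {v | Orb E f v}
    have hKp : ∀ x y, IsMissing E x y → x ∈ K → y ∈ K := fun x y hm hx => g.orb_partner hc hx hm
    have hKc : ∀ x, x ∈ K → Cyc E x := fun x hx => g.orb_cyc hc hx
    have hKs : ∀ x, x ∈ K → Orb E x f := fun x hx => g.orb_sym hc hx
    have hout : (Nplus E f \ K).ncard ≤ (Npp E f \ K).ncard := by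
      refine (hf (Nplus E f \ K) (fun x hx => Or.inl hx.1)).trans ?_
      apply Set.ncard_le_ncard _ (Set.toFinite _)
      rintro y ⟨hyf, hyS, x, ⟨hfx, hxK⟩, hxy⟩
      have hfx : E f x := hfx
      have hyK : y ∉ K := by
        intro hyK
        rcases hxy with hxy | ⟨hm, _⟩
        · rcases g.orb_step (hKs y hyK) hxy with h | ⟨x', h1, h2⟩
          · exact g.dig _ _ hfx h
          · exact hxK (hKp x' x h2.sym (Relation.ReflTransGen.trans hyK h1))
        · exact hxK (hKp y x hm.sym hyK)
      have hfy : ¬ E f y := fun h => hyS ⟨h, hyK⟩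
      refine ⟨?_, hyK⟩
      rcases hxy with hxy | ⟨hm, ho⟩
      · exact ⟨hyf, hfy, x, hfx, hxy⟩
      · rcases err f x y hfx hfy hm ho (fun hx h => hxK (g.orb_sym hx h)) with h | ⟨f', hl, _⟩
        · exact h
        · exfalso
          have hf' : f' ∈ K := hKp f f' hl.m1 Relation.ReflTransGen.refl
          have hM : MM E x f' := ⟨f, y, hl⟩
          have hx : Cyc E x := g.cyc_of_mm hM (hKc f' hf')
          exact hxK (Relation.ReflTransGen.trans hf'
            (g.orb_sym hx (Relation.ReflTransGen.single hM)))
    have hin : (Nplus E f ∩ K).ncard ≤ (Npp E f ∩ K).ncard := by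
      have hsucc : ∀ x ∈ Nplus E f ∩ K, ∃ c x' d, Lz E x x' c d ∧ c ∈ K := by
        rintro x ⟨_, hxK⟩
        obtain ⟨x', h1, h2⟩ := g.cyc_partner (hKc x hxK)
        have hx' : x' ∈ K := hKp x x' h2 hxK
        obtain ⟨c, hc', hM⟩ := Relation.TransGen.tail'_iff.1 (hKc x' hx')
        obtain ⟨p, d, hl⟩ := hM
        obtain rfl := g.mat _ _ _ h2.sym hl.m1.sym
        exact ⟨c, x', d, hl, Relation.ReflTransGen.trans hx' hc'⟩
      choose! s s' d hs hsK using hsucc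
      apply Set.ncard_le_ncard_of_injOn s _ _ (Set.toFinite _)
      · rintro x hx
        have hfx : E f x := hx.1
        have hl := hs x hx
        refine ⟨⟨?_, ?_, x, hfx, hl.ac⟩, hsK x hx⟩
        · intro h
          have := hl.ac
          rw [h] at this
          exact g.dig _ _ hfx this
        · intro hfc
          rcases g.mm_step ⟨x, d x, hl⟩ hfc with h | h
          · exact g.loop f (g.not_both (hKs x hx.2) _ hl.m1 hfx h).1
          · obtain rfl := g.mat _ _ _ h.sym hl.m1.sym
            exact g.loop _ hfx
      · intro x hx y hy hxy
        have h1 := hs x hx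
        have h2 := hs y hy
        rw [hxy] at h1
        rw [g.mat _ _ _ h1.m2 h2.m2] at h1
        exact (g.in_unique h1 h2).1
    rw [← Set.ncard_inter_add_ncard_sdiff_eq_ncard (Nplus E f) K (Set.toFinite _),
      ← Set.ncard_inter_add_ncard_sdiff_eq_ncard (Npp E f) K (Set.toFinite _)]
    omega
  · have hco : ∀ x, Cyc E x → ¬ Orb E x f := fun x hx h => hc (g.orb_cyc hx h)
    by_cases hex : ∃ f' x0 y0, Lz E f f' x0 y0 ∧ O f f'
    · obtain ⟨f', x0, y0, hl, ho⟩ := hex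
      have h1 := hf (Nplus E f ∪ {f'}) (by
        rintro x (hx | rfl)
        · exact Or.inl hx
        · exact Or.inr ⟨hl.m1, ho⟩)
      have h2 : (Nplus E f ∪ {f'}).ncard = (Nplus E f).ncard + 1 := by
        rw [Set.ncard_union_eq _ (Set.toFinite _) (Set.toFinite _), Set.ncard_singleton]
        rw [Set.disjoint_singleton_right]
        exact hl.m1.2.1
      have h3 : {y | y ≠ f ∧ y ∉ Nplus E f ∪ {f'} ∧ ∃ x ∈ Nplus E f ∪ {f'}, T x y} ⊆
          Npp E f ∪ {y0} := by
        rintro y ⟨hyf, hyS, x, hx, hxy⟩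
        have hfy : ¬ E f y := fun h => hyS (Or.inl h)
        have hyf' : y ≠ f' := fun h => hyS (Or.inr h)
        rcases hx with hx | hx
        · have hfx : E f x := hx
          rcases hxy with hxy | ⟨hm, hoxy⟩
          · exact Or.inl ⟨hyf, hfy, x, hfx, hxy⟩
          · rcases err f x y hfx hfy hm hoxy (hco x) with h | ⟨f'', hl', _⟩
            · exact Or.inl h
            · obtain rfl := g.mat _ _ _ hl.m1 hl'.m1
              exact Or.inr (g.out_unique hl hl').2.symm
        · obtain rfl : x = f' := hx
          rcases hxy with hxy | ⟨hm, _⟩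
          · by_cases hy0 : y = y0
            · exact Or.inr hy0
            · left
              have hyx0 : y ≠ x0 := by rintro rfl; exact hfy hl.ac
              rcases g.adj hl.m2 hyx0 hy0 with h | h
              · exact ⟨hyf, hfy, x0, hl.ac, h⟩
              · exact absurd h (hl.n2 _ hxy)
          · exact absurd (g.mat _ _ _ hm hl.m1.sym) hyf
      have h4 := Set.ncard_le_ncard h3 (Set.toFinite _)
      have h5 := Set.ncard_union_le (Npp E f) {y0}
      rw [Set.ncard_singleton] at h5
      omega
    · refine (hf (Nplus E f) (fun x hx => Or.inl hx)).trans ?_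
      apply Set.ncard_le_ncard _ (Set.toFinite _)
      rintro y ⟨hyf, hfy, x, hfx, hxy⟩
      rcases hxy with hxy | ⟨hm, hoxy⟩
      · exact ⟨hyf, hfy, x, hfx, hxy⟩
      · rcases err f x y hfx hfy hm hoxy (hco x) with h | ⟨f', hl, ho⟩
        · exact h
        · exact absurd ⟨f', x, y, hl, ho⟩ hex

theorem stmt_17 {V : Type*} [Fintype V] [Nonempty V]
    (E : V → V → Prop) (hloop : ∀ v, ¬ E v v) (hdigon : ∀ x y, ¬ (E x y ∧ E y x))
    (hmatch : ∀ a b c, IsMissing E a b → IsMissing E a c → b = c) :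
    ∃ v, (Nplus E v).ncard ≤ (Npp E v).ncard := by
  exact OGM.main ⟨hloop, fun x y h h2 => hdigon x y ⟨h, h2⟩, hmatch⟩
end
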